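/- Let W be a 2-dimensional complex vector space. A map Z' : 𝒦(W) → 𝒦(W) is a continuous, translation invariant and SL(W,ℂ)-covariant Minkowski valuation if and only if there exist convex bodies M, N ∈ 𝒦(ℂ) such that Z'K = D_M K + (Φ⁻¹ ∘ Π_N)K for all K ∈ 𝒦(W), where Φ : W → W* is the identification induced by the determinant map. -/

import Mathlib

open scoped Pointwise
open MeasureTheory Module

noncomputable section

section CommonDefs

variable {V V' A : Type*}
variable [NormedAddCommGroup V] [NormedSpace ℝ V]
variable [NormedAddCommGroup V'] [NormedSpace ℝ V']
variable [NormedAddCommGroup A] [NormedSpace ℝ A]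

/-- The supremum of a (pairing) functional over a convex body; used to express the
support function `h(K, ξ) = sup_{x ∈ K} ⟨ξ, x⟩` for the various pairings `p = ⟨ξ, ·⟩`. -/
def hSupp (K : ConvexBody V) (p : V → ℝ) : ℝ := sSup (p '' (K : Set V))

/-- The translate `x + K` of a convex body. -/
def ConvexBody.translate (K : ConvexBody V) (x : V) : ConvexBody V :=
  ⟨(fun y => x + y) '' (K : Set V), K.convex.translate x,
    K.isCompact.image (continuous_const.add continuous_id),
    K.nonempty.image _⟩

/-- The image of a convex body under a continuous linear map. -/
def ConvexBody.mapCLM (f : V →L[ℝ] V') (K : ConvexBody V) : ConvexBody V' :=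
  ⟨f '' (K : Set V), K.convex.linear_image (f : V →ₗ[ℝ] V'),
    K.isCompact.image f.continuous, K.nonempty.image _⟩

/-- The reflection `-K` of a convex body about the origin. -/
def ConvexBody.neg (K : ConvexBody V) : ConvexBody V :=
  K.mapCLM (-(ContinuousLinearMap.id ℝ V))

/-- The union of two convex bodies (a convex body provided it is convex). -/
def ConvexBody.union (K L : ConvexBody V) (h : Convex ℝ ((K : Set V) ∪ (L : Set V))) :
    ConvexBody V :=
  ⟨(K : Set V) ∪ (L : Set V), h, K.isCompact.union L.isCompact,
    K.nonempty.mono Set.subset_union_left⟩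

/-- The intersection of two convex bodies (a convex body provided it is nonempty). -/
def ConvexBody.inter (K L : ConvexBody V) (h : ((K : Set V) ∩ (L : Set V)).Nonempty) :
    ConvexBody V :=
  ⟨(K : Set V) ∩ (L : Set V), K.convex.inter L.convex,
    K.isCompact.inter_right L.isClosed, h⟩

/-- A Minkowski valuation: `Z(K ∪ L) + Z(K ∩ L) = Z(K) + Z(L)` (Minkowski addition)
whenever `K, L, K ∪ L` are convex bodies. -/
def IsMinkowskiValuation (Z : ConvexBody V → ConvexBody A) : Prop :=
  ∀ (K L : ConvexBody V) (hU : Convex ℝ ((K : Set V) ∪ (L : Set V)))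
    (hI : ((K : Set V) ∩ (L : Set V)).Nonempty),
    Z (K.union L hU) + Z (K.inter L hI) = Z K + Z L

/-- A real-valued valuation: `φ(K ∪ L) + φ(K ∩ L) = φ(K) + φ(L)`
whenever `K, L, K ∪ L` are convex bodies. -/
def IsValuation (φ : ConvexBody V → ℝ) : Prop :=
  ∀ (K L : ConvexBody V) (hU : Convex ℝ ((K : Set V) ∪ (L : Set V)))
    (hI : ((K : Set V) ∩ (L : Set V)).Nonempty),
    φ (K.union L hU) + φ (K.inter L hI) = φ K + φ L

/-- Translation invariance of a map defined on convex bodies. -/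
def IsTranslationInvariant {α : Type*} (Z : ConvexBody V → α) : Prop :=
  ∀ (K : ConvexBody V) (x : V), Z (K.translate x) = Z K

/-- The mixed volume (w.r.t. the Lebesgue (Haar) measure `μ`) of an `n`-tuple of convex
bodies, given by the polarization formula
`V(K₁, …, Kₙ) = (1/n!) ∑_{S ⊆ {1,…,n}} (-1)^{n - |S|} vol(∑_{i ∈ S} K_i)`. -/
def mixedVol [MeasurableSpace V] (μ : Measure V) {n : ℕ} (K : Fin n → ConvexBody V) : ℝ :=
  (n.factorial : ℝ)⁻¹ *
    ∑ S : Finset (Fin n), (-1 : ℝ) ^ (n - S.card) * (μ (∑ i ∈ S, (K i : Set V))).toReal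

/-- The extension `V(K, …, K, f)` (with `n - 1` copies of `K`) of the mixed volume to
continuous positively `1`-homogeneous functions `f` on the dual space, defined via
Aleksandrov's variational formula: `V(K,…,K,f)` is `1/n` times the right derivative at
`t = 0` of the volume of the Wulff shape (aka Aleksandrov body) of `h_K + t f`.
For `f = h_L` the Wulff shape is `K + t L`, so this indeed extends `L ↦ V(K, …, K, L)`. -/
def mixedVolFn [MeasurableSpace V] (μ : Measure V) (K : ConvexBody V)
    (f : (V →L[ℝ] ℝ) → ℝ) : ℝ :=
  (Module.finrank ℝ V : ℝ)⁻¹ *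
    derivWithin (fun t : ℝ =>
        (μ {x : V | ∀ ξ : V →L[ℝ] ℝ, ξ x ≤ hSupp K ξ + t * f ξ}).toReal)
      (Set.Ici 0) 0

/-- The dimension of a convex body: the dimension of (the direction of) its affine hull. -/
def bodyDim (K : ConvexBody V) : ℕ := Module.finrank ℝ (vectorSpan ℝ (K : Set V))

/-- A convex body contained in a subspace `E`, viewed as a convex body of `E`. -/
def bodyIn (E : Submodule ℝ V) (K : ConvexBody V) (h : (K : Set V) ⊆ (E : Set V)) :
    ConvexBody ↥E :=
  ⟨Subtype.val ⁻¹' (K : Set V),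
    K.convex.linear_preimage (E.subtype),
    by
      rw [Topology.IsEmbedding.subtypeVal.isCompact_iff,
        Set.image_preimage_eq_of_subset (by rw [Subtype.range_coe]; exact h)]
      exact K.isCompact,
    by obtain ⟨x, hx⟩ := K.nonempty; exact ⟨⟨x, h hx⟩, hx⟩⟩

/-- The properties of the components of McMullen's decomposition of (the support function
of) a Minkowski valuation: each `fᵢ(·, u)` is a continuous, translation invariant
valuation, homogeneous of degree `i`, and each `fᵢ(K, ·)` is continuous and positively
`1`-homogeneous. -/
def McMullenProps (f : ℕ → ConvexBody V → V → ℝ) : Prop :=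
  (∀ (i : ℕ) (u : V), Continuous fun K : ConvexBody V => f i K u) ∧
  (∀ (i : ℕ) (u : V), IsValuation fun K : ConvexBody V => f i K u) ∧
  (∀ (i : ℕ) (u : V), IsTranslationInvariant fun K : ConvexBody V => f i K u) ∧
  (∀ (i : ℕ) (K : ConvexBody V) (u : V) (t : ℝ), 0 < t → f i (t • K) u = t ^ i * f i K u) ∧
  (∀ (i : ℕ) (K : ConvexBody V), Continuous fun u : V => f i K u) ∧
  (∀ (i : ℕ) (K : ConvexBody V) (u : V) (t : ℝ), 0 < t → f i K (t • u) = t * f i K u)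

end CommonDefs

/-- The surface area measure `S(M, ·)` on `S¹ ⊆ ℂ` of a planar convex body `M`,
characterized (uniquely) by the property that it is a finite measure concentrated on the
unit circle with `∫_{S¹} h(L, α) dσ(α) = 2 V(M, L)` for every planar convex body `L`. -/
def IsSurfaceAreaMeasure (M : ConvexBody ℂ) (σ : Measure ℂ) : Prop :=
  IsFiniteMeasure σ ∧ σ (Metric.sphere (0 : ℂ) 1)ᶜ = 0 ∧
    ∀ L : ConvexBody ℂ,
      (∫ α, hSupp L (fun c => (c * (starRingEnd ℂ) α).re) ∂σ) = 2 * mixedVol volume ![M, L]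

section ComplexDefs

variable {W : Type*} [NormedAddCommGroup W] [NormedSpace ℂ W] [FiniteDimensional ℂ W]

/-- The determinant pairing `det(u, v)` on a 2-dimensional complex vector space,
with respect to a fixed basis `b`. -/
def cdet (b : Basis (Fin 2) ℂ W) (u v : W) : ℂ :=
  b.coord 0 u * b.coord 1 v - b.coord 1 u * b.coord 0 v

/-- `det(·, w) : W → ℂ` as a continuous real-linear map. -/
def cdetCLM (b : Basis (Fin 2) ℂ W) (w : W) : W →L[ℝ] ℂ :=
  LinearMap.toContinuousLinearMap
    (((b.coord 1 w) • (b.coord 0 : W →ₗ[ℂ] ℂ)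
      - (b.coord 0 w) • (b.coord 1 : W →ₗ[ℂ] ℂ)).restrictScalars ℝ)

/-- `det(K, w) = {det(k, w) : k ∈ K} ⊆ ℂ`. -/
def detBody (b : Basis (Fin 2) ℂ W) (K : ConvexBody W) (w : W) : ConvexBody ℂ :=
  K.mapCLM (cdetCLM b w)

/-- `N · w = {c • w : c ∈ N} ⊆ W` for a planar convex body `N ⊆ ℂ`. -/
def dotBody (N : ConvexBody ℂ) (w : W) : ConvexBody W :=
  N.mapCLM (LinearMap.toContinuousLinearMap ((LinearMap.toSpanSingleton ℂ W w).restrictScalars ℝ))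

/-- A complex-linear endomorphism, as a continuous real-linear map. -/
def cReal (g : W →ₗ[ℂ] W) : W →L[ℝ] W :=
  LinearMap.toContinuousLinearMap (g.restrictScalars ℝ)

/-- Precomposition `ξ ↦ ξ ∘ g` on the complex dual `W* = W →L[ℂ] ℂ`,
as a continuous real-linear map. The adjoint of `g` is `precompDual g`, and
`g^{-*} = precompDual g⁻¹`. -/
def precompDual (g : W →L[ℂ] W) : (W →L[ℂ] ℂ) →L[ℝ] (W →L[ℂ] ℂ) :=
  LinearMap.toContinuousLinearMap
    { toFun := fun ξ => ξ.comp g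
      map_add' := fun ξ η => ContinuousLinearMap.add_comp ξ η g
      map_smul' := fun r ξ => ContinuousLinearMap.smul_comp r ξ g }

/-- `Z : 𝒦(W) → 𝒦(W*)` is `SL(W,ℂ)`-contravariant: `Z(gK) = g^{-*} Z(K)` for every
`g ∈ SL(W,ℂ)`. -/
def IsSLContravariant (Z : ConvexBody W → ConvexBody (W →L[ℂ] ℂ)) : Prop :=
  ∀ g : W ≃L[ℂ] W, LinearMap.det ((g : W →L[ℂ] W) : W →ₗ[ℂ] W) = 1 →
    ∀ K : ConvexBody W,
      Z (K.mapCLM (cReal (g : W →ₗ[ℂ] W))) =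
        (Z K).mapCLM (precompDual (g.symm : W →L[ℂ] W))

/-- `Z : 𝒦(W) → 𝒦(W)` is `SL(W,ℂ)`-covariant: `Z(gK) = g Z(K)` for every
`g ∈ SL(W,ℂ)`. -/
def IsSLCovariant (Z : ConvexBody W → ConvexBody W) : Prop :=
  ∀ g : W ≃L[ℂ] W, LinearMap.det ((g : W →L[ℂ] W) : W →ₗ[ℂ] W) = 1 →
    ∀ K : ConvexBody W,
      Z (K.mapCLM (cReal (g : W →ₗ[ℂ] W))) = (Z K).mapCLM (cReal (g : W →ₗ[ℂ] W))

end ComplexDefs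

namespace ConvexBody

section Topology

variable {V V' X : Type*} [NormedAddCommGroup V] [NormedSpace ℝ V]
  [NormedAddCommGroup V'] [NormedSpace ℝ V'] [TopologicalSpace X]

theorem dist_le_of_mem {K L : ConvexBody V} {r : ℝ} (hr : 0 ≤ r)
    (h₁ : ∀ x ∈ K, ∃ y ∈ L, dist x y ≤ r) (h₂ : ∀ y ∈ L, ∃ x ∈ K, dist x y ≤ r) :
    dist K L ≤ r := by
  rw [← hausdorffDist_coe]
  refine Metric.hausdorffDist_le_of_mem_dist hr h₁ fun y hy => ?_
  obtain ⟨x, hx, h⟩ := h₂ y hy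
  exact ⟨x, hx, by rwa [dist_comm]⟩

theorem exists_dist_le (K L : ConvexBody V) {x : V} (hx : x ∈ K) :
    ∃ y ∈ L, dist x y ≤ dist K L := by
  obtain ⟨y, hy, h⟩ := L.isCompact.exists_infDist_eq_dist L.nonempty x
  refine ⟨y, hy, ?_⟩
  rw [← h, ← hausdorffDist_coe]
  exact Metric.infDist_le_hausdorffDist_of_mem hx hausdorffEDist_ne_top

theorem mem_add_iff {K L : ConvexBody V} {x : V} :
    x ∈ K + L ↔ ∃ k ∈ K, ∃ l ∈ L, k + l = x := Iff.rfl

theorem mem_smul_iff {K : ConvexBody V} {r : ℝ} {x : V} :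
    x ∈ r • K ↔ ∃ k ∈ K, r • k = x := Iff.rfl

theorem mem_mapCLM_iff {K : ConvexBody V} {f : V →L[ℝ] V'} {x : V'} :
    x ∈ K.mapCLM f ↔ ∃ k ∈ K, f k = x := Iff.rfl

theorem coe_mapCLM (K : ConvexBody V) (f : V →L[ℝ] V') :
    (K.mapCLM f : Set V') = f '' K := rfl

theorem coe_translate (K : ConvexBody V) (x : V) :
    (K.translate x : Set V) = (fun y => x + y) '' K := rfl

theorem mem_coe' {K : ConvexBody V} {x : V} : x ∈ (K : Set V) ↔ x ∈ K := Iff.rfl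

theorem dist_add_add_le' (K L M N : ConvexBody V) :
    dist (K + M) (L + N) ≤ dist K L + dist M N := by
  have key : ∀ K L M N : ConvexBody V, ∀ x ∈ K + M, ∃ y ∈ L + N,
      dist x y ≤ dist K L + dist M N := by
    rintro K L M N _ ⟨k, hk, m, hm, rfl⟩
    obtain ⟨l, hl, h₁⟩ := exists_dist_le K L hk
    obtain ⟨n, hn, h₂⟩ := exists_dist_le M N hm
    exact ⟨l + n, ⟨l, hl, n, hn, rfl⟩, (dist_add_add_le _ _ _ _).trans (add_le_add h₁ h₂)⟩
  refine dist_le_of_mem (by positivity) (key K L M N) fun y hy => ?_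
  obtain ⟨x, hx, h⟩ := key L K N M y hy
  exact ⟨x, hx, by rwa [dist_comm, dist_comm K, dist_comm M]⟩

instance : ContinuousAdd (ConvexBody V) := by
  refine ⟨LipschitzWith.continuous (K := 2) (LipschitzWith.of_dist_le_mul fun p q => ?_)⟩
  refine (dist_add_add_le' _ _ _ _).trans ?_
  have h₁ : dist p.1 q.1 ≤ dist p q := le_max_left _ _
  have h₂ : dist p.2 q.2 ≤ dist p q := le_max_right _ _
  push_cast
  linarith

theorem dist_mapCLM_le (f : V →L[ℝ] V') (K L : ConvexBody V) :
    dist (K.mapCLM f) (L.mapCLM f) ≤ ‖f‖ * dist K L := by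
  refine dist_le_of_mem (by positivity) ?_ ?_
  · rintro _ ⟨k, hk, rfl⟩
    obtain ⟨l, hl, h⟩ := exists_dist_le K L hk
    refine ⟨f l, ⟨l, hl, rfl⟩, (f.dist_le_opNorm _ _).trans ?_⟩
    gcongr
  · rintro _ ⟨k, hk, rfl⟩
    obtain ⟨l, hl, h⟩ := exists_dist_le L K hk
    refine ⟨f l, ⟨l, hl, rfl⟩, (f.dist_le_opNorm _ _).trans ?_⟩
    rw [dist_comm, dist_comm K]
    gcongr

theorem exists_norm_le (K : ConvexBody V) : ∃ C, 0 < C ∧ ∀ x ∈ K, ‖x‖ ≤ C :=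
  K.isBounded.exists_pos_norm_le

theorem dist_mapCLM_mapCLM_le (f g : V →L[ℝ] V') (K : ConvexBody V) {C : ℝ} (hC : 0 ≤ C)
    (h : ∀ x ∈ K, ‖x‖ ≤ C) : dist (K.mapCLM f) (K.mapCLM g) ≤ ‖f - g‖ * C := by
  have key : ∀ x ∈ K, dist (f x) (g x) ≤ ‖f - g‖ * C := fun x hx => by
    rw [dist_eq_norm, ← sub_apply]
    exact (ContinuousLinearMap.le_opNorm _ _).trans (by gcongr; exact h x hx)
  refine dist_le_of_mem (by positivity) ?_ ?_
  · rintro _ ⟨k, hk, rfl⟩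
    exact ⟨g k, ⟨k, hk, rfl⟩, key k hk⟩
  · rintro _ ⟨k, hk, rfl⟩
    exact ⟨f k, ⟨k, hk, rfl⟩, key k hk⟩

theorem continuous_mapCLM {f : X → V →L[ℝ] V'} {K : X → ConvexBody V} (hf : Continuous f)
    (hK : Continuous K) : Continuous fun x => (K x).mapCLM (f x) := by
  rw [continuous_iff_continuousAt]
  intro x₀
  obtain ⟨C, hC, hb⟩ := (K x₀).exists_norm_le
  rw [ContinuousAt, tendsto_iff_dist_tendsto_zero]
  have h : Filter.Tendsto (fun x => ‖f x‖ * dist (K x) (K x₀) + ‖f x - f x₀‖ * C) (nhds x₀)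
      (nhds (‖f x₀‖ * dist (K x₀) (K x₀) + ‖f x₀ - f x₀‖ * C)) :=
    Continuous.tendsto (by fun_prop) x₀
  simp only [dist_self, mul_zero, sub_self, norm_zero, zero_mul, add_zero] at h
  refine squeeze_zero (fun _ => dist_nonneg) (fun x => ?_) h
  refine (dist_triangle _ ((K x₀).mapCLM (f x)) _).trans (add_le_add ?_ ?_)
  · exact dist_mapCLM_le _ _ _
  · exact dist_mapCLM_mapCLM_le _ _ _ hC.le hb

theorem smul_eq_mapCLM (r : ℝ) (K : ConvexBody V) :
    r • K = K.mapCLM (r • ContinuousLinearMap.id ℝ V) := by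
  ext x
  simp [Set.mem_smul_set, mem_mapCLM_iff]

instance : ContinuousSMul ℝ (ConvexBody V) := by
  refine ⟨?_⟩
  simp only [smul_eq_mapCLM]
  exact continuous_mapCLM (by fun_prop) continuous_snd

theorem mapCLM_add (f : V →L[ℝ] V') (K L : ConvexBody V) :
    (K + L).mapCLM f = K.mapCLM f + L.mapCLM f :=
  ConvexBody.ext (Set.image_add f)

theorem mapCLM_smul (f : V →L[ℝ] V') (r : ℝ) (K : ConvexBody V) :
    (r • K).mapCLM f = r • K.mapCLM f := by
  apply ConvexBody.ext
  simp only [coe_mapCLM, coe_smul]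
  exact Set.image_smul_comm f r _ (fun x => map_smul f r x)

theorem mapCLM_mapCLM {V'' : Type*} [NormedAddCommGroup V''] [NormedSpace ℝ V'']
    (f : V →L[ℝ] V') (g : V' →L[ℝ] V'') (K : ConvexBody V) :
    (K.mapCLM f).mapCLM g = K.mapCLM (g.comp f) :=
  ConvexBody.ext (Set.image_image g f _)

theorem mapCLM_id (K : ConvexBody V) : K.mapCLM (ContinuousLinearMap.id ℝ V) = K :=
  ConvexBody.ext (Set.image_id' _)

theorem mapCLM_congr {f g : V →L[ℝ] V'} {K : ConvexBody V} (h : ∀ x ∈ K, f x = g x) :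
    K.mapCLM f = K.mapCLM g :=
  ConvexBody.ext (Set.image_congr h)

theorem add_smul' (K : ConvexBody V) {r s : ℝ} (hr : 0 ≤ r) (hs : 0 ≤ s) :
    (r + s) • K = r • K + s • K :=
  ConvexBody.ext (K.convex.add_smul hr hs)

theorem one_smul' (K : ConvexBody V) : (1 : ℝ) • K = K := one_smul ℝ K

theorem zero_smul' (K : ConvexBody V) : (0 : ℝ) • K = 0 :=
  ConvexBody.ext (Set.zero_smul_set K.nonempty)

/-- A point as a convex body. -/
def pt (x : V) : ConvexBody V :=
  ⟨{x}, convex_singleton x, isCompact_singleton, Set.singleton_nonempty x⟩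

theorem coe_pt (x : V) : (pt x : Set V) = {x} := rfl

@[simp] theorem mem_pt {x y : V} : y ∈ pt x ↔ y = x := Iff.rfl

theorem pt_zero : pt (0 : V) = 0 := rfl

theorem add_pt (K : ConvexBody V) (x : V) : K + pt x = K.translate x := by
  ext y
  simp only [mem_coe', mem_add_iff, mem_pt, coe_translate, Set.mem_image]
  constructor
  · rintro ⟨k, hk, _, rfl, rfl⟩
    exact ⟨k, hk, add_comm _ _⟩
  · rintro ⟨k, hk, rfl⟩
    exact ⟨k, hk, x, rfl, add_comm _ _⟩

theorem smul_pt (r : ℝ) (x : V) : r • pt x = pt (r • x) :=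
  ConvexBody.ext Set.smul_set_singleton

theorem mapCLM_pt (f : V →L[ℝ] V') (x : V) : (pt x).mapCLM f = pt (f x) :=
  ConvexBody.ext Set.image_singleton

open Classical in
/-- The convex hull of a finite nonempty set, as a convex body. -/
def hull (s : Set V) : ConvexBody V :=
  if h : s.Finite ∧ s.Nonempty then
    ⟨convexHull ℝ s, convex_convexHull ℝ s, h.1.isCompact_convexHull ℝ, h.2.convexHull⟩
  else 0

theorem coe_hull {s : Set V} (hs : s.Finite) (hn : s.Nonempty) :
    (hull s : Set V) = convexHull ℝ s := by
  rw [hull, dif_pos ⟨hs, hn⟩]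
  rfl

theorem hull_singleton (x : V) : hull {x} = pt x :=
  ConvexBody.ext (by rw [coe_hull (by simp) (by simp), convexHull_singleton]; rfl)

theorem coe_hull_pair (x y : V) : (hull {x, y} : Set V) = segment ℝ x y := by
  rw [coe_hull (by simp) (by simp), convexHull_pair]

theorem mapCLM_hull (f : V →L[ℝ] V') {s : Set V} (hs : s.Finite) (hn : s.Nonempty) :
    (hull s).mapCLM f = hull (f '' s) :=
  ConvexBody.ext (by
    rw [coe_mapCLM, coe_hull hs hn, coe_hull (hs.image _) (hn.image _)]
    exact (f : V →ₗ[ℝ] V').image_convexHull s)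

theorem hull_add_hull {s t : Set V} (hs : s.Finite) (hn : s.Nonempty) (ht : t.Finite)
    (hm : t.Nonempty) : hull s + hull t = hull (s + t) :=
  ConvexBody.ext (by
    rw [coe_add, coe_hull hs hn, coe_hull ht hm, coe_hull (hs.add ht) (hn.add hm), convexHull_add])

theorem dist_hull_range_le {ι : Type*} [Finite ι] [Nonempty ι] {P Q : ι → V} {r : ℝ}
    (hr : 0 ≤ r) (h : ∀ i, dist (P i) (Q i) ≤ r) :
    dist (hull (Set.range P)) (hull (Set.range Q)) ≤ r := by
  have key : ∀ P Q : ι → V, (∀ i, dist (P i) (Q i) ≤ r) → ∀ x ∈ hull (Set.range P),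
      ∃ y ∈ hull (Set.range Q), dist x y ≤ r := by
    intro P Q h x hx
    have hsub : (hull (Set.range P) : Set V) ⊆
        (hull (Set.range Q) : Set V) + Metric.closedBall (0 : V) r := by
      rw [coe_hull (Set.finite_range P) (Set.range_nonempty P)]
      refine convexHull_min ?_ ((hull (Set.range Q)).convex.add (convex_closedBall _ _))
      rintro _ ⟨i, rfl⟩
      refine ⟨Q i, ?_, P i - Q i, ?_, by simp⟩
      · rw [coe_hull (Set.finite_range Q) (Set.range_nonempty Q)]
        exact subset_convexHull _ _ ⟨i, rfl⟩
      · rw [mem_closedBall_zero_iff, ← dist_eq_norm]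
        exact h i
    obtain ⟨y, hy, z, hz, rfl⟩ := hsub hx
    exact ⟨y, hy, by simpa using hz⟩
  refine dist_le_of_mem hr (key P Q h) fun y hy => ?_
  obtain ⟨x, hx, hxy⟩ := key Q P (fun i => by rw [dist_comm]; exact h i) y hy
  exact ⟨x, hx, by rwa [dist_comm]⟩

theorem continuous_hull_range {ι : Type*} [Fintype ι] [Nonempty ι] {P : X → ι → V}
    (hP : Continuous P) : Continuous fun x => hull (Set.range (P x)) := by
  have : Continuous fun Q : ι → V => hull (Set.range Q) :=
    (LipschitzWith.of_dist_le_mul (K := 1) fun P Q => by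
      simp only [NNReal.coe_one, one_mul]
      exact dist_hull_range_le dist_nonneg (fun i => dist_le_pi_dist P Q i)).continuous
  exact this.comp hP

theorem continuous_hull_pair {a b : X → V} (ha : Continuous a) (hb : Continuous b) :
    Continuous fun x => hull {a x, b x} := by
  have := continuous_hull_range (P := fun x => ![a x, b x])
    (continuous_pi fun i => by fin_cases i <;> simpa)
  simpa [Matrix.range_cons, Matrix.range_empty, Set.pair_comm] using this

theorem continuous_hull_triple {a b c : X → V} (ha : Continuous a) (hb : Continuous b)
    (hc : Continuous c) : Continuous fun x => hull {a x, b x, c x} := by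
  have := continuous_hull_range (P := fun x => ![a x, b x, c x])
    (continuous_pi fun i => by fin_cases i <;> simpa)
  convert this using 3
  ext y
  simp only [Set.mem_insert_iff, Set.mem_singleton_iff, Matrix.range_cons, Matrix.range_empty,
    Set.union_empty, Set.mem_union]

/-- Polytopes are dense. -/
theorem exists_hull_dist_le (K : ConvexBody V) {ε : ℝ} (hε : 0 < ε) (t : Set V)
    (ht : t.Finite) (htK : t ⊆ K) :
    ∃ s : Set V, s.Finite ∧ s.Nonempty ∧ t ⊆ s ∧ s ⊆ K ∧ dist (hull s) K ≤ ε := by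
  obtain ⟨s, hsK, hs, hcov⟩ := K.isCompact.finite_cover_balls hε
  obtain ⟨x₀, hx₀⟩ := K.nonempty
  have hfin : (insert x₀ (s ∪ t)).Finite := (hs.union ht).insert _
  have hsub : insert x₀ (s ∪ t) ⊆ (K : Set V) :=
    Set.insert_subset hx₀ (Set.union_subset hsK htK)
  refine ⟨insert x₀ (s ∪ t), hfin, Set.insert_nonempty _ _,
    fun y hy => Set.mem_insert_of_mem _ (Or.inr hy), hsub, ?_⟩
  have hc := coe_hull hfin (Set.insert_nonempty _ _)
  refine dist_le_of_mem hε.le (fun x hx => ⟨x, ?_, by simpa using hε.le⟩) fun y hy => ?_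
  · have : x ∈ convexHull ℝ (insert x₀ (s ∪ t)) := hc ▸ hx
    exact convexHull_min hsub K.convex this
  · obtain ⟨x, hx, hxy⟩ := Set.mem_iUnion₂.1 (hcov hy)
    refine ⟨x, ?_, by rw [dist_comm]; exact (Metric.mem_ball.1 hxy).le⟩
    have : x ∈ (hull (insert x₀ (s ∪ t)) : Set V) := by
      rw [hc]; exact subset_convexHull _ _ (by simp [hx])
    exact this

theorem eq_of_forall_hull {F G : ConvexBody V → ℝ} (hF : Continuous F) (hG : Continuous G)
    (h : ∀ s : Set V, s.Finite → s.Nonempty → F (hull s) = G (hull s)) (K : ConvexBody V) :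
    F K = G K := by
  have hcl : IsClosed {K : ConvexBody V | F K = G K} := isClosed_eq hF hG
  refine hcl.closure_subset (Metric.mem_closure_iff.2 fun ε hε => ?_)
  obtain ⟨s, hs, hn, -, -, hd⟩ := K.exists_hull_dist_le (half_pos hε) ∅ Set.finite_empty
    (Set.empty_subset _)
  exact ⟨hull s, h s hs hn, by rw [dist_comm]; linarith⟩

end Topology

end ConvexBody

open ConvexBody

section Valuations

variable {V V' : Type*} [NormedAddCommGroup V] [NormedSpace ℝ V]
  [NormedAddCommGroup V'] [NormedSpace ℝ V']

/-- If the union of two closed convex sets is convex, then every segment joining a point of the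
first to a point of the second meets the intersection. -/
theorem exists_segment_mem_inter {K M : ConvexBody V}
    (hU : Convex ℝ ((K : Set V) ∪ (M : Set V))) {k m : V} (hk : k ∈ K) (hm : m ∈ M) :
    ∃ a b : ℝ, 0 ≤ a ∧ 0 ≤ b ∧ a + b = 1 ∧ a • k + b • m ∈ K ∧ a • k + b • m ∈ M := by
  have hseg : segment ℝ k m ⊆ (K : Set V) ∪ M := hU.segment_subset (Or.inl hk) (Or.inr hm)
  have hpc : IsPreconnected (segment ℝ k m) := (convex_segment k m).isPreconnected
  obtain ⟨x, ⟨a, b, ha, hb, hab, rfl⟩, hx⟩ := isPreconnected_closed_iff.1 hpc K M K.isClosed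
    M.isClosed hseg ⟨k, left_mem_segment _ _ _, hk⟩ ⟨m, right_mem_segment _ _ _, hm⟩
  exact ⟨a, b, ha, hb, hab, hx.1, hx.2⟩

/-- Continuous, translation invariant real valuations on convex bodies. -/
structure CTVal (φ : ConvexBody V → ℝ) : Prop where
  cont : Continuous φ
  transl : IsTranslationInvariant φ
  val : IsValuation φ

namespace CTVal

variable {φ χ : ConvexBody V → ℝ}

theorem val_eq (h : CTVal φ) {U I K L : ConvexBody V} (h₁ : ∀ x ∈ K, x ∈ U)
    (h₂ : ∀ x ∈ L, x ∈ U) (h₃ : ∀ x ∈ U, x ∈ K ∨ x ∈ L) (h₄ : ∀ x ∈ I, x ∈ K ∧ x ∈ L)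
    (h₅ : ∀ x ∈ K, x ∈ L → x ∈ I) : φ U + φ I = φ K + φ L := by
  have e₁ : (U : Set V) = (K : Set V) ∪ (L : Set V) :=
    Set.ext fun x => ⟨h₃ x, fun hx => hx.elim (h₁ x) (h₂ x)⟩
  have e₂ : (I : Set V) = (K : Set V) ∩ L := Set.ext fun x => ⟨h₄ x, fun hx => h₅ x hx.1 hx.2⟩
  have hU : Convex ℝ ((K : Set V) ∪ (L : Set V)) := e₁ ▸ U.convex
  have hI : ((K : Set V) ∩ (L : Set V)).Nonempty := e₂ ▸ I.nonempty
  rw [show U = K.union L hU from ConvexBody.ext e₁, show I = K.inter L hI from ConvexBody.ext e₂]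
  exact h.val K L hU hI

theorem add_pt (h : CTVal φ) (K : ConvexBody V) (x : V) : φ (K + pt x) = φ K := by
  rw [ConvexBody.add_pt, h.transl]

theorem comp (h : CTVal φ) (f : V' →L[ℝ] V) (L : ConvexBody V) :
    CTVal fun K : ConvexBody V' => φ (K.mapCLM f + L) where
  cont := h.cont.comp ((continuous_mapCLM continuous_const continuous_id).add continuous_const)
  transl K x := by
    simp only
    rw [← ConvexBody.add_pt, mapCLM_add, mapCLM_pt, add_right_comm, h.add_pt]
  val K M hU hI := by
    apply h.val_eq
    · rintro _ ⟨_, ⟨k, hk, rfl⟩, l, hl, rfl⟩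
      exact ⟨_, ⟨k, Or.inl hk, rfl⟩, l, hl, rfl⟩
    · rintro _ ⟨_, ⟨k, hk, rfl⟩, l, hl, rfl⟩
      exact ⟨_, ⟨k, Or.inr hk, rfl⟩, l, hl, rfl⟩
    · rintro _ ⟨_, ⟨k, hk | hk, rfl⟩, l, hl, rfl⟩
      · exact Or.inl ⟨_, ⟨k, hk, rfl⟩, l, hl, rfl⟩
      · exact Or.inr ⟨_, ⟨k, hk, rfl⟩, l, hl, rfl⟩
    · rintro _ ⟨_, ⟨k, hk, rfl⟩, l, hl, rfl⟩
      exact ⟨⟨_, ⟨k, hk.1, rfl⟩, l, hl, rfl⟩, ⟨_, ⟨k, hk.2, rfl⟩, l, hl, rfl⟩⟩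
    · rintro _ ⟨_, ⟨k, hk, rfl⟩, l, hl, rfl⟩ ⟨_, ⟨m, hm, rfl⟩, l', hl', heq⟩
      obtain ⟨a, b, ha, hb, hab, h₁, h₂⟩ := exists_segment_mem_inter hU hk hm
      refine ⟨_, ⟨a • k + b • m, ⟨h₁, h₂⟩, rfl⟩, a • l + b • l', L.convex hl hl' ha hb hab, ?_⟩
      change f m + l' = f k + l at heq
      calc f (a • k + b • m) + (a • l + b • l')
          = a • (f k + l) + b • (f m + l') := by rw [map_add, map_smul, map_smul]; module
        _ = (a + b) • (f k + l) := by rw [heq]; module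
        _ = f k + l := by rw [hab, one_smul]

theorem comp_map (h : CTVal φ) (f : V' →L[ℝ] V) :
    CTVal fun K : ConvexBody V' => φ (K.mapCLM f) := by
  simpa using h.comp f 0

theorem comp_smul_add (h : CTVal φ) (r : ℝ) (L : ConvexBody V) :
    CTVal fun K : ConvexBody V => φ (r • K + L) := by
  simpa only [smul_eq_mapCLM] using h.comp (r • ContinuousLinearMap.id ℝ V) L

theorem comp_add (h : CTVal φ) (L : ConvexBody V) : CTVal fun K : ConvexBody V => φ (K + L) := by
  simpa using h.comp_smul_add 1 L

theorem comp_smul (h : CTVal φ) (r : ℝ) : CTVal fun K : ConvexBody V => φ (r • K) := by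
  simpa using h.comp_smul_add r 0

theorem add (h : CTVal φ) (h' : CTVal χ) : CTVal fun K => φ K + χ K where
  cont := h.cont.add h'.cont
  transl K x := by simp only [h.transl K x, h'.transl K x]
  val K L hU hI := by
    have := h.val K L hU hI
    have := h'.val K L hU hI
    simp only
    linarith

theorem const_mul (h : CTVal φ) (c : ℝ) : CTVal fun K => c * φ K where
  cont := h.cont.const_mul c
  transl K x := by simp only [h.transl K x]
  val K L hU hI := by simp only [← mul_add, h.val K L hU hI]

theorem sub (h : CTVal φ) (h' : CTVal χ) : CTVal fun K => φ K - χ K := by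
  convert h.add (h'.const_mul (-1)) using 2
  ring

theorem zero : CTVal fun _ : ConvexBody V => (0 : ℝ) where
  cont := continuous_const
  transl _ _ := rfl
  val _ _ _ _ := rfl

end CTVal

end Valuations

section EdgeSplit

variable {V : Type*} [NormedAddCommGroup V] [NormedSpace ℝ V]

theorem mem_convexHull_insert_iff {a : V} {s : Set V} (hs : s.Nonempty) {x : V} :
    x ∈ convexHull ℝ (insert a s) ↔
      ∃ t ∈ convexHull ℝ s, ∃ α γ : ℝ, 0 ≤ α ∧ 0 ≤ γ ∧ α + γ = 1 ∧ x = α • a + γ • t := by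
  rw [convexHull_insert hs, mem_convexJoin]
  constructor
  · rintro ⟨_, rfl, t, ht, α, γ, hα, hγ, h, rfl⟩
    exact ⟨t, ht, α, γ, hα, hγ, h, rfl⟩
  · rintro ⟨t, ht, α, γ, hα, hγ, h, rfl⟩
    exact ⟨a, rfl, t, ht, α, γ, hα, hγ, h, rfl⟩

theorem mem_convexHull_insert_insert_iff {a b : V} {s : Set V} (hs : s.Nonempty) {x : V} :
    x ∈ convexHull ℝ (insert a (insert b s)) ↔
      ∃ t ∈ convexHull ℝ s, ∃ α β γ : ℝ, 0 ≤ α ∧ 0 ≤ β ∧ 0 ≤ γ ∧ α + β + γ = 1 ∧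
        x = α • a + β • b + γ • t := by
  constructor
  · rw [mem_convexHull_insert_iff (Set.insert_nonempty _ _)]
    rintro ⟨y, hy, α, δ, hα, hδ, h, rfl⟩
    obtain ⟨t, ht, β, γ, hβ, hγ, h', rfl⟩ := (mem_convexHull_insert_iff hs).1 hy
    refine ⟨t, ht, α, δ * β, δ * γ, hα, by positivity, by positivity, ?_, by module⟩
    rw [add_assoc, ← mul_add, h', mul_one, h]
  · rintro ⟨t, ht, α, β, γ, hα, hβ, hγ, h, rfl⟩
    have hc := convex_convexHull ℝ (insert a (insert b s))
    have h₁ : a ∈ convexHull ℝ (insert a (insert b s)) := subset_convexHull _ _ (by simp)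
    have h₂ : b ∈ convexHull ℝ (insert a (insert b s)) := subset_convexHull _ _ (by simp)
    have h₃ : t ∈ convexHull ℝ (insert a (insert b s)) :=
      convexHull_mono ((Set.subset_insert _ _).trans (Set.subset_insert _ _)) ht
    have := hc.sum_mem (t := Finset.univ) (w := ![α, β, γ]) (z := ![a, b, t])
      (by simp [Fin.forall_fin_succ, hα, hβ, hγ]) (by simp [Fin.sum_univ_three, h])
      (by simp [Fin.forall_fin_succ, h₁, h₂, h₃])
    simpa [Fin.sum_univ_three] using this

theorem convexHull_insert_left_subset {a b p : V} {s : Set V} (hp : p ∈ segment ℝ a b) :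
    convexHull ℝ (insert a (insert p s)) ⊆ convexHull ℝ (insert a (insert b s)) := by
  refine convexHull_min ?_ (convex_convexHull _ _)
  have hseg : segment ℝ a b ⊆ convexHull ℝ (insert a (insert b s)) :=
    segment_subset_convexHull (by simp) (by simp)
  rintro x (rfl | rfl | hx)
  · exact subset_convexHull _ _ (by simp)
  · exact hseg hp
  · exact subset_convexHull _ _ (by simp [hx])

set_option linter.unnecessarySeqFocus false in
/-- Splitting the convex hull of `a, b, s` at a point `p` of the edge `[a, b]`. -/
theorem CTVal.edge_split {φ : ConvexBody V → ℝ} (h : CTVal φ) {a b p : V} {s : Set V}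
    (hs : s.Finite) (hn : s.Nonempty) (hp : p ∈ segment ℝ a b) :
    φ (hull (insert a (insert b s))) + φ (hull (insert p s)) =
      φ (hull (insert a (insert p s))) + φ (hull (insert p (insert b s))) := by
  have hc : ∀ a b : V, (hull (insert a (insert b s)) : Set V)
      = convexHull ℝ (insert a (insert b s)) :=
    fun a b => coe_hull ((hs.insert _).insert _) (Set.insert_nonempty _ _)
  have hc' : (hull (insert p s) : Set V) = convexHull ℝ (insert p s) :=
    coe_hull (hs.insert _) (Set.insert_nonempty _ _)
  apply h.val_eq <;> simp only [← SetLike.mem_coe, hc, hc']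
  · exact fun x hx => convexHull_insert_left_subset hp hx
  · intro x hx
    rw [Set.insert_comm] at hx ⊢
    exact convexHull_insert_left_subset (by rwa [segment_symm]) hx
  · obtain ⟨c, d, hc, hd, hcd, rfl⟩ := hp
    intro x hx
    obtain ⟨t, ht, α, β, γ, hα, hβ, hγ, hs', rfl⟩ := (mem_convexHull_insert_insert_iff hn).1 hx
    rcases le_total (β * c) (α * d) with hle | hle
    · left
      rcases hd.eq_or_lt with rfl | hd
      · have : c = 1 := by linarith
        subst this
        have hβ0 : β = 0 := by nlinarith
        subst hβ0
        exact (mem_convexHull_insert_insert_iff hn).2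
          ⟨t, ht, α, 0, γ, hα, le_rfl, hγ, hs', by simp⟩
      · have hc1 : c = 1 - d := by linarith
        refine (mem_convexHull_insert_insert_iff hn).2
          ⟨t, ht, α - β * c / d, β / d, γ, ?_, by positivity, hγ, ?_, ?_⟩
        · rw [sub_nonneg, div_le_iff₀ hd]; exact hle
        · rw [← hs', hc1]; field_simp; ring
        · match_scalars <;> field_simp <;> ring
    · right
      rcases hc.eq_or_lt with rfl | hc
      · have : d = 1 := by linarith
        subst this
        have hα0 : α = 0 := by nlinarith
        subst hα0
        exact (mem_convexHull_insert_insert_iff hn).2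
          ⟨t, ht, 0, β, γ, le_rfl, hβ, hγ, hs', by simp⟩
      · have hd1 : d = 1 - c := by linarith
        refine (mem_convexHull_insert_insert_iff hn).2
          ⟨t, ht, α / c, β - α * d / c, γ, by positivity, ?_, hγ, ?_, ?_⟩
        · rw [sub_nonneg, div_le_iff₀ hc]; exact hle
        · rw [← hs', hd1]; field_simp; ring
        · match_scalars <;> field_simp <;> ring
  · intro x hx
    refine ⟨convexHull_mono (Set.subset_insert _ _) hx, convexHull_mono ?_ hx⟩
    exact Set.insert_subset_insert (Set.subset_insert _ _)
  · obtain ⟨c, d, hc, hd, hcd, rfl⟩ := hp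
    intro x hx hx'
    obtain ⟨t, ht, α, μ, γ, hα, hμ, hγ, hs₁, rfl⟩ := (mem_convexHull_insert_insert_iff hn).1 hx
    obtain ⟨t', ht', μ', β, γ', hμ', hβ, hγ', hs₂, heq⟩ :=
      (mem_convexHull_insert_insert_iff hn).1 hx'
    have hconv := convex_convexHull ℝ (insert (c • a + d • b) s)
    rcases (add_nonneg (mul_nonneg hα hd) (mul_nonneg hβ hc)).eq_or_lt with h0 | hpos
    · have hαd : α * d = 0 := by nlinarith [mul_nonneg hα hd, mul_nonneg hβ hc]
      rcases mul_eq_zero.1 hαd with rfl | rfl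
      · exact (mem_convexHull_insert_iff hn).2 ⟨t, ht, μ, γ, hμ, hγ, by linarith, by simp⟩
      · have hc1 : c = 1 := by linarith
        subst hc1
        have : β = 0 := by linarith
        subst this
        rw [heq]
        exact (mem_convexHull_insert_iff hn).2 ⟨t', ht', μ', γ', hμ', hγ', by linarith, by simp⟩
    · set D := α * d + β * c with hD
      have hp' : c • a + d • b ∈ convexHull ℝ (insert (c • a + d • b) s) :=
        subset_convexHull _ _ (by simp)
      have htm : ∀ {t}, t ∈ convexHull ℝ s → t ∈ convexHull ℝ (insert (c • a + d • b) s) :=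
        fun ht => convexHull_mono (Set.subset_insert _ _) ht
      have key := hconv.sum_mem (t := Finset.univ)
        (w := ![β * c / D * μ + α * d / D * μ' + α * β / D, β * c / D * γ, α * d / D * γ'])
        (z := ![c • a + d • b, t, t'])
        (by simp only [Fin.forall_fin_succ]; simp; refine ⟨?_, ?_, ?_⟩ <;> positivity)
        (by
          simp only [Fin.sum_univ_three, Matrix.cons_val]
          field_simp
          rw [show γ = 1 - α - μ by linarith, show γ' = 1 - μ' - β by linarith,
            show c = 1 - d by linarith, hD, show c = 1 - d by linarith]
          ring)
        (by simp [Fin.forall_fin_succ, hp', htm ht, htm ht'])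
      convert key using 1
      simp only [Fin.sum_univ_three, Matrix.cons_val]
      have e : α • a + μ • (c • a + d • b) + γ • t = (β * c / D) •
          (α • a + μ • (c • a + d • b) + γ • t) + (α * d / D) •
          (μ' • (c • a + d • b) + β • b + γ' • t') := by
        rw [← heq, ← add_smul, ← add_div, add_comm (β * c), div_self hpos.ne', one_smul]
      rw [e]
      module

end EdgeSplit

section Reduction

variable {V : Type*} [NormedAddCommGroup V] [NormedSpace ℝ V]

theorem exists_mem_segment_of_mem_convexHull {a b p : V} {s : Set V}
    (hp : p ∈ convexHull ℝ (insert a (insert b s))) :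
    ∃ q ∈ segment ℝ a b, p ∈ convexHull ℝ (insert q s) := by
  rcases s.eq_empty_or_nonempty with rfl | hs
  · refine ⟨p, ?_, subset_convexHull _ _ (by simp)⟩
    rw [← convexHull_pair]
    simpa using hp
  · obtain ⟨t, ht, α, β, γ, hα, hβ, hγ, h, rfl⟩ := (mem_convexHull_insert_insert_iff hs).1 hp
    rcases (add_nonneg hα hβ).eq_or_lt with h0 | hpos
    · have hα0 : α = 0 := by linarith
      have hβ0 : β = 0 := by linarith
      have hγ1 : γ = 1 := by linarith
      subst hα0 hβ0 hγ1
      exact ⟨a, left_mem_segment _ _ _, convexHull_mono (Set.subset_insert _ _) (by simpa using ht)⟩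
    · refine ⟨(α / (α + β)) • a + (β / (α + β)) • b, ⟨_, _, by positivity, by positivity, ?_, rfl⟩,
        (mem_convexHull_insert_iff hs).2 ⟨t, ht, α + β, γ, hpos.le, hγ, h, ?_⟩⟩
      · rw [← add_div, div_self hpos.ne']
      · match_scalars <;> field_simp

theorem hull_insert_of_mem {p : V} {s : Set V} (hs : s.Finite)
    (hp : p ∈ convexHull ℝ s) : hull (insert p s) = hull s := by
  have hn : s.Nonempty := by
    rw [← convexHull_nonempty_iff (𝕜 := ℝ)]; exact ⟨p, hp⟩
  apply ConvexBody.ext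
  rw [coe_hull (hs.insert _) (Set.insert_nonempty _ _), coe_hull hs hn]
  exact (convexHull_min (Set.insert_subset hp (subset_convexHull _ _))
    (convex_convexHull _ _)).antisymm (convexHull_mono (Set.subset_insert _ _))

open Classical in
theorem CTVal.hull_union_eq_zero {φ : ConvexBody V → ℝ} (h : CTVal φ) {m : ℕ}
    (hm : ∀ s : Finset V, s.Nonempty → s.card < m → φ (hull s) = 0) {p : V} (k : ℕ) :
    ∀ I t : Finset V, I.card ≤ k + 1 → I.card + t.card ≤ m → p ∈ convexHull ℝ (I : Set V) →
      p ∈ convexHull ℝ (t : Set V) → φ (hull (I ∪ t : Finset V)) = 0 := by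
  induction k with
  | zero =>
    intro I t hI hIt hpI hpt
    have hn : I.Nonempty := by
      by_contra hne
      rw [Finset.not_nonempty_iff_eq_empty] at hne
      simp [hne] at hpI
    obtain ⟨q, rfl⟩ := Finset.card_eq_one.1 (le_antisymm hI hn.card_pos)
    have : p = q := by simpa using hpI
    subst this
    rw [Finset.coe_union, Finset.coe_singleton, Set.singleton_union,
      hull_insert_of_mem t.finite_toSet hpt]
    refine hm t ?_ (by simp at hIt; omega)
    by_contra hne
    rw [Finset.not_nonempty_iff_eq_empty] at hne
    simp [hne] at hpt
  | succ k ih =>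
    intro I t hI hIt hpI hpt
    rcases Nat.lt_or_ge I.card 2 with hlt | hge
    · exact ih I t (by omega) hIt hpI hpt
    · obtain ⟨a, b, hab, J, rfl, haJ, hbJ⟩ : ∃ a b, a ≠ b ∧ ∃ J : Finset V,
          I = insert a (insert b J) ∧ a ∉ J ∧ b ∉ J := by
        obtain ⟨a, ha, b, hb, hab⟩ := Finset.one_lt_card.1 (show 1 < I.card by omega)
        refine ⟨a, b, hab, (I.erase a).erase b, ?_, by simp, by simp⟩
        rw [Finset.insert_erase (by simp [hb, hab.symm]), Finset.insert_erase ha]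
      have hcard : (insert a (insert b J)).card = J.card + 2 := by
        rw [Finset.card_insert_of_notMem (by simp [hab, haJ]), Finset.card_insert_of_notMem hbJ]
      rw [hcard] at hIt hI
      have htn : t.Nonempty := by
        by_contra hne
        rw [Finset.not_nonempty_iff_eq_empty] at hne
        simp [hne] at hpt
      rw [Finset.coe_insert, Finset.coe_insert] at hpI
      obtain ⟨q, hq, hpq⟩ := exists_mem_segment_of_mem_convexHull hpI
      have hpq' : p ∈ convexHull ℝ ((insert q J : Finset V) : Set V) := by
        rwa [Finset.coe_insert]
      have hcq : (insert q J).card ≤ J.card + 1 := Finset.card_insert_le _ _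
      have split := h.edge_split (s := ((J ∪ t : Finset V) : Set V)) (Finset.finite_toSet _)
        (by simpa using htn.mono Finset.subset_union_right) hq
      have h₁ := ih (insert q J) (insert a t) (by omega)
        (by have := Finset.card_insert_le a t; omega) hpq'
        (convexHull_mono (by simp) hpt)
      have h₂ := ih (insert q J) (insert b t) (by omega)
        (by have := Finset.card_insert_le b t; omega) hpq'
        (convexHull_mono (by simp) hpt)
      have h₃ := ih (insert q J) t (by omega) (by omega) hpq' hpt
      have e₀ : ((insert a (insert b J) ∪ t : Finset V) : Set V)
          = insert a (insert b ((J ∪ t : Finset V) : Set V)) := by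
        push_cast; simp only [Set.insert_union]
      have e₁ : ((insert q J ∪ insert a t : Finset V) : Set V)
          = insert a (insert q ((J ∪ t : Finset V) : Set V)) := by
        push_cast
        rw [Set.insert_union, Set.union_insert, Set.insert_comm]
      have e₂ : ((insert q J ∪ insert b t : Finset V) : Set V)
          = insert q (insert b ((J ∪ t : Finset V) : Set V)) := by
        push_cast
        rw [Set.insert_union, Set.union_insert]
      have e₃ : ((insert q J ∪ t : Finset V) : Set V)
          = insert q ((J ∪ t : Finset V) : Set V) := by
        push_cast; rw [Set.insert_union]
      rw [e₀]
      rw [e₁] at h₁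
      rw [e₂] at h₂
      rw [e₃] at h₃
      linarith

/-- A valuation that vanishes on simplices vanishes. -/
theorem CTVal.eq_zero_of_simplices [FiniteDimensional ℝ V] {φ : ConvexBody V → ℝ} (h : CTVal φ)
    (h0 : ∀ s : Finset V, s.Nonempty → s.card ≤ finrank ℝ V + 1 → φ (hull s) = 0)
    (K : ConvexBody V) : φ K = 0 := by
  classical
  have key : ∀ m, ∀ s : Finset V, s.Nonempty → s.card < m → φ (hull s) = 0 := by
    intro m
    induction m with
    | zero => intro s _ hs; omega
    | succ m ih =>
      intro s hn hs
      rcases Nat.lt_or_ge s.card m with hlt | hge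
      · exact ih s hn hlt
      rcases Nat.lt_or_ge (finrank ℝ V + 1) s.card with hlt | hle
      · have hdep : ¬ AffineIndependent ℝ (Subtype.val : s → V) := by
          intro hind
          have := hind.card_le_finrank_succ
          have h2 := Submodule.finrank_le (vectorSpan ℝ (Set.range (Subtype.val : s → V)))
          rw [Fintype.card_coe] at this
          omega
        obtain ⟨I, p, hp₁, hp₂⟩ := Convex.radon_partition hdep
        let A : Finset V := s.filter (fun x => ∃ hx : x ∈ s, (⟨x, hx⟩ : s) ∈ I)
        have hA : (Subtype.val '' I : Set V) = A := by
          ext x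
          simp [A]
        have hB : (Subtype.val '' Iᶜ : Set V) = (s \ A : Finset V) := by
          ext x
          simp only [Set.mem_image, Set.mem_compl_iff, Subtype.exists, exists_and_right,
            exists_eq_right, Finset.coe_sdiff, Finset.coe_filter, Set.mem_sdiff, Finset.mem_coe,
            Set.mem_ofPred_eq, not_and, not_exists, A]
          constructor
          · rintro ⟨hx, h⟩; exact ⟨hx, fun _ _ => h⟩
          · rintro ⟨hx, h⟩; exact ⟨hx, h hx hx⟩
        rw [hA] at hp₁
        rw [hB] at hp₂
        have hAs : A ⊆ s := Finset.filter_subset _ _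
        have := h.hull_union_eq_zero ih A.card A (s \ A) (by omega)
          (by rw [Finset.card_sdiff_of_subset hAs]; have := Finset.card_le_card hAs; omega) hp₁ hp₂
        rwa [Finset.union_sdiff_of_subset hAs] at this
      · exact h0 s hn hle
  refine eq_of_forall_hull h.cont continuous_const (fun s hs hn => ?_) K
  have := key (hs.toFinset.card + 1) hs.toFinset (by simpa using hn) (by omega)
  simpa using this

end Reduction

section McMullen

variable {V : Type*} [NormedAddCommGroup V] [NormedSpace ℝ V]

theorem ConvexBody.exists_add_smul_eq (B : ConvexBody V) {b b' : V} (hb : b ∈ B) (hb' : b' ∈ B)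
    {α β : ℝ} (hα : 0 ≤ α) (hβ : 0 ≤ β) : ∃ c ∈ B, α • b + β • b' = (α + β) • c := by
  rcases (add_nonneg hα hβ).eq_or_lt with h0 | hpos
  · have hα0 : α = 0 := by linarith
    have hβ0 : β = 0 := by linarith
    subst hα0 hβ0
    exact ⟨b, hb, by simp⟩
  · refine ⟨(α / (α + β)) • b + (β / (α + β)) • b',
      B.convex hb hb' (by positivity) (by positivity) (by rw [← add_div, div_self hpos.ne']), ?_⟩
    match_scalars <;> field_simp

theorem CTVal.cone_cut {φ : ConvexBody V → ℝ} (h : CTVal φ) {K B : ConvexBody V}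
    (hK : ∀ x, x ∈ K ↔ ∃ b ∈ B, ∃ c : ℝ, 0 ≤ c ∧ c ≤ 1 ∧ x = c • b) {r : ℝ} (hr : 0 ≤ r)
    (L : ConvexBody V) :
    φ ((r + 1) • K + L) + φ (r • B + L) = φ (r • K + L) + φ (r • B + (K + L)) := by
  have hK' : ∀ s : ℝ, 0 ≤ s → ∀ x, x ∈ s • K ↔ ∃ b ∈ B, ∃ c : ℝ, 0 ≤ c ∧ c ≤ s ∧ x = c • b := by
    intro s hs x
    constructor
    · rintro ⟨k, hk, rfl⟩
      obtain ⟨b, hb, c, hc, hc1, rfl⟩ := (hK k).1 hk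
      exact ⟨b, hb, s * c, by positivity, by nlinarith, smul_smul _ _ _⟩
    · rintro ⟨b, hb, c, hc, hcs, rfl⟩
      rcases hs.eq_or_lt with rfl | hs
      · have : c = 0 := le_antisymm hcs hc
        subst this
        exact ⟨(0 : ℝ) • b, (hK _).2 ⟨b, hb, 0, le_rfl, zero_le_one, rfl⟩, by simp⟩
      · refine ⟨(c / s) • b, (hK _).2 ⟨b, hb, c / s, by positivity, ?_, rfl⟩, ?_⟩
        · rwa [div_le_one hs]
        · simp only [smul_smul]; rw [mul_div_cancel₀ _ hs.ne']
  apply h.val_eq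
  · rintro _ ⟨_, hk, l, hl, rfl⟩
    obtain ⟨b, hb, c, hc, hc', rfl⟩ := (hK' r hr _).1 hk
    exact ⟨_, (hK' _ (by positivity) _).2 ⟨b, hb, c, hc, by linarith, rfl⟩, l, hl, rfl⟩
  · rintro _ ⟨_, ⟨b, hb, rfl⟩, _, ⟨_, hk, l, hl, rfl⟩, rfl⟩
    obtain ⟨b', hb', c, hc, hc', rfl⟩ := (hK _).1 hk
    obtain ⟨b'', hb'', he⟩ := B.exists_add_smul_eq hb hb' hr hc
    refine ⟨_, (hK' _ (by positivity) _).2 ⟨b'', hb'', r + c, by positivity, by linarith, rfl⟩,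
      l, hl, ?_⟩
    simp only [← he]
    abel
  · rintro _ ⟨_, hk, l, hl, rfl⟩
    obtain ⟨b, hb, c, hc, hc', rfl⟩ := (hK' _ (by positivity) _).1 hk
    rcases le_total c r with hcr | hcr
    · exact Or.inl ⟨_, (hK' r hr _).2 ⟨b, hb, c, hc, hcr, rfl⟩, l, hl, rfl⟩
    · refine Or.inr ⟨r • b, ⟨b, hb, rfl⟩, (c - r) • b + l, ⟨_, (hK _).2 ⟨b, hb, c - r,
        by linarith, by linarith, rfl⟩, l, hl, rfl⟩, ?_⟩
      simp only
      module
  · rintro _ ⟨_, ⟨b, hb, rfl⟩, l, hl, rfl⟩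
    refine ⟨⟨_, (hK' r hr _).2 ⟨b, hb, r, hr, le_rfl, rfl⟩, l, hl, rfl⟩,
      r • b, ⟨b, hb, rfl⟩, l, ⟨_, (hK _).2 ⟨b, hb, 0, le_rfl, zero_le_one, rfl⟩, l, hl, by simp⟩,
      rfl⟩
  · rintro _ ⟨_, hk, l, hl, rfl⟩ ⟨_, ⟨b, hb, rfl⟩, _, ⟨_, hk', l', hl', rfl⟩, heq⟩
    obtain ⟨b₁, hb₁, c, hc, hc', rfl⟩ := (hK' r hr _).1 hk
    obtain ⟨b₂, hb₂, d, hd, hd', rfl⟩ := (hK _).1 hk'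
    simp only at heq ⊢
    obtain ⟨b₃, hb₃, h₃⟩ := B.exists_add_smul_eq hb hb₂ hr hd
    rcases hd.eq_or_lt with rfl | hd
    · refine ⟨r • b, ⟨b, hb, rfl⟩, l', hl', ?_⟩
      rw [← heq]; simp
    have hD : 0 < r + d - c := by linarith
    obtain ⟨b₄, hb₄, h₄⟩ := B.exists_add_smul_eq hb₁ hb₃ (α := d / (r + d - c) * c)
      (β := (r - c) / (r + d - c) * (r + d)) (by positivity)
      (mul_nonneg (div_nonneg (by linarith) hD.le) (by linarith))
    refine ⟨r • b₄, ⟨b₄, hb₄, rfl⟩, (d / (r + d - c)) • l + ((r - c) / (r + d - c)) • l',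
      L.convex hl hl' (by positivity) (div_nonneg (by linarith) hD.le)
        (by field_simp; ring), ?_⟩
    have hr' : d / (r + d - c) * c + (r - c) / (r + d - c) * (r + d) = r := by
      field_simp; ring
    rw [hr'] at h₄
    simp only
    rw [← h₄]
    have e : (d / (r + d - c)) • (c • b₁ + l) + ((r - c) / (r + d - c)) • (c • b₁ + l)
        = c • b₁ + l := by
      rw [← add_smul, ← add_div, show d + (r - c) = r + d - c by ring, div_self hD.ne', one_smul]
    have e2 : c • b₁ + l = (r + d) • b₃ + l' := by rw [← heq, ← add_assoc, h₃]
    calc _ = (d / (r + d - c)) • (c • b₁ + l)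
          + ((r - c) / (r + d - c)) • ((r + d) • b₃ + l') := by module
      _ = _ := by rw [← e2, e]

theorem mem_hull_insert_zero_iff {S : Set V} (hS : S.Finite) (hn : S.Nonempty) (x : V) :
    x ∈ hull (insert 0 S) ↔ ∃ b ∈ hull S, ∃ c : ℝ, 0 ≤ c ∧ c ≤ 1 ∧ x = c • b := by
  rw [← SetLike.mem_coe, coe_hull (hS.insert _) (Set.insert_nonempty _ _),
    mem_convexHull_insert_iff hn]
  simp only [← SetLike.mem_coe, coe_hull hS hn]
  constructor
  · rintro ⟨t, ht, α, γ, hα, hγ, h, rfl⟩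
    exact ⟨t, ht, γ, hγ, by linarith, by simp⟩
  · rintro ⟨t, ht, c, hc, hc', rfl⟩
    exact ⟨t, ht, 1 - c, c, by linarith, hc, by ring, by simp⟩

theorem hull_translate {S : Set V} (hS : S.Finite) (hn : S.Nonempty) (a : V) :
    hull ((fun x => x + a) '' S) = hull S + pt a := by
  rw [← hull_singleton, hull_add_hull hS hn (Set.finite_singleton a) (Set.singleton_nonempty a),
    Set.add_singleton]

theorem fwdDiff_iter_const_zero {d : ℕ} {c : ℝ} :
    (fwdDiff 1)^[d + 1] (fun _ : ℕ => c) = 0 := by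
  rw [Function.iterate_succ_apply, fwdDiff_const]
  induction d with
  | zero => rfl
  | succ d ih => rw [Function.iterate_succ_apply, fwdDiff_const]; exact ih

theorem CTVal.fwdDiff_simplex {φ : ConvexBody V → ℝ} (h : CTVal φ) (k : ℕ) :
    ∀ (s : Finset V) (_ : s.Nonempty) (_ : s.card ≤ k + 1) (L : ConvexBody V),
      (fwdDiff 1)^[k + 1] (fun n : ℕ => φ ((n : ℝ) • hull s + L)) = 0 := by
  classical
  have const : ∀ (a : V) (L : ConvexBody V) (k : ℕ),
      (fwdDiff 1)^[k + 1] (fun n : ℕ => φ ((n : ℝ) • hull {a} + L)) = 0 := by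
    intro a L k
    have : (fun n : ℕ => φ ((n : ℝ) • hull {a} + L)) = fun _ : ℕ => φ L := by
      funext n
      rw [hull_singleton, smul_pt, add_comm, h.add_pt]
    rw [this, fwdDiff_iter_const_zero]
  induction k with
  | zero =>
    intro s hs hc L
    obtain ⟨a, rfl⟩ := Finset.card_eq_one.1 (le_antisymm hc hs.card_pos)
    simpa using const a L 0
  | succ k ih =>
    intro s hs hc L
    obtain ⟨a, ha⟩ := hs
    rcases (s.erase a).eq_empty_or_nonempty with he | hne
    · have : s = {a} := by rw [← Finset.insert_erase ha, he]; rfl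
      subst this
      simpa using const a L (k + 1)
    · set S : Finset V := (s.erase a).image (fun x => x + -a) with hSdef
      have hSn : S.Nonempty := hne.image _
      have hSc : S.card ≤ k + 1 := by
        refine Finset.card_image_le.trans ?_
        rw [Finset.card_erase_of_mem ha]
        omega
      have hsS : hull (s : Set V) = hull (insert 0 (S : Set V)) + pt a := by
        rw [← hull_translate (S.finite_toSet.insert _) (Set.insert_nonempty _ _)]
        congr 1
        conv_lhs => rw [← Finset.insert_erase ha]
        rw [Set.image_insert_eq, Finset.coe_insert, hSdef, Finset.coe_image, Set.image_image]
        simp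
      have hshift : (fun n : ℕ => φ ((n : ℝ) • hull s + L))
          = fun n : ℕ => φ ((n : ℝ) • hull (insert 0 (S : Set V)) + L) := by
        funext n
        rw [hsS, smul_add, smul_pt, add_right_comm, h.add_pt]
      have hstep : fwdDiff 1 (fun n : ℕ => φ ((n : ℝ) • hull (insert 0 (S : Set V)) + L))
          = (fun n : ℕ => φ ((n : ℝ) • hull S + (hull (insert 0 (S : Set V)) + L)))
            - fun n : ℕ => φ ((n : ℝ) • hull S + L) := by
        funext n
        have := h.cone_cut (mem_hull_insert_zero_iff S.finite_toSet (by simpa using hSn))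
          (r := n) (by positivity) L
        simp only [fwdDiff, Pi.sub_apply, Nat.cast_add, Nat.cast_one]
        linarith
      have hsub : ∀ f g : ℕ → ℝ, f - g = f + (-1 : ℝ) • g := fun f g => by
        funext n; simp [sub_eq_add_neg]
      rw [Function.iterate_succ_apply, hshift, hstep, hsub, fwdDiff_iter_add,
        fwdDiff_iter_const_smul, ih S hSn hSc, ih S hSn hSc, smul_zero, add_zero]

theorem CTVal.recurrence [FiniteDimensional ℝ V] (hd : finrank ℝ V ≤ 4) {φ : ConvexBody V → ℝ}
    (h : CTVal φ) (K L : ConvexBody V) (n : ℕ) :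
    φ (((n + 5 : ℕ) : ℝ) • K + L) = 5 * φ (((n + 4 : ℕ) : ℝ) • K + L)
      - 10 * φ (((n + 3 : ℕ) : ℝ) • K + L) + 10 * φ (((n + 2 : ℕ) : ℝ) • K + L)
      - 5 * φ (((n + 1 : ℕ) : ℝ) • K + L) + φ ((n : ℝ) • K + L) := by
  have hv := ((((((h.comp_smul_add ((n + 5 : ℕ) : ℝ) L).sub
    ((h.comp_smul_add ((n + 4 : ℕ) : ℝ) L).const_mul 5)).add
    ((h.comp_smul_add ((n + 3 : ℕ) : ℝ) L).const_mul 10)).sub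
    ((h.comp_smul_add ((n + 2 : ℕ) : ℝ) L).const_mul 10)).add
    ((h.comp_smul_add ((n + 1 : ℕ) : ℝ) L).const_mul 5)).sub
    (h.comp_smul_add (n : ℝ) L))
  have := hv.eq_zero_of_simplices (fun s hs hc => ?_) K
  · linarith
  · have := congrFun (h.fwdDiff_simplex 4 s hs (by omega) L) n
    simp only [Function.iterate_succ, Function.iterate_zero, Function.comp_apply, fwdDiff, id,
      Pi.zero_apply, add_assoc, Nat.reduceAdd] at this
    linarith

theorem CTVal.exists_poly [FiniteDimensional ℝ V] (hd : finrank ℝ V ≤ 4) {φ : ConvexBody V → ℝ}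
    (h : CTVal φ) (K L : ConvexBody V) : ∃ a b c d e : ℝ, ∀ n : ℕ,
      φ ((n : ℝ) • K + L) = a + b * n + c * n ^ 2 + d * n ^ 3 + e * n ^ 4 := by
  set p : ℕ → ℝ := fun n => φ ((n : ℝ) • K + L) with hp
  have hrec : ∀ n, p (n + 5) = 5 * p (n + 4) - 10 * p (n + 3) + 10 * p (n + 2) - 5 * p (n + 1)
      + p n := fun n => h.recurrence hd K L n
  set d₁ := p 1 - p 0
  set d₂ := p 2 - 2 * p 1 + p 0
  set d₃ := p 3 - 3 * p 2 + 3 * p 1 - p 0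
  set d₄ := p 4 - 4 * p 3 + 6 * p 2 - 4 * p 1 + p 0
  refine ⟨p 0, d₁ - d₂ / 2 + d₃ / 3 - d₄ / 4, d₂ / 2 - d₃ / 2 + 11 * d₄ / 24, d₃ / 6 - d₄ / 4,
    d₄ / 24, fun n => ?_⟩
  change p n = _
  induction n using Nat.strong_induction_on with
  | _ n ih =>
    match n with
    | 0 => simp
    | 1 => push_cast; simp only [d₁, d₂, d₃, d₄]; ring
    | 2 => push_cast; simp only [d₁, d₂, d₃, d₄]; ring
    | 3 => push_cast; simp only [d₁, d₂, d₃, d₄]; ring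
    | 4 => push_cast; simp only [d₁, d₂, d₃, d₄]; ring
    | n + 5 =>
      rw [hrec, ih n (by omega), ih (n + 1) (by omega), ih (n + 2) (by omega),
        ih (n + 3) (by omega), ih (n + 4) (by omega)]
      push_cast
      ring

/-- The coefficient of degree `i` of the polynomial of degree at most `4` with the given values
at `0, 1, 2, 3, 4`. -/
def interpCoeff (p : ℕ → ℝ) : ℕ → ℝ
  | 0 => p 0
  | 1 => -(25 / 12) * p 0 + 4 * p 1 - 3 * p 2 + 4 / 3 * p 3 - 1 / 4 * p 4
  | 2 => 35 / 24 * p 0 - 13 / 3 * p 1 + 19 / 4 * p 2 - 7 / 3 * p 3 + 11 / 24 * p 4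
  | 3 => -(5 / 12) * p 0 + 3 / 2 * p 1 - 2 * p 2 + 7 / 6 * p 3 - 1 / 4 * p 4
  | 4 => 1 / 24 * p 0 - 1 / 6 * p 1 + 1 / 4 * p 2 - 1 / 6 * p 3 + 1 / 24 * p 4
  | _ => 0

/-- McMullen's homogeneous component of degree `i`. -/
def homComp (φ : ConvexBody V → ℝ) (i : ℕ) (K : ConvexBody V) : ℝ :=
  interpCoeff (fun j => φ ((j : ℝ) • K)) i

/-- Homogeneity of degree `k` with respect to nonnegative dilations. -/
def HomDeg (φ : ConvexBody V → ℝ) (k : ℕ) : Prop :=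
  ∀ (K : ConvexBody V) (t : ℝ), 0 ≤ t → φ (t • K) = t ^ k * φ K

theorem interpCoeff_poly {p : ℕ → ℝ} {a b c d e : ℝ}
    (h : ∀ n : ℕ, p n = a + b * n + c * n ^ 2 + d * n ^ 3 + e * n ^ 4) :
    interpCoeff p 0 = a ∧ interpCoeff p 1 = b ∧ interpCoeff p 2 = c ∧ interpCoeff p 3 = d ∧
      interpCoeff p 4 = e := by
  refine ⟨?_, ?_, ?_, ?_, ?_⟩ <;> simp only [interpCoeff, h] <;> push_cast <;> ring

theorem homogeneous_of_nat {f : ℝ → ℝ} (hf : Continuous f) (k : ℕ)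
    (h : ∀ (n : ℕ) (r : ℝ), 0 ≤ r → f (n * r) = (n : ℝ) ^ k * f r) {t : ℝ} (ht : 0 ≤ t) :
    f t = t ^ k * f 1 := by
  have key : ∀ q : ℚ, f |(q : ℝ)| = |(q : ℝ)| ^ k * f 1 := by
    intro q
    have hden : (0 : ℝ) < q.den := by exact_mod_cast q.den_pos
    have hq : |(q : ℝ)| = (q.num.natAbs : ℝ) / q.den := by
      conv_lhs => rw [Rat.cast_def, abs_div, Nat.abs_cast]
      rw [Nat.cast_natAbs, Int.cast_abs]
    have h₁ := h q.den |(q : ℝ)| (abs_nonneg _)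
    have h₂ : (q.den : ℝ) * |(q : ℝ)| = (q.num.natAbs : ℝ) * 1 := by
      rw [hq, mul_one, mul_div_cancel₀ _ hden.ne']
    rw [h₂, h _ 1 zero_le_one] at h₁
    have h₃ : (q.den : ℝ) ^ k ≠ 0 := pow_ne_zero _ hden.ne'
    apply mul_left_cancel₀ h₃
    rw [← h₁, ← mul_assoc, ← mul_pow, h₂, mul_one]
  have := congrFun (Rat.denseRange_cast (𝕜 := ℝ).equalizer (hf.comp continuous_abs)
    ((continuous_abs.pow k).mul continuous_const) (funext key)) t
  simpa [abs_of_nonneg ht] using this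

theorem CTVal.homComp [FiniteDimensional ℝ V] {φ : ConvexBody V → ℝ} (h : CTVal φ) (i : ℕ) :
    CTVal (homComp φ i) := by
  have hj := fun (j : ℕ) (c : ℝ) => (h.comp_smul (j : ℝ)).const_mul c
  unfold _root_.homComp
  match i with
  | 0 => exact h.comp_smul _
  | 1 => exact ((((hj 0 _).add (hj 1 _)).sub (hj 2 _)).add (hj 3 _)).sub (hj 4 _)
  | 2 => exact ((((hj 0 _).sub (hj 1 _)).add (hj 2 _)).sub (hj 3 _)).add (hj 4 _)
  | 3 => exact ((((hj 0 _).add (hj 1 _)).sub (hj 2 _)).add (hj 3 _)).sub (hj 4 _)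
  | 4 => exact ((((hj 0 _).sub (hj 1 _)).add (hj 2 _)).sub (hj 3 _)).add (hj 4 _)
  | n + 5 => exact CTVal.zero

theorem CTVal.homComp_homDeg [FiniteDimensional ℝ V] (hd : finrank ℝ V ≤ 4)
    {φ : ConvexBody V → ℝ} (h : CTVal φ) (i : ℕ) : HomDeg (_root_.homComp φ i) i := by
  have hnat : ∀ (n : ℕ) (K : ConvexBody V),
      _root_.homComp φ i ((n : ℝ) • K) = (n : ℝ) ^ i * _root_.homComp φ i K := by
    intro n K
    obtain ⟨a, b, c, d, e, hp⟩ := h.exists_poly hd K 0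
    simp only [add_zero] at hp
    have hp' : ∀ j : ℕ, φ ((j : ℝ) • (n : ℝ) • K) = a + (n * b) * j + (n ^ 2 * c) * j ^ 2
        + (n ^ 3 * d) * j ^ 3 + (n ^ 4 * e) * j ^ 4 := fun j => by
      rw [smul_smul, ← Nat.cast_mul, hp]
      push_cast
      ring
    obtain ⟨h0, h1, h2, h3, h4⟩ := interpCoeff_poly hp
    obtain ⟨g0, g1, g2, g3, g4⟩ := interpCoeff_poly hp'
    unfold _root_.homComp
    match i with
    | 0 => rw [h0, g0]; simp
    | 1 => rw [h1, g1]; simp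
    | 2 => rw [h2, g2]
    | 3 => rw [h3, g3]
    | 4 => rw [h4, g4]
    | n + 5 => simp [interpCoeff]
  intro K t ht
  have := homogeneous_of_nat (f := fun t => _root_.homComp φ i (t • K))
    ((h.homComp i).cont.comp (continuous_id.smul continuous_const)) i (fun n r _ => by
      simp only [mul_smul, hnat]) ht
  simpa using this

theorem CTVal.sum_homComp [FiniteDimensional ℝ V] (hd : finrank ℝ V ≤ 4)
    {φ : ConvexBody V → ℝ} (h : CTVal φ) (K : ConvexBody V) :
    φ K = _root_.homComp φ 0 K + _root_.homComp φ 1 K + _root_.homComp φ 2 K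
      + _root_.homComp φ 3 K + _root_.homComp φ 4 K := by
  obtain ⟨a, b, c, d, e, hp⟩ := h.exists_poly hd K 0
  simp only [add_zero] at hp
  obtain ⟨h0, h1, h2, h3, h4⟩ := interpCoeff_poly hp
  have := hp 1
  simp only [_root_.homComp, h0, h1, h2, h3, h4]
  simpa using this

/-- Valuations that are homogeneous of degree one are Minkowski additive. -/
theorem CTVal.additive [FiniteDimensional ℝ V] (hd : finrank ℝ V ≤ 4)
    {φ : ConvexBody V → ℝ} (h : CTVal φ) (h1 : HomDeg φ 1) (K L : ConvexBody V) :
    φ (K + L) = φ K + φ L := by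
  obtain ⟨a, b, c, d, e, hp⟩ := h.exists_poly hd K L
  set F : ℝ → ℝ := fun x => φ (K + x • L) with hF
  have hFc : Continuous F :=
    h.cont.comp (continuous_const.add (continuous_id.smul continuous_const))
  let x : ℕ → ℝ := fun n => 1 / ((n : ℝ) + 1)
  have hx : Filter.Tendsto x Filter.atTop (nhds 0) := tendsto_one_div_add_atTop_nhds_zero_nat
  have hxpos : ∀ n, 0 < x n := fun n => by positivity
  have h₄ : ∀ n, a * x n ^ 4 + b * x n ^ 3 + c * x n ^ 2 + d * x n + e = x n ^ 3 * F (x n) := by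
    intro n
    have hx1 : ((n + 1 : ℕ) : ℝ) * x n = 1 := by simp only [x]; push_cast; field_simp
    have := h1 (((n + 1 : ℕ) : ℝ) • K + L) (x n) (hxpos n).le
    rw [smul_add, smul_smul, mul_comm, hx1, one_smul, hp] at this
    simp only [hF, this]
    have e1 : ((n + 1 : ℕ) : ℝ) = (x n)⁻¹ := eq_inv_of_mul_eq_one_left hx1
    rw [e1]
    have := (hxpos n).ne'
    field_simp
  have lim : ∀ {P Q : ℝ → ℝ}, Continuous P → Continuous Q → (∀ n, P (x n) = Q (x n)) →
      P 0 = Q 0 := fun hP hQ hPQ =>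
    tendsto_nhds_unique ((hP.tendsto 0).comp hx) (by
      have := (hQ.tendsto 0).comp hx
      refine this.congr fun n => (hPQ n).symm)
  have he : e = 0 := by
    simpa using lim (P := fun y => a * y ^ 4 + b * y ^ 3 + c * y ^ 2 + d * y + e)
      (Q := fun y => y ^ 3 * F y) (by fun_prop) (by fun_prop) h₄
  have h₃ : ∀ n, a * x n ^ 3 + b * x n ^ 2 + c * x n + d = x n ^ 2 * F (x n) := fun n =>
    mul_left_cancel₀ (hxpos n).ne' (by linear_combination h₄ n - he)
  have hd0 : d = 0 := by
    simpa using lim (P := fun y => a * y ^ 3 + b * y ^ 2 + c * y + d)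
      (Q := fun y => y ^ 2 * F y) (by fun_prop) (by fun_prop) h₃
  have h₂ : ∀ n, a * x n ^ 2 + b * x n + c = x n * F (x n) := fun n =>
    mul_left_cancel₀ (hxpos n).ne' (by linear_combination h₃ n - hd0)
  have hc0 : c = 0 := by
    simpa using lim (P := fun y => a * y ^ 2 + b * y + c)
      (Q := fun y => y * F y) (by fun_prop) (by fun_prop) h₂
  have h₁ : ∀ n, a * x n + b = F (x n) := fun n =>
    mul_left_cancel₀ (hxpos n).ne' (by linear_combination h₂ n - hc0)
  have hb : b = φ K := by
    have := lim (P := fun y => a * y + b) (Q := F) (by fun_prop) hFc h₁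
    simpa [hF, zero_smul'] using this
  have e0 := hp 0
  have e1 := hp 1
  simp [zero_smul', he, hd0, hc0] at e0 e1
  linarith

end McMullen

section Segments

variable {V V' : Type*} [NormedAddCommGroup V] [NormedSpace ℝ V]
  [NormedAddCommGroup V'] [NormedSpace ℝ V']

/-- The segment joining the origin to `u`. -/
def ConvexBody.seg (u : V) : ConvexBody V := hull {0, u}

namespace ConvexBody

theorem mem_seg {u x : V} : x ∈ seg u ↔ ∃ t : ℝ, 0 ≤ t ∧ t ≤ 1 ∧ x = t • u := by
  rw [← mem_coe', seg, coe_hull_pair]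
  constructor
  · rintro ⟨a, b, ha, hb, hab, rfl⟩
    exact ⟨b, hb, by linarith, by simp⟩
  · rintro ⟨t, ht, ht', rfl⟩
    exact ⟨1 - t, t, by linarith, ht, by ring, by simp⟩

theorem mapCLM_seg (f : V →L[ℝ] V') (u : V) : (seg u).mapCLM f = seg (f u) := by
  rw [seg, mapCLM_hull f (by simp) (by simp), Set.image_pair, map_zero, seg]

theorem smul_seg (r : ℝ) (u : V) : r • seg u = seg (r • u) := by
  rw [smul_eq_mapCLM, mapCLM_seg]; simp

theorem seg_zero : seg (0 : V) = 0 := by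
  rw [seg, Set.pair_eq_singleton, hull_singleton, pt_zero]

theorem continuous_seg : Continuous (seg : V → ConvexBody V) :=
  continuous_hull_pair continuous_const continuous_id

theorem hull_pair_eq (a b : V) : hull {a, b} = seg (b - a) + pt a := by
  rw [seg, ← hull_translate (by simp) (by simp), Set.image_pair]
  simp

theorem mem_add_seg_smul {K : ConvexBody V} {u x : V} {r : ℝ} (hr : 0 ≤ r) :
    x ∈ K + seg (r • u) ↔ ∃ t : ℝ, 0 ≤ t ∧ t ≤ r ∧ x - t • u ∈ K := by
  simp only [mem_add_iff, mem_seg]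
  constructor
  · rintro ⟨k, hk, _, ⟨t, ht, ht', rfl⟩, rfl⟩
    exact ⟨t * r, by positivity, by nlinarith, by simpa [mul_smul] using hk⟩
  · rintro ⟨t, ht, ht', hx⟩
    rcases hr.eq_or_lt with rfl | hr
    · obtain rfl : t = 0 := le_antisymm ht' ht
      exact ⟨x, by simpa using hx, 0, ⟨0, by simp⟩, by simp⟩
    · refine ⟨_, hx, t • u, ⟨t / r, by positivity, (div_le_one hr).2 ht', ?_⟩, by simp⟩
      rw [smul_smul, div_mul_cancel₀ _ hr.ne']

theorem mem_add_pt {K : ConvexBody V} {a x : V} : x ∈ K + pt a ↔ x - a ∈ K := by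
  simp only [mem_add_iff, mem_pt, exists_eq_left]
  constructor
  · rintro ⟨k, hk, rfl⟩; simpa using hk
  · intro h; exact ⟨_, h, by simp⟩

/-- Points of a convex body on a line form an interval. -/
theorem sub_smul_mem {K : ConvexBody V} {x u : V} {s t r : ℝ} (hs : x - s • u ∈ K)
    (ht : x - t • u ∈ K) (h₁ : s ≤ r) (h₂ : r ≤ t) : x - r • u ∈ K := by
  rcases h₁.eq_or_lt with rfl | h₁
  · exact hs
  have hst : 0 < t - s := by linarith
  have := K.convex hs ht (a := (t - r) / (t - s)) (b := (r - s) / (t - s))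
    (div_nonneg (by linarith) hst.le) (div_nonneg (by linarith) hst.le)
    (by field_simp; ring)
  suffices h : x - r • u
      = ((t - r) / (t - s)) • (x - s • u) + ((r - s) / (t - s)) • (x - t • u) by rwa [h]
  match_scalars <;> field_simp <;> ring

/-- The intersection of a convex body with a closed convex set. -/
def restr (K : ConvexBody V) (s : Set V) (hc : Convex ℝ s) (hs : IsClosed s)
    (hn : ((K : Set V) ∩ s).Nonempty) : ConvexBody V :=
  ⟨(K : Set V) ∩ s, K.convex.inter hc, K.isCompact.inter_right hs, hn⟩

/-- The part of a convex body in a closed half-space. -/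
def lower (K : ConvexBody V) (l : V →L[ℝ] ℝ) (c : ℝ) (hn : ∃ x ∈ K, l x ≤ c) : ConvexBody V :=
  K.restr {x | l x ≤ c} (convex_halfSpace_le l.toLinearMap.isLinear c)
    (isClosed_le l.continuous continuous_const) hn

/-- The part of a convex body in a closed half-space. -/
def upper (K : ConvexBody V) (l : V →L[ℝ] ℝ) (c : ℝ) (hn : ∃ x ∈ K, c ≤ l x) : ConvexBody V :=
  K.restr {x | c ≤ l x} (convex_halfSpace_ge l.toLinearMap.isLinear c)
    (isClosed_le continuous_const l.continuous) hn

theorem mem_lower {K : ConvexBody V} {l : V →L[ℝ] ℝ} {c : ℝ} {hn} {x : V} :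
    x ∈ K.lower l c hn ↔ x ∈ K ∧ l x ≤ c := Iff.rfl

theorem mem_upper {K : ConvexBody V} {l : V →L[ℝ] ℝ} {c : ℝ} {hn} {x : V} :
    x ∈ K.upper l c hn ↔ x ∈ K ∧ c ≤ l x := Iff.rfl

end ConvexBody

/-- The increment of `φ` under adding a segment. -/
def segDiff (φ : ConvexBody V → ℝ) (u : V) (K : ConvexBody V) : ℝ := φ (K + seg u) - φ K

variable {φ : ConvexBody V → ℝ}

theorem CTVal.segDiff (h : CTVal φ) (u : V) : CTVal (segDiff φ u) :=
  (h.comp_add (seg u)).sub h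

theorem CTVal.add_seg_smul (h : CTVal φ) (K : ConvexBody V) (u : V) {r : ℝ} (hr : 0 ≤ r) :
    φ (K + seg (r • u)) = φ K + r * _root_.segDiff φ u K := by
  set g : ℝ → ℝ := fun r => φ (K + seg (r • u)) - φ K with hg
  have hgc : Continuous g := (h.cont.comp (continuous_const.add
    (continuous_seg.comp (continuous_id.smul continuous_const)))).sub continuous_const
  have hadd : ∀ r s, 0 ≤ r → 0 ≤ s → g (r + s) = g r + g s := by
    intro r s hr hs
    have := h.val_eq (U := K + seg ((r + s) • u)) (I := K + pt (r • u)) (K := K + seg (r • u))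
      (L := K + seg (s • u) + pt (r • u)) ?_ ?_ ?_ ?_ ?_
    · rw [h.add_pt, h.add_pt] at this
      simp only [hg]; linarith
    all_goals simp only [mem_add_pt, mem_add_seg_smul hr, mem_add_seg_smul hs,
      mem_add_seg_smul (add_nonneg hr hs)]
    · rintro x ⟨t, ht, ht', hx⟩
      exact ⟨t, ht, by linarith, hx⟩
    · rintro x ⟨t, ht, ht', hx⟩
      exact ⟨r + t, by linarith, by linarith, by rwa [add_smul, ← sub_sub]⟩
    · rintro x ⟨t, ht, ht', hx⟩
      rcases le_total t r with htr | htr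
      · exact Or.inl ⟨t, ht, htr, hx⟩
      · refine Or.inr ⟨t - r, by linarith, by linarith, ?_⟩
        rwa [sub_sub, ← add_smul, add_sub_cancel]
    · intro x hx
      exact ⟨⟨r, hr, le_rfl, hx⟩, 0, le_rfl, hs, by simpa using hx⟩
    · rintro x ⟨t, ht, ht', hx⟩ ⟨t', hs, hs', hx'⟩
      rw [sub_sub, ← add_smul] at hx'
      exact sub_smul_mem hx hx' ht' (by linarith)
  have hnat : ∀ (n : ℕ) (r : ℝ), 0 ≤ r → g (n * r) = (n : ℝ) ^ 1 * g r := by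
    intro n r hr
    rw [pow_one]
    induction n with
    | zero => simp [hg, seg_zero]
    | succ n ih =>
      push_cast
      rw [add_mul, one_mul, hadd _ _ (by positivity) hr, ih]
      ring
  have := homogeneous_of_nat hgc 1 hnat hr
  simp only [hg, one_smul, pow_one] at this
  simp only [_root_.segDiff]
  linarith

theorem CTVal.cut (h : CTVal φ) {K P N I : ConvexBody V} (l : V →L[ℝ] ℝ) (c : ℝ)
    (hP : ∀ x, x ∈ P ↔ x ∈ K ∧ c ≤ l x) (hN : ∀ x, x ∈ N ↔ x ∈ K ∧ l x ≤ c)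
    (hI : ∀ x, x ∈ I ↔ x ∈ K ∧ l x = c) : φ K + φ I = φ N + φ P := by
  apply h.val_eq
  · intro x hx; exact ((hN x).1 hx).1
  · intro x hx; exact ((hP x).1 hx).1
  · intro x hx
    rcases le_total (l x) c with h | h
    · exact Or.inl ((hN x).2 ⟨hx, h⟩)
    · exact Or.inr ((hP x).2 ⟨hx, h⟩)
  · intro x hx
    have := (hI x).1 hx
    exact ⟨(hN x).2 ⟨this.1, this.2.le⟩, (hP x).2 ⟨this.1, this.2.ge⟩⟩
  · intro x h₁ h₂
    exact (hI x).2 ⟨((hN x).1 h₁).1, le_antisymm ((hN x).1 h₁).2 ((hP x).1 h₂).2⟩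

/-- The projection along `u` onto the kernel of `l`, where `l u = 1`. -/
def projAlong (l : V →L[ℝ] ℝ) (u : V) : V →L[ℝ] V :=
  ContinuousLinearMap.id ℝ V - l.smulRight u

@[simp] theorem projAlong_apply (l : V →L[ℝ] ℝ) (u x : V) : projAlong l u x = x - l x • u := rfl

/-- The increment along `u` only depends on the projection of the body along `u`. -/
theorem CTVal.segDiff_proj (h : CTVal φ) {l : V →L[ℝ] ℝ} {u : V} (hl : l u = 1)
    (X : ConvexBody V) :
    _root_.segDiff φ u (X.mapCLM (projAlong l u)) = _root_.segDiff φ u X := by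
  obtain ⟨C, hC, hXC⟩ := X.exists_norm_le
  set c : ℝ := ‖l‖ * C with hc
  have hc0 : 0 ≤ c := by positivity
  have hXl : ∀ x ∈ X, |l x| ≤ c := fun x hx =>
    (l.le_opNorm x).trans (by rw [hc]; gcongr; exact hXC x hx)
  set Y : ConvexBody V := X + pt (-(c • u)) with hY
  have hYl : ∀ x ∈ Y, l x ≤ 0 ∧ -(2 * c) ≤ l x := by
    intro x hx
    have := abs_le.1 (hXl _ (mem_add_pt.1 hx))
    simp only [sub_neg_eq_add, map_add, map_smul, smul_eq_mul, hl] at this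
    constructor <;> linarith
  set R : ℝ := 2 * c
  have hR : 0 ≤ R := by positivity
  have hπu : projAlong l u (-(c • u)) = 0 := by simp [hl]
  have hXY : _root_.segDiff φ u X = _root_.segDiff φ u Y :=
    ((h.segDiff u).add_pt X (-(c • u))).symm
  have hπ : X.mapCLM (projAlong l u) = Y.mapCLM (projAlong l u) := by
    rw [hY, mapCLM_add, mapCLM_pt, hπu, pt_zero, add_zero]
  rw [hXY, hπ]
  set Q := Y.mapCLM (projAlong l u)
  have hQ : ∀ x, x ∈ Q ↔ l x = 0 ∧ ∃ t : ℝ, 0 ≤ t ∧ t ≤ R ∧ x - t • u ∈ Y := by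
    intro x
    constructor
    · rintro ⟨y, hy, rfl⟩
      refine ⟨by simp [hl], -l y, by linarith [hYl y hy], by linarith [hYl y hy], by simpa using hy⟩
    · rintro ⟨hx, t, ht, ht', hy⟩
      exact ⟨_, hy, by simp [hx, hl]⟩
  obtain ⟨p, hp⟩ := Q.nonempty
  have hp' := (hQ p).1 hp
  have hmem : ∀ r : ℝ, 0 ≤ r → ∀ x, x ∈ Y + seg ((R + r) • u) ↔
      ∃ t : ℝ, 0 ≤ t ∧ t ≤ R + r ∧ x - t • u ∈ Y := fun r hr x =>
    mem_add_seg_smul (by linarith)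
  have hpm : ∀ r : ℝ, 0 ≤ r → p ∈ Y + seg ((R + r) • u) := fun r hr => by
    obtain ⟨t, ht, ht', hy⟩ := hp'.2
    exact (hmem r hr p).2 ⟨t, ht, by linarith, hy⟩
  let D := fun (r : ℝ) (hr : 0 ≤ r) => (Y + seg ((R + r) • u)).lower l 0 ⟨p, hpm r hr, hp'.1.le⟩
  let E := fun (r : ℝ) (hr : 0 ≤ r) => (Y + seg ((R + r) • u)).upper l 0 ⟨p, hpm r hr, hp'.1.ge⟩
  have hcut : ∀ r hr, φ (Y + seg ((R + r) • u)) + φ Q = φ (D r hr) + φ (E r hr) := by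
    intro r hr
    refine h.cut l 0 (fun x => Iff.rfl) (fun x => Iff.rfl) fun x => ?_
    rw [hQ, hmem r hr]
    constructor
    · rintro ⟨h₁, t, ht, ht', hy⟩
      exact ⟨⟨t, ht, by linarith, hy⟩, h₁⟩
    · rintro ⟨⟨t, ht, ht', hy⟩, h₁⟩
      refine ⟨h₁, t, ht, ?_, hy⟩
      have := (hYl _ hy).2
      simp [h₁, hl] at this
      linarith
  have hD : D 1 zero_le_one = D 0 le_rfl := by
    ext x
    simp only [mem_coe', D, mem_lower, hmem 1 zero_le_one, hmem 0 le_rfl]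
    constructor
    · rintro ⟨⟨t, ht, ht', hy⟩, h₁⟩
      refine ⟨⟨t, ht, ?_, hy⟩, h₁⟩
      have := (hYl _ hy).2
      simp [hl] at this
      linarith
    · rintro ⟨⟨t, ht, ht', hy⟩, h₁⟩
      exact ⟨⟨t, ht, by linarith, hy⟩, h₁⟩
  have hE : φ (E 1 zero_le_one) + φ (Q + pt u) = φ (Q + seg u) + φ (E 0 le_rfl + pt u) := by
    have hs : ∀ x, x ∈ Q + seg u ↔ ∃ t : ℝ, 0 ≤ t ∧ t ≤ 1 ∧ x - t • u ∈ Q := fun x => by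
      simpa using mem_add_seg_smul (K := Q) (u := u) (x := x) zero_le_one
    refine h.cut l 1 (fun x => ?_) (fun x => ?_) fun x => ?_
    · simp only [mem_add_pt, E, mem_upper, hmem 1 zero_le_one, hmem 0 le_rfl]
      constructor
      · rintro ⟨⟨t, ht, ht', hy⟩, h₁⟩
        simp only [map_sub, hl] at h₁
        refine ⟨⟨⟨t + 1, by linarith, by linarith, ?_⟩, by linarith⟩, by linarith⟩
        rwa [add_comm, add_smul, one_smul, ← sub_sub]
      · rintro ⟨⟨⟨t, ht, ht', hy⟩, -⟩, h₁⟩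
        have := (hYl _ hy).1
        simp [hl] at this
        refine ⟨⟨t - 1, by linarith, by linarith, ?_⟩, by simp [hl, h₁]⟩
        rwa [sub_sub, ← one_smul ℝ u, smul_smul, mul_one, ← add_smul, add_sub_cancel]
    · simp only [hs, hQ, E, mem_upper, hmem 1 zero_le_one]
      constructor
      · rintro ⟨s, hs, hs', h₁, t, ht, ht', hy⟩
        simp only [map_sub, map_smul, hl, smul_eq_mul, mul_one] at h₁
        refine ⟨⟨⟨s + t, by linarith, by linarith, ?_⟩, by linarith⟩, by linarith⟩
        rwa [add_smul, ← sub_sub]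
      · rintro ⟨⟨⟨t, ht, ht', hy⟩, h₁⟩, h₂⟩
        have := hYl _ hy
        simp [hl] at this
        refine ⟨l x, h₁, h₂, by simp [hl], t - l x, by linarith, by linarith, ?_⟩
        rwa [sub_sub, ← add_smul, add_sub_cancel]
    · simp only [mem_add_pt, hQ, E, mem_upper, hmem 1 zero_le_one]
      constructor
      · rintro ⟨h₁, t, ht, ht', hy⟩
        simp only [map_sub, hl] at h₁
        refine ⟨⟨⟨t + 1, by linarith, by linarith, ?_⟩, by linarith⟩, by linarith⟩
        rwa [add_comm, add_smul, one_smul, ← sub_sub]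
      · rintro ⟨⟨⟨t, ht, ht', hy⟩, -⟩, h₁⟩
        have := hYl _ hy
        simp [hl] at this
        refine ⟨by simp [hl, h₁], t - 1, by linarith, by linarith, ?_⟩
        rwa [sub_sub, ← one_smul ℝ u, smul_smul, mul_one, ← add_smul, add_sub_cancel]
  have h0 := hcut 0 le_rfl
  have h1 := hcut 1 zero_le_one
  rw [h.add_seg_smul _ _ (by linarith)] at h0 h1
  rw [hD] at h1
  rw [h.add_pt, h.add_pt] at hE
  have : _root_.segDiff φ u Q = φ (Q + seg u) - φ Q := rfl
  linarith

end Segments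

section Absorbing

variable {V : Type*} [NormedAddCommGroup V] [NormedSpace ℝ V]

theorem ConvexBody.mem_hull_union {s t : Set V} (hs : s.Finite) (hs' : s.Nonempty) (ht : t.Finite)
    (ht' : t.Nonempty) {x : V} : x ∈ hull (s ∪ t) ↔
      ∃ a ∈ hull s, ∃ b ∈ hull t, ∃ c : ℝ, 0 ≤ c ∧ c ≤ 1 ∧ x = (1 - c) • a + c • b := by
  rw [← mem_coe', coe_hull (hs.union ht) (hs'.inl), convexHull_union hs' ht', mem_convexJoin]
  simp only [← mem_coe', coe_hull hs hs', coe_hull ht ht']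
  constructor
  · rintro ⟨a, ha, b, hb, α, β, hα, hβ, h, rfl⟩
    exact ⟨a, ha, b, hb, β, hβ, by linarith, by rw [show 1 - β = α by linarith]⟩
  · rintro ⟨a, ha, b, hb, c, hc, hc', rfl⟩
    exact ⟨a, ha, b, hb, 1 - c, c, by linarith, hc, by ring, rfl⟩

variable {φ : ConvexBody V → ℝ}

/-- Cutting the sum of the two joins `hull (s ∪ t)` and `hull (s' ∪ t)`, where `s' ⊆ s`. -/
theorem CTVal.join_cut (h : CTVal φ) {s s' t : Set V} (hs : s.Finite)
    (hs' : s'.Nonempty) (hss : s' ⊆ s) (ht : t.Finite) (ht' : t.Nonempty) :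
    φ (hull (s ∪ t) + hull (s' ∪ t)) + φ (hull s + hull t)
      = φ (hull s + hull (s' ∪ t)) + φ (hull (s ∪ t) + hull t) := by
  have hfs' := hs.subset hss
  have hsn := hs'.mono hss
  have hsub : ∀ x ∈ hull s', x ∈ hull s := fun x hx => by
    rw [← mem_coe', coe_hull hfs' hs'] at hx
    rw [← mem_coe', coe_hull hs hsn]
    exact convexHull_mono hss hx
  have hK : ∀ x, x ∈ hull (s ∪ t) ↔ _ := fun x => mem_hull_union hs hsn ht ht'
  have hK' : ∀ x, x ∈ hull (s' ∪ t) ↔ _ := fun x => mem_hull_union hfs' hs' ht ht'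
  obtain ⟨a₀, ha₀⟩ := (hull s').nonempty
  obtain ⟨b₀, hb₀⟩ := (hull t).nonempty
  apply h.val_eq
  · rintro _ ⟨a, ha, k, hk, rfl⟩
    exact ⟨a, (hK a).2 ⟨a, ha, b₀, hb₀, 0, le_rfl, zero_le_one, by simp⟩, k, hk, rfl⟩
  · rintro _ ⟨k, hk, b, hb, rfl⟩
    exact ⟨k, hk, b, (hK' b).2 ⟨a₀, ha₀, b, hb, 1, zero_le_one, le_rfl, by simp⟩, rfl⟩
  · rintro _ ⟨_, hk, _, hk', rfl⟩
    obtain ⟨a, ha, b, hb, c, hc, hc', rfl⟩ := (hK _).1 hk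
    obtain ⟨a', ha', b', hb', d, hd, hd', rfl⟩ := (hK' _).1 hk'
    obtain ⟨b₁, hb₁, e₁⟩ := (hull t).exists_add_smul_eq hb hb' hc hd
    rcases le_total (c + d) 1 with hcd | hcd
    · left
      refine ⟨(1 - c) • a + c • a', (hull s).convex ha (hsub _ ha') (by linarith) hc (by ring),
        (1 - (c + d)) • a' + (c + d) • b₁, (hK' _).2 ⟨a', ha', b₁, hb₁, c + d, by linarith, hcd,
          rfl⟩, ?_⟩
      simp only [← e₁]
      module
    · right
      obtain ⟨a₁, ha₁, e₂⟩ := (hull s).exists_add_smul_eq ha (hsub _ ha') (α := 1 - c)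
        (β := 1 - d) (by linarith) (by linarith)
      refine ⟨(1 - (c + d - 1)) • a₁ + (c + d - 1) • b₁, (hK _).2 ⟨a₁, ha₁, b₁, hb₁, c + d - 1,
          by linarith, by linarith, rfl⟩, b₁, hb₁, ?_⟩
      simp only
      rw [show 1 - (c + d - 1) = 1 - c + (1 - d) by ring, ← e₂, sub_smul (c + d), ← e₁]
      module
  · rintro _ ⟨a, ha, b, hb, rfl⟩
    exact ⟨⟨a, ha, b, (hK' b).2 ⟨a₀, ha₀, b, hb, 1, zero_le_one, le_rfl, by simp⟩, rfl⟩,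
      a, (hK a).2 ⟨a, ha, b₀, hb₀, 0, le_rfl, zero_le_one, by simp⟩, b, hb, rfl⟩
  · rintro _ ⟨a, ha, _, hk, rfl⟩ ⟨_, hk', b, hb, heq⟩
    obtain ⟨a', ha', b', hb', c, hc, hc', rfl⟩ := (hK' _).1 hk
    obtain ⟨a'', ha'', b'', hb'', d, hd, hd', rfl⟩ := (hK _).1 hk'
    simp only at heq ⊢
    by_cases hD : 1 - c + d = 0
    · obtain rfl : c = 1 := by linarith
      exact ⟨a, ha, b', hb', by simp⟩
    have hD' : 0 < 1 - c + d := lt_of_le_of_ne (by linarith) (Ne.symm hD)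
    set α := d / (1 - c + d) with hα
    set β := (1 - c) / (1 - c + d) with hβ
    have hα0 : 0 ≤ α := by positivity
    have hβ0 : 0 ≤ β := div_nonneg (by linarith) hD'.le
    have hαβ : α + β = 1 := by rw [hα, hβ, ← add_div, add_comm, div_self hD]
    have hαβ' : α * (1 - c) = β * d := by rw [hα, hβ]; ring
    obtain ⟨a₁, ha₁, e₁⟩ := (hull s).exists_add_smul_eq ha (hsub _ ha') (α := α)
      (β := α * (1 - c)) hα0 (mul_nonneg hα0 (by linarith))
    obtain ⟨a₂, ha₂, e₂⟩ := (hull s).exists_add_smul_eq ha₁ ha'' (α := α + α * (1 - c))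
      (β := β * (1 - d)) (add_nonneg hα0 (mul_nonneg hα0 (by linarith)))
      (mul_nonneg hβ0 (by linarith))
    obtain ⟨b₁, hb₁, e₃⟩ := (hull t).exists_add_smul_eq hb hb'' (α := β) (β := β * d) hβ0
      (mul_nonneg hβ0 hd)
    obtain ⟨b₂, hb₂, e₄⟩ := (hull t).exists_add_smul_eq hb₁ hb' (α := β + β * d) (β := α * c)
      (add_nonneg hβ0 (mul_nonneg hβ0 hd)) (mul_nonneg hα0 hc)
    refine ⟨a₂, ha₂, b₂, hb₂, ?_⟩
    have e₅ : α + α * (1 - c) + β * (1 - d) = 1 := by linear_combination hαβ' + hαβ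
    have e₆ : β + β * d + α * c = 1 := by linear_combination hαβ - hαβ'
    rw [e₅, one_smul, ← e₁] at e₂
    rw [e₆, one_smul, ← e₃] at e₄
    rw [← e₂, ← e₄]
    set X := a + ((1 - c) • a' + c • b')
    calc _ = α • X + β • ((1 - d) • a'' + d • b'' + b) := by simp only [X]; module
      _ = X := by rw [heq, ← add_smul, hαβ, one_smul]

/-- A map is absorbing if it is unchanged by adding segments. -/
def Absorbing (φ : ConvexBody V → ℝ) : Prop := ∀ u K, φ (K + seg u) = φ K

theorem Absorbing.add_pair (ha : Absorbing φ) (h : CTVal φ) (K : ConvexBody V) (a b : V) :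
    φ (K + hull {a, b}) = φ K := by
  rw [hull_pair_eq, ← add_assoc, h.add_pt, ha]

omit [NormedAddCommGroup V] [NormedSpace ℝ V] in
theorem exists_five {s : Finset V} (hs : s.Nonempty) (hc : s.card ≤ 5) :
    ∃ a b c d e : V, (s : Set V) = {a, b, c, d, e} := by
  obtain ⟨x₀, hx₀⟩ := hs
  have hl : s.toList.length ≤ 5 := by simpa using hc
  let f : Fin 5 → V := fun i => s.toList.getD i x₀
  refine ⟨f 0, f 1, f 2, f 3, f 4, ?_⟩
  have hf : ∀ i, f i ∈ s := fun i => by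
    simp only [f, List.getD_eq_getElem?_getD]
    rcases lt_or_ge (i : ℕ) s.toList.length with h | h
    · rw [List.getElem?_eq_getElem h]; exact Finset.mem_toList.1 (List.getElem_mem _)
    · rw [List.getElem?_eq_none h]; exact hx₀
  ext x
  constructor
  · intro hx
    obtain ⟨n, hn, rfl⟩ := List.getElem_of_mem (Finset.mem_toList.2 hx)
    have : s.toList[n] = f ⟨n, by omega⟩ := by
      simp [f, List.getD_eq_getElem?_getD, List.getElem?_eq_getElem hn]
    rw [this]
    generalize (⟨n, _⟩ : Fin 5) = i
    fin_cases i <;> simp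
  · rintro (rfl | rfl | rfl | rfl | rfl) <;> exact hf _

theorem two_smul_body (K : ConvexBody V) : (2 : ℝ) • K = K + K := by
  rw [← one_add_one_eq_two, add_smul' K zero_le_one zero_le_one, one_smul']

theorem HomDeg.add_self {k : ℕ} (hh : HomDeg φ k) (K : ConvexBody V) :
    φ (K + K) = 2 ^ k * φ K := by
  rw [← two_smul_body, hh _ _ zero_le_two]

theorem HomDeg.zero_body {k : ℕ} (hk : k ≠ 0) (hh : HomDeg φ k) : φ 0 = 0 := by
  have := hh 0 0 le_rfl
  rwa [zero_smul', zero_pow hk, zero_mul] at this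

section

variable (h : CTVal φ) (ha : Absorbing φ) {k : ℕ} (hk : 2 ≤ k) (hh : HomDeg φ k)
include h ha hk hh

theorem Absorbing.pair_eq_zero (a b : V) : φ (hull {a, b}) = 0 := by
  rw [← zero_add (hull _), ha.add_pair h, hh.zero_body (by omega)]

theorem Absorbing.four_eq_zero (a b c d : V) : φ (hull {a, b, c, d}) = 0 := by
  have h2 : (2 : ℝ) ^ 2 ≤ 2 ^ k := pow_le_pow_right₀ one_le_two hk
  have := h.join_cut (s := {a, b}) (s' := {a, b}) (t := {c, d}) (by simp) (by simp) subset_rfl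
    (by simp) (by simp)
  simp only [Set.insert_union, Set.singleton_union] at this
  rw [hh.add_self, add_comm (hull {a, b}) (hull {a, b, c, d}), ha.add_pair h, ha.add_pair h,
    ha.add_pair h, ha.pair_eq_zero h hk hh] at this
  nlinarith

theorem Absorbing.three_eq_zero (a b c : V) : φ (hull {a, b, c}) = 0 := by
  simpa using ha.four_eq_zero h hk hh a a b c

theorem Absorbing.five_eq (a b c d e : V) :
    (2 ^ k - 2) * φ (hull {a, b, c, d, e}) = φ (hull {a, b, c} + hull {c, d, e}) := by
  have h₁ := h.join_cut (s := {a, b}) (s' := {a, b}) (t := {c, d, e}) (by simp) (by simp)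
    subset_rfl (by simp) (by simp)
  have h₂ := h.join_cut (s := {a, b, c}) (s' := {c}) (t := {d, e}) (by simp) (by simp)
    (by simp) (by simp) (by simp)
  simp only [Set.insert_union, Set.singleton_union] at h₁ h₂
  rw [hh.add_self, add_comm (hull {a, b}) (hull {c, d, e}),
    add_comm (hull {a, b}) (hull {a, b, c, d, e}), ha.add_pair h, ha.add_pair h,
    ha.three_eq_zero h hk hh] at h₁
  rw [ha.add_pair h, ha.add_pair h, ha.three_eq_zero h hk hh] at h₂
  linarith

omit hh hk in
theorem Absorbing.triangle_double (a b c : V) (Y : ConvexBody V) :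
    φ (hull {a, b, c} + hull {a, b, c} + Y) = 2 * φ (hull {a, b, c} + Y) - φ Y := by
  have := (h.comp_add Y).join_cut (s := {a}) (s' := {a}) (t := {b, c}) (by simp) (by simp)
    subset_rfl (by simp) (by simp)
  simp only [Set.singleton_union] at this
  rw [hull_singleton] at this
  have e₁ : ∀ K, φ (pt a + K + Y) = φ (K + Y) := fun K => by
    rw [add_comm (pt a), add_right_comm, h.add_pt]
  have e₂ : ∀ K, φ (K + hull {b, c} + Y) = φ (K + Y) := fun K => by
    rw [add_right_comm, ha.add_pair h]
  rw [e₁, e₁, e₂, ← zero_add (hull {b, c}), e₂, zero_add] at this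
  linarith

theorem Absorbing.triangle_double_left (a b c d e f : V) :
    φ (hull {a, b, c} + hull {a, b, c} + hull {d, e, f})
      = 2 * φ (hull {a, b, c} + hull {d, e, f}) := by
  rw [ha.triangle_double h, ha.three_eq_zero h hk hh, sub_zero]

theorem Absorbing.triangle_add (a b c d e f : V) :
    (2 ^ k - 4) * φ (hull {a, b, c} + hull {d, e, f}) = 0 := by
  have h₁ := ha.triangle_double h a b c (hull {d, e, f} + hull {d, e, f})
  have h₂ := ha.triangle_double_left h hk hh d e f a b c
  rw [hh.add_self, ha.three_eq_zero h hk hh, add_add_add_comm, hh.add_self,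
    add_comm (hull {a, b, c}) (_ + _), h₂, add_comm (hull {d, e, f})] at h₁
  linarith

end

section DegreeTwo

variable (h : CTVal φ) (ha : Absorbing φ) (hh : HomDeg φ 2)

/-- The value on the sum of the triangles spanned by `a, b` and by `c, d`. -/
def triSum (φ : ConvexBody V → ℝ) (a b c d : V) : ℝ :=
  φ (hull {0, a, a + b} + hull {0, c, c + d})

theorem triSum_comm (a b c d : V) : triSum φ a b c d = triSum φ c d a b := by
  rw [triSum, triSum, add_comm]

include h ha hh

omit hh in
theorem Absorbing.triSum_edge (a b c d : V) {s t : ℝ} (hs : 0 ≤ s) (ht : 0 ≤ t)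
    (hst : s + t = 1) : triSum φ a b c d + φ (hull {0, c, c + d})
      = triSum φ a (s • b) c d + triSum φ (a + s • b) (t • b) c d := by
  have := (h.comp_add (hull {0, c, c + d})).edge_split (a := a) (b := a + b) (p := a + s • b)
    (s := {0}) (by simp) (by simp) ⟨t, s, ht, hs, by rw [add_comm, hst], by
      rw [smul_add, ← add_assoc, ← add_smul, add_comm t, hst, one_smul]⟩
  simp only [triSum]
  rw [add_comm (hull {a + s • b, 0}), ha.add_pair h] at this
  rw [add_assoc a, ← add_smul, hst, one_smul]
  simpa only [Set.insert_comm _ (0 : V), Set.pair_comm _ (0 : V)] using this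

theorem Absorbing.triSum_shear_pos (a b c d : V) {r : ℝ} (hr : 0 ≤ r) :
    triSum φ a b (c + r • b) d = triSum φ a b c d := by
  have h5 : ∀ a b c d : V, 2 * φ (hull {0, a, a + b, a + b + c, a + b + c + d})
      = triSum φ a b c d := by
    intro a b c d
    have := ha.five_eq h le_rfl hh 0 a (a + b) (a + b + c) (a + b + c + d)
    rw [show hull {a + b, a + b + c, a + b + c + d} = hull {0, c, c + d} + pt (a + b) by
      rw [← hull_translate (by simp) (by simp)]
      congr 1
      rw [Set.image_insert_eq, Set.image_insert_eq, Set.image_singleton, zero_add,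
        show c + (a + b) = a + b + c by abel, show c + d + (a + b) = a + b + c + d by abel],
        ← add_assoc, h.add_pt] at this
    rw [triSum, ← this]
    ring
  have key : ∀ (B : V) {s t : ℝ}, 0 ≤ s → 0 ≤ t → s + t = 1 →
      triSum φ a (s • B) c d = triSum φ a (s • B) (t • B + c) d := by
    intro B s t hs ht hst
    have e1 := ha.triSum_edge h a B c d hs ht hst
    rw [ha.three_eq_zero h le_rfl hh] at e1
    have e2 := h.edge_split (a := a) (b := a + B) (p := a + s • B)
      (s := {0, a + B + c, a + B + c + d}) (by simp) (by simp)
      ⟨t, s, ht, hs, by rw [add_comm, hst], by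
        rw [smul_add, ← add_assoc, ← add_smul, add_comm t, hst, one_smul]⟩
    rw [ha.four_eq_zero h le_rfl hh] at e2
    have e3 := h5 a B c d
    have e4 := h5 a (s • B) (t • B + c) d
    have e5 := h5 (a + s • B) (t • B) c d
    have eB : s • B + t • B = B := by rw [← add_smul, hst, one_smul]
    have : a + s • B + (t • B + c) = a + B + c := by
      rw [show a + B + c = a + (s • B + t • B) + c by rw [eB]]; abel
    rw [this] at e4
    rw [add_assoc a, eB] at e5
    rw [Set.insert_comm _ 0, Set.insert_comm _ 0, Set.insert_comm _ 0] at e2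
    simp only [Set.insert_comm _ (0 : V)] at e2 e3 e4 e5
    linarith
  have hr' : 0 < 1 + r := by linarith
  have := key ((1 + r) • b) (s := 1 / (1 + r)) (t := r / (1 + r)) (by positivity) (by positivity)
    (by field_simp)
  rw [smul_smul, smul_smul, one_div_mul_cancel hr'.ne', div_mul_cancel₀ _ hr'.ne', one_smul,
    add_comm] at this
  exact this.symm

theorem Absorbing.triSum_shear (a b c d : V) (r : ℝ) :
    triSum φ a b (c + r • b) d = triSum φ a b c d := by
  rcases le_total 0 r with hr | hr
  · exact ha.triSum_shear_pos h hh a b c d hr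
  · have := ha.triSum_shear_pos h hh a b (c + r • b) d (r := -r) (by linarith)
    rw [← this]
    congr 1
    module

theorem Absorbing.triSum_swap (a b c d : V) : triSum φ b a c d = -triSum φ a b c d := by
  have hc := h.comp_add (hull {0, c, c + d})
  have hm : (1 / 2 : ℝ) • (a + b) ∈ convexHull ℝ ({0, a + b} : Set V) := by
    rw [convexHull_pair]
    exact ⟨1 / 2, 1 / 2, by norm_num, by norm_num, by norm_num, by simp⟩
  have := hc.edge_split (a := a) (b := b) (p := (1 / 2 : ℝ) • (a + b)) (s := {0, a + b})
    (by simp) (by simp) ⟨1 / 2, 1 / 2, by norm_num, by norm_num, by norm_num, by module⟩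
  rw [hull_insert_of_mem (by simp) hm, Set.insert_comm _ b,
    Set.insert_comm a ((1 / 2 : ℝ) • (a + b)),
    hull_insert_of_mem (p := (1 / 2 : ℝ) • (a + b)) (by simp)
      (convexHull_mono (Set.subset_insert _ _) hm),
    hull_insert_of_mem (p := (1 / 2 : ℝ) • (a + b)) (by simp)
      (convexHull_mono (Set.subset_insert _ _) hm)] at this
  have hpar : hull {b, a, 0, a + b} = hull {0, a} + hull {0, b} := by
    rw [hull_add_hull (by simp) (by simp) (by simp) (by simp)]
    congr 1
    ext x
    simp only [Set.mem_insert_iff, Set.mem_singleton_iff, Set.mem_add, exists_eq_or_imp,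
      exists_eq_left, zero_add, add_zero]
    grind
  rw [hpar, add_comm (hull {0, a + b}), ha.add_pair h,
    add_comm _ (hull {0, c, c + d}), ← add_assoc, ha.add_pair h, ha.add_pair h,
    ha.three_eq_zero h le_rfl hh, Set.insert_comm a 0, Set.insert_comm b 0] at this
  simp only [triSum, add_comm b a]
  linarith

theorem Absorbing.triSum_shear_left (a b c d : V) (r : ℝ) :
    triSum φ (a + r • d) b c d = triSum φ a b c d := by
  rw [triSum_comm, ha.triSum_shear h hh, triSum_comm]

theorem Absorbing.triSum_shear_inner (a b c d : V) (r : ℝ) :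
    triSum φ (a + r • b) b c d = triSum φ a b c d := by
  have hI : ∀ a b c d : V, ∀ r : ℝ, triSum φ (a + r • c) b c d = triSum φ a b c d := by
    intro a b c d r
    have hs : ∀ a b c d : V, triSum φ a b d c = -triSum φ a b c d := fun a b c d => by
      rw [triSum_comm, ha.triSum_swap h hh, triSum_comm]
    rw [← neg_inj, ← hs, ← hs, ha.triSum_shear_left h hh]
  have h₁ := hI a b (c + r • b) d 1
  have h₂ := ha.triSum_shear h hh (a + (c + r • b)) b (c + r • b) d (-r)
  have h₃ := hI (a + (c + r • b)) b c d (-1)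
  rw [show c + r • b + -r • b = c by module] at h₂
  rw [show a + (c + r • b) + (-1 : ℝ) • c = a + r • b by module] at h₃
  rw [one_smul] at h₁
  rw [h₃, h₂, h₁, ha.triSum_shear h hh]

theorem Absorbing.triSum_diag (a b c d : V) {r : ℝ} (hr : r ≠ 0) :
    triSum φ (r • a) (r⁻¹ • b) c d = triSum φ a b c d := by
  have hS : ∀ a b : V, ∀ r : ℝ, triSum φ a (b + r • a) c d = triSum φ a b c d := fun a b r => by
    have := ha.triSum_shear_inner h hh b a c d r
    rwa [ha.triSum_swap h hh, ha.triSum_swap h hh a b, neg_inj] at this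
  have key : ∀ a b : V, ∀ r : ℝ, r ≠ 0 → triSum φ (r • b) (-r⁻¹ • a) c d = triSum φ a b c d := by
    intro a b r hr
    have e₁ := ha.triSum_shear_inner h hh a b c d r
    have e₂ := hS (a + r • b) b (-r⁻¹)
    rw [show b + -r⁻¹ • (a + r • b) = -r⁻¹ • a by match_scalars <;> field_simp; ring] at e₂
    have e₃ := ha.triSum_shear_inner h hh (a + r • b) (-r⁻¹ • a) c d r
    rw [show a + r • b + r • -r⁻¹ • a = r • b by match_scalars <;> field_simp; ring] at e₃
    rw [e₃, e₂, e₁]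
  have e₁ := key (r⁻¹ • b) (-r • a) (-1) (by norm_num)
  have e₂ := key a b r⁻¹ (inv_ne_zero hr)
  rw [inv_inv] at e₂
  rw [← e₂, ← e₁]
  congr 1 <;> module

theorem Absorbing.triSum_eq_zero (a b c d : V) : triSum φ a b c d = 0 := by
  have hdbl : ∀ a b : V, triSum φ ((2 : ℝ) • a) ((2 : ℝ) • b) c d = 2 * triSum φ a b c d := by
    intro a b
    rw [triSum, triSum, ← ha.triangle_double_left h le_rfl hh, ← two_smul_body]
    congr 2
    rw [smul_eq_mapCLM, mapCLM_hull _ (by simp) (by simp)]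
    simp [Set.image_insert_eq]
  have hhalf : ∀ a b : V, triSum φ ((2 : ℝ) • a) b c d = 2 * triSum φ a b c d := by
    intro a b
    have := ha.triSum_edge h b ((2 : ℝ) • a) c d (s := 1 / 2) (t := 1 / 2) (by norm_num)
      (by norm_num) (by norm_num)
    rw [smul_smul, ha.three_eq_zero h le_rfl hh] at this
    norm_num at this
    have e := ha.triSum_shear_inner h hh b a c d 1
    rw [one_smul] at e
    rw [ha.triSum_swap h hh b, ha.triSum_swap h hh b a, this, e]
    ring
  have h₁ : triSum φ ((2 : ℝ) • (2 : ℝ) • a) ((2 : ℝ) • (2 : ℝ) • b) c d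
      = 4 * triSum φ a b c d := by
    rw [hdbl, hdbl]; ring
  have h₂ := ha.triSum_diag h hh ((2 : ℝ) • (2 : ℝ) • a) ((2 : ℝ) • (2 : ℝ) • b) c d (r := 4)
    (by norm_num)
  rw [show (4 : ℝ)⁻¹ • (2 : ℝ) • (2 : ℝ) • b = b by match_scalars; norm_num,
    show (4 : ℝ) • (2 : ℝ) • (2 : ℝ) • a = (2 : ℝ) • (2 : ℝ) • (2 : ℝ) • (2 : ℝ) • a by module,
    hhalf, hhalf, hhalf, hhalf, h₁] at h₂
  linarith

end DegreeTwo

theorem hull_triple_eq (a b c : V) :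
    hull {a, b, c} = hull {0, b - a, (b - a) + (c - b)} + pt a := by
  rw [← hull_translate (by simp) (by simp)]
  simp [Set.image_insert_eq]

/-- An absorbing continuous translation invariant valuation which is homogeneous of degree at
least two vanishes in dimension at most four. -/
theorem Absorbing.eq_zero [FiniteDimensional ℝ V] (hd : finrank ℝ V ≤ 4) (h : CTVal φ)
    (ha : Absorbing φ) {k : ℕ} (hk : 2 ≤ k) (hh : HomDeg φ k) (K : ConvexBody V) : φ K = 0 := by
  refine h.eq_zero_of_simplices (fun s hs hc => ?_) K
  obtain ⟨a, b, c, d, e, he⟩ := exists_five hs (by omega)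
  rw [he]
  have h₁ := ha.five_eq h hk hh a b c d e
  have h2 : (2 : ℝ) ^ 2 ≤ 2 ^ k := pow_le_pow_right₀ one_le_two hk
  have h₃ : φ (hull {a, b, c} + hull {c, d, e}) = 0 := by
    rcases hk.eq_or_lt with rfl | hk'
    · have := ha.triSum_eq_zero h hh (b - a) (c - b) (d - c) (e - d)
      rw [triSum] at this
      rw [hull_triple_eq a, hull_triple_eq c, ← add_assoc, h.add_pt, add_right_comm, h.add_pt, this]
    · have h4 : (2 : ℝ) ^ 3 ≤ 2 ^ k := pow_le_pow_right₀ one_le_two hk'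
      have := ha.triangle_add h hk hh a b c c d e
      rcases mul_eq_zero.1 this with h | h
      · linarith
      · exact h
  rw [h₃] at h₁
  rcases mul_eq_zero.1 h₁ with h | h
  · linarith
  · exact h

end Absorbing

section Generalities

variable {V V' : Type*} [NormedAddCommGroup V] [NormedSpace ℝ V]
  [NormedAddCommGroup V'] [NormedSpace ℝ V']

theorem eq_zero_of_forall_pos {F : ℝ → ℝ} (hF : Continuous F) (h : ∀ t, 0 < t → F t = 0) :
    F 0 = 0 := by
  have h₁ : Filter.Tendsto F (nhdsWithin 0 (Set.Ioi 0)) (nhds (F 0)) :=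
    (hF.tendsto 0).mono_left nhdsWithin_le_nhds
  refine tendsto_nhds_unique h₁ (tendsto_const_nhds.congr' ?_)
  filter_upwards [self_mem_nhdsWithin] with t ht using (h t ht).symm

theorem homDeg_of_pos {φ : ConvexBody V → ℝ} (hφ : Continuous φ) {k : ℕ}
    (h : ∀ K t, 0 < t → φ (t • K) = t ^ k * φ K) : HomDeg φ k := by
  intro K t ht
  rcases ht.eq_or_lt with rfl | ht
  · have := eq_zero_of_forall_pos (F := fun t => φ (t • K) - t ^ k * φ K)
      (by
        have : Continuous fun t : ℝ => φ (t • K) :=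
          hφ.comp (continuous_id.smul continuous_const)
        fun_prop) (fun t ht => sub_eq_zero.2 (h K t ht))
    exact sub_eq_zero.1 this
  · exact h K t ht

theorem CTVal.segDiff_smul {φ : ConvexBody V → ℝ} (h : CTVal φ) (u : V) {r : ℝ} (hr : 0 ≤ r)
    (K : ConvexBody V) : _root_.segDiff φ (r • u) K = r * _root_.segDiff φ u K := by
  rw [_root_.segDiff, h.add_seg_smul K u hr]
  ring

theorem HomDeg.segDiff {φ : ConvexBody V → ℝ} {k : ℕ} (hh : HomDeg φ (k + 1)) (h : CTVal φ)
    (u : V) : HomDeg (segDiff φ u) k := by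
  refine homDeg_of_pos (h.segDiff u).cont fun K t ht => ?_
  have h₁ := h.segDiff_smul u ht.le (t • K)
  rw [_root_.segDiff, ← smul_seg, ← smul_add, hh _ _ ht.le, hh _ _ ht.le] at h₁
  apply mul_left_cancel₀ ht.ne'
  rw [← h₁, _root_.segDiff]
  ring

theorem segDiff_comm (φ : ConvexBody V → ℝ) (u v : V) :
    segDiff (segDiff φ u) v = segDiff (segDiff φ v) u := by
  funext K
  simp only [segDiff, add_right_comm K (seg v)]
  ring

theorem continuous_segDiff {φ : ConvexBody V → ℝ} (h : Continuous φ) {X : Type*}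
    [TopologicalSpace X] {u : X → V} {K : X → ConvexBody V} (hu : Continuous u)
    (hK : Continuous K) : Continuous fun x => segDiff φ (u x) (K x) :=
  (h.comp (hK.add (continuous_seg.comp hu))).sub (h.comp hK)

theorem continuous_segDiff_segDiff {φ : ConvexBody V → ℝ} (h : Continuous φ) {X : Type*}
    [TopologicalSpace X] {u v : X → V} {K : X → ConvexBody V} (hu : Continuous u)
    (hv : Continuous v) (hK : Continuous K) :
    Continuous fun x => segDiff (segDiff φ (u x)) (v x) (K x) :=
  (continuous_segDiff h hu (hK.add (continuous_seg.comp hv))).sub (continuous_segDiff h hu hK)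

theorem absorbing_of_segDiff {φ : ConvexBody V → ℝ} (h : ∀ u K, segDiff φ u K = 0) :
    Absorbing φ := fun u K => sub_eq_zero.1 (h u K)

theorem homComp_mapCLM {φ : ConvexBody V → ℝ} {ψ : ConvexBody V' → ℝ} {f : V →L[ℝ] V'} {c : ℝ}
    (h : ∀ K, ψ (K.mapCLM f) = c * φ K) (i : ℕ) (K : ConvexBody V) :
    homComp ψ i (K.mapCLM f) = c * homComp φ i K := by
  have : ∀ j : ℕ, ψ ((j : ℝ) • K.mapCLM f) = c * φ ((j : ℝ) • K) := fun j => by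
    rw [← mapCLM_smul, h]
  unfold homComp
  match i with
  | 0 => simp only [interpCoeff, this]
  | 1 => simp only [interpCoeff, this]; ring
  | 2 => simp only [interpCoeff, this]; ring
  | 3 => simp only [interpCoeff, this]; ring
  | 4 => simp only [interpCoeff, this]; ring
  | n + 5 => simp [interpCoeff]

/-- The real determinant of two complex numbers. -/
def det2 (z w : ℂ) : ℝ := z.re * w.im - z.im * w.re

theorem eq_zero_of_det2 {F : ℂ → ℂ → ℝ} (hF : Continuous fun p : ℂ × ℂ => F p.1 p.2)
    (h : ∀ u v, det2 u v ≠ 0 → F u v = 0) (u v : ℂ) : F u v = 0 := by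
  have h₁ : ∀ u v, v ≠ 0 → F u v = 0 := by
    intro u v hv
    by_cases hd : det2 u v = 0
    · have := eq_zero_of_forall_pos (F := fun t : ℝ => F (u + t * (Complex.I * v)) v)
        (hF.comp (by fun_prop : Continuous fun t : ℝ => (u + t * (Complex.I * v), v)))
        (fun t ht => h _ _ ?_)
      · simpa using this
      · have e : det2 (u + t * (Complex.I * v)) v = det2 u v - t * Complex.normSq v := by
          simp [det2, Complex.normSq_apply]
          ring
        rw [e, hd, zero_sub, neg_ne_zero]
        exact mul_ne_zero ht.ne' (by simpa using hv)
    · exact h u v hd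
  by_cases hv : v = 0
  · subst hv
    have := eq_zero_of_forall_pos (F := fun t : ℝ => F u t)
      (hF.comp (by fun_prop : Continuous fun t : ℝ => (u, (t : ℂ))))
      (fun t ht => h₁ u t (by exact_mod_cast ht.ne'))
    simpa using this
  · exact h₁ u v hv

end Generalities

section Plane

/-- The complex `2 × 2` matrix with rows `(a, b)` and `(c, d)` as a real linear map. -/
def mat (a b c d : ℂ) : ℂ × ℂ →L[ℝ] ℂ × ℂ :=
  (ContinuousLinearMap.inl ℝ ℂ ℂ).comp
      (a • ContinuousLinearMap.fst ℝ ℂ ℂ + b • ContinuousLinearMap.snd ℝ ℂ ℂ)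
    + (ContinuousLinearMap.inr ℝ ℂ ℂ).comp
      (c • ContinuousLinearMap.fst ℝ ℂ ℂ + d • ContinuousLinearMap.snd ℝ ℂ ℂ)

@[simp] theorem mat_apply (a b c d : ℂ) (p : ℂ × ℂ) :
    mat a b c d p = (a * p.1 + b * p.2, c * p.1 + d * p.2) := by
  simp [mat]

theorem continuous_mat {X : Type*} [TopologicalSpace X] {a b c d : X → ℂ} (ha : Continuous a)
    (hb : Continuous b) (hc : Continuous c) (hd : Continuous d) :
    Continuous fun x => mat (a x) (b x) (c x) (d x) := by
  unfold mat
  fun_prop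

theorem mat_comp (a b c d a' b' c' d' : ℂ) : (mat a b c d).comp (mat a' b' c' d')
    = mat (a * a' + b * c') (a * b' + b * d') (c * a' + d * c') (c * b' + d * d') := by
  ext p <;> simp <;> ring

theorem mat_one : mat 1 0 0 1 = ContinuousLinearMap.id ℝ (ℂ × ℂ) := by
  ext p <;> simp

theorem smul_mat (r : ℝ) (a b c d : ℂ) (K : ConvexBody (ℂ × ℂ)) :
    r • K.mapCLM (mat a b c d) = K.mapCLM (mat (r * a) (r * b) (r * c) (r * d)) := by
  rw [smul_eq_mapCLM, mapCLM_mapCLM]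
  congr 1
  ext p <;> simp [mul_assoc]

theorem finrank_plane : finrank ℝ (ℂ × ℂ) = 4 := by
  simp [Complex.finrank_real_complex]

/-- The behaviour of the functional `h(Φ(Z K), e₁)` under diagonal matrices. -/
def DiagCov (χ : ConvexBody (ℂ × ℂ) → ℝ) : Prop :=
  ∀ t : ℝ, 0 < t → ∀ K, χ (K.mapCLM (mat (t⁻¹ : ℝ) 0 0 t)) = t * χ K

variable {χ : ConvexBody (ℂ × ℂ) → ℝ}

theorem DiagCov.homComp (hc : DiagCov χ) (i : ℕ) : DiagCov (homComp χ i) := fun t ht K =>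
  homComp_mapCLM (hc t ht) i K

theorem DiagCov.scale_left (hc : DiagCov χ) {k : ℕ} (hh : HomDeg χ k) {s : ℝ} (hs : 0 < s)
    (K : ConvexBody (ℂ × ℂ)) : s * χ (K.mapCLM (mat (s ^ 2 : ℝ) 0 0 1)) = s ^ k * χ K := by
  have h₁ := hc s⁻¹ (inv_pos.2 hs) K
  have h₂ := hh (K.mapCLM (mat ((s⁻¹)⁻¹ : ℝ) 0 0 (s⁻¹ : ℝ))) s hs.le
  rw [h₁, smul_mat] at h₂
  have e : mat (s * ((s⁻¹)⁻¹ : ℝ)) (s * 0) (s * 0) (s * (s⁻¹ : ℝ)) = mat (s ^ 2 : ℝ) 0 0 1 := by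
    congr 1
    · push_cast; rw [inv_inv, sq]
    · simp
    · simp
    · push_cast; exact mul_inv_cancel₀ (by exact_mod_cast hs.ne')
  rw [e] at h₂
  rw [h₂]
  field_simp

theorem DiagCov.scale_right (hc : DiagCov χ) {k : ℕ} (hh : HomDeg χ k) {s : ℝ} (hs : 0 < s)
    (K : ConvexBody (ℂ × ℂ)) : χ (K.mapCLM (mat 1 0 0 (s ^ 2 : ℝ))) = s ^ (k + 1) * χ K := by
  have h₁ := hc s hs K
  have h₂ := hh (K.mapCLM (mat (s⁻¹ : ℝ) 0 0 s)) s hs.le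
  rw [h₁, smul_mat] at h₂
  have e : mat (s * (s⁻¹ : ℝ)) (s * 0) (s * 0) (s * s) = mat 1 0 0 (s ^ 2 : ℝ) := by
    congr 1
    · push_cast; exact mul_inv_cancel₀ (by exact_mod_cast hs.ne')
    · simp
    · simp
    · push_cast; ring
  rw [e] at h₂
  rw [h₂]
  ring

/-- The inclusion of the first coordinate axis. -/
abbrev inl2 : ℂ →L[ℝ] ℂ × ℂ := ContinuousLinearMap.inl ℝ ℂ ℂ

/-- The inclusion of the second coordinate axis. -/
abbrev inr2 : ℂ →L[ℝ] ℂ × ℂ := ContinuousLinearMap.inr ℝ ℂ ℂ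

theorem CTVal.segDiff_segDiff_eq (h : CTVal χ) {u v : ℂ × ℂ} (huv : det2 u.2 v.2 ≠ 0)
    (K : ConvexBody (ℂ × ℂ)) : ∃ A : ConvexBody ℂ,
      _root_.segDiff (_root_.segDiff χ u) v K
        = _root_.segDiff (_root_.segDiff χ u) v (A.mapCLM inl2) := by
  let D : ℂ → ℂ × ℂ →L[ℝ] ℝ := fun w =>
    ((det2 u.2 v.2)⁻¹ * w.im) • Complex.reCLM.comp (ContinuousLinearMap.snd ℝ ℂ ℂ)
      - ((det2 u.2 v.2)⁻¹ * w.re) • Complex.imCLM.comp (ContinuousLinearMap.snd ℝ ℂ ℂ)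
  have hD : ∀ w p, D w p = (det2 u.2 v.2)⁻¹ * det2 p.2 w := fun w p => by
    simp [D, det2]; ring
  have hself : ∀ z, det2 z z = 0 := fun z => by simp [det2]; ring
  have h₁ : D v.2 u = 1 := by rw [hD, inv_mul_cancel₀ huv]
  have h₂ : D (-u.2) v = 1 := by
    rw [hD, show det2 v.2 (-u.2) = det2 u.2 v.2 by simp [det2]; ring, inv_mul_cancel₀ huv]
  have h₃ : D v.2 v = 0 := by rw [hD, hself, mul_zero]
  have h₄ : D (-u.2) u = 0 := by
    rw [hD, show det2 u.2 (-u.2) = 0 by simp [det2]; ring, mul_zero]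
  have e₁ := (h.segDiff u).segDiff_proj h₂ K
  have e₂ := (h.segDiff v).segDiff_proj h₁ (K.mapCLM (projAlong (D (-u.2)) v))
  rw [← segDiff_comm, e₁] at e₂
  rw [← e₂]
  refine ⟨((K.mapCLM (projAlong (D (-u.2)) v)).mapCLM (projAlong (D v.2) u)).mapCLM
    (ContinuousLinearMap.fst ℝ ℂ ℂ), ?_⟩
  congr 1
  refine (mapCLM_id _).symm.trans (Eq.trans (mapCLM_congr ?_) (mapCLM_mapCLM _ _ _).symm)
  rintro _ ⟨_, ⟨p, -, rfl⟩, rfl⟩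
  set q := projAlong (D v.2) u (projAlong (D (-u.2)) v p) with hq
  have k₁ : D v.2 q = 0 := by simp [hq, h₁]
  have k₂ : D (-u.2) q = 0 := by simp [hq, h₂, h₄]
  rw [hD, mul_eq_zero, or_iff_right (inv_ne_zero huv)] at k₁ k₂
  have k₃ : q.2 = 0 := by
    simp only [det2, Complex.neg_re, Complex.neg_im] at k₁ k₂ huv
    apply Complex.ext
    · apply mul_right_cancel₀ huv
      rw [Complex.zero_re, zero_mul]
      linear_combination u.2.re * k₁ + v.2.re * k₂
    · apply mul_right_cancel₀ huv
      rw [Complex.zero_im, zero_mul]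
      linear_combination u.2.im * k₁ + v.2.im * k₂
  ext <;> simp [k₃]

theorem DiagCov.segDiff_segDiff_inl (hc : DiagCov χ) (h : CTVal χ) {m : ℕ}
    (hh : HomDeg χ (m + 3)) (u v : ℂ × ℂ) (A : ConvexBody ℂ) :
    segDiff (segDiff χ u) v (A.mapCLM inl2)
      = 0 ^ m * segDiff (segDiff χ (0, u.2)) (0, v.2) (A.mapCLM inl2) := by
  set F : ℝ → ℝ := fun s => segDiff (segDiff χ u) v (A.mapCLM inl2)
    - s ^ m * segDiff (segDiff χ (mat (s ^ 2 : ℝ) 0 0 1 u)) (mat (s ^ 2 : ℝ) 0 0 1 v)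
      (A.mapCLM inl2) with hF
  have hFc : Continuous F := by
    have : Continuous fun s : ℝ => segDiff (segDiff χ (mat (s ^ 2 : ℝ) 0 0 1 u))
        (mat (s ^ 2 : ℝ) 0 0 1 v) (A.mapCLM inl2) := by
      refine continuous_segDiff_segDiff h.cont ?_ ?_ continuous_const <;>
        simp only [mat_apply] <;> fun_prop
    fun_prop
  have hpos : ∀ s, 0 < s → F s = 0 := by
    intro s hs
    have hγ : HomDeg (segDiff (segDiff χ (mat (s ^ 2 : ℝ) 0 0 1 u)) (mat (s ^ 2 : ℝ) 0 0 1 v))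
        (m + 1) := HomDeg.segDiff (HomDeg.segDiff hh h _) (h.segDiff _) _
    have h₁ : s * segDiff (segDiff χ (mat (s ^ 2 : ℝ) 0 0 1 u)) (mat (s ^ 2 : ℝ) 0 0 1 v)
        ((A.mapCLM inl2).mapCLM (mat (s ^ 2 : ℝ) 0 0 1))
        = s ^ (m + 3) * segDiff (segDiff χ u) v (A.mapCLM inl2) := by
      simp only [segDiff, ← mapCLM_seg, ← mapCLM_add, mul_sub, hc.scale_left hh hs]
    have h₂ : (A.mapCLM inl2).mapCLM (mat (s ^ 2 : ℝ) 0 0 1) = (s ^ 2) • A.mapCLM inl2 := by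
      rw [mapCLM_mapCLM, ← mapCLM_smul, smul_eq_mapCLM, mapCLM_mapCLM]
      congr 1
      ext z <;> simp
    rw [h₂, hγ _ _ (by positivity)] at h₁
    rw [hF]
    apply mul_left_cancel₀ (pow_ne_zero (m + 3) hs.ne')
    simp only [mul_sub, mul_zero]
    rw [← h₁]
    ring
  have := eq_zero_of_forall_pos hFc hpos
  rw [hF] at this
  simp only [ne_eq, OfNat.ofNat_ne_zero, not_false_eq_true, zero_pow, mat_apply,
    Complex.ofReal_zero, zero_mul, one_mul, zero_add, add_zero] at this
  linarith

/-- A valuation of degree `3` or `4` with the equivariance of `h(Φ(Z K), e₁)` vanishes as soon as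
it vanishes on products with parallelograms (which is automatic in degree `4`). -/
theorem DiagCov.eq_zero_of_prod (hc : DiagCov χ) (h : CTVal χ) {k : ℕ} (hh : HomDeg χ k)
    (hk : k = 4 ∨ (k = 3 ∧ ∀ (A : ConvexBody ℂ) (u v : ℂ),
      χ (A.mapCLM inl2 + (seg u + seg v).mapCLM inr2) = 0)) (K : ConvexBody (ℂ × ℂ)) :
    χ K = 0 := by
  obtain ⟨m, rfl⟩ : ∃ m, k = m + 3 := ⟨k - 3, by omega⟩
  have hγ₀ : ∀ u v : ℂ × ℂ, ∀ A : ConvexBody ℂ,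
      segDiff (segDiff χ u) v (A.mapCLM inl2) = 0 := by
    intro u v A
    rw [hc.segDiff_segDiff_inl h hh]
    rcases hk with hk | ⟨-, hk⟩
    · obtain rfl : m = 1 := by omega
      simp
    · have e : ∀ w : ℂ, seg ((0, w) : ℂ × ℂ) = (seg w).mapCLM inr2 := fun w => by
        rw [mapCLM_seg]; rfl
      have e₀ : ∀ w : ℂ, χ (A.mapCLM inl2 + (seg w).mapCLM inr2) = 0 := fun w => by
        simpa [seg_zero] using hk A w 0
      have e₁ : χ (A.mapCLM inl2) = 0 := by
        have e' : (0 : ConvexBody ℂ).mapCLM inr2 = 0 := by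
          rw [← pt_zero, mapCLM_pt, map_zero, pt_zero]
        simpa [seg_zero, e'] using e₀ 0
      have : segDiff (segDiff χ ((0, u.2) : ℂ × ℂ)) (0, v.2) (A.mapCLM inl2) = 0 := by
        simp only [segDiff, e, e₀, e₁]
        rw [add_assoc, ← mapCLM_add, hk]
        simp
      rw [this, mul_zero]
  have hγ : ∀ u v K, segDiff (segDiff χ u) v K = 0 := by
    intro u v K
    refine eq_zero_of_det2 (F := fun u₂ v₂ => segDiff (segDiff χ (u.1, u₂)) (v.1, v₂) K)
      (continuous_segDiff_segDiff h.cont (by fun_prop) (by fun_prop) continuous_const)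
      (fun u₂ v₂ huv => ?_) u.2 v.2
    obtain ⟨A, hA⟩ := h.segDiff_segDiff_eq (u := (u.1, u₂)) (v := (v.1, v₂)) huv K
    rw [hA, hγ₀]
  have hT : ∀ u K, segDiff χ u K = 0 := fun u K =>
    (absorbing_of_segDiff (hγ u)).eq_zero finrank_plane.le (h.segDiff u) (by omega)
      (HomDeg.segDiff hh h u) K
  exact (absorbing_of_segDiff hT).eq_zero finrank_plane.le h (by omega) hh K

end Plane

theorem exists_eq_range {V : Type*} {s : Finset V} (hs : s.Nonempty) {n : ℕ} (hc : s.card ≤ n) :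
    ∃ f : Fin n → V, (s : Set V) = Set.range f := by
  obtain ⟨x₀, hx₀⟩ := hs
  refine ⟨fun i => s.toList.getD i x₀, Set.ext fun x => ⟨fun hx => ?_, ?_⟩⟩
  · obtain ⟨m, hm, rfl⟩ := List.getElem_of_mem (Finset.mem_toList.2 hx)
    have hm' : m < s.card := by simpa using hm
    exact ⟨⟨m, by omega⟩, by simp [List.getD_eq_getElem?_getD, List.getElem?_eq_getElem hm]⟩
  · rintro ⟨i, rfl⟩
    simp only [List.getD_eq_getElem?_getD]
    rcases lt_or_ge (i : ℕ) s.toList.length with h | h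
    · rw [List.getElem?_eq_getElem h]; exact Finset.mem_toList.1 (List.getElem_mem _)
    · rw [List.getElem?_eq_none h]; exact hx₀

section Shear

/-- The shear `(x, τ) ↦ (x, τ + Im (δ x))`. -/
def shear (δ : ℂ) : ℂ × ℝ →L[ℝ] ℂ × ℝ :=
  ContinuousLinearMap.id ℝ _ + (ContinuousLinearMap.inr ℝ ℂ ℝ).comp
    (Complex.imCLM.comp (δ • ContinuousLinearMap.fst ℝ ℂ ℝ))

@[simp] theorem shear_apply (δ : ℂ) (p : ℂ × ℝ) : shear δ p = (p.1, p.2 + (δ * p.1).im) := by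
  ext <;> simp [shear]

/-- The dilation `(x, τ) ↦ (x, r τ)`. -/
def vscale (r : ℝ) : ℂ × ℝ →L[ℝ] ℂ × ℝ :=
  (ContinuousLinearMap.fst ℝ ℂ ℝ).prod (r • ContinuousLinearMap.snd ℝ ℂ ℝ)

@[simp] theorem vscale_apply (r : ℝ) (p : ℂ × ℝ) : vscale r p = (p.1, r * p.2) := rfl

theorem exists_shear {u v : ℂ} (h : det2 u v ≠ 0) (a b : ℝ) :
    ∃ δ : ℂ, (δ * u).im = a ∧ (δ * v).im = b := by
  refine ⟨⟨(b * u.re - a * v.re) / det2 u v, (a * v.im - b * u.im) / det2 u v⟩, ?_, ?_⟩ <;>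
  · simp only [Complex.mul_im]
    field_simp
    simp only [det2]
    ring

variable {τ : ConvexBody (ℂ × ℝ) → ℝ} (h : CTVal τ)
  (hs : ∀ δ K, τ (K.mapCLM (shear δ)) = τ K)
  (hd : ∀ q : ℝ, 0 < q → ∀ K, τ (K.mapCLM (vscale (q ^ 2))) = q * τ K)

include hd in
theorem eq_zero_of_vscale (K : ConvexBody (ℂ × ℝ)) (hK : ∀ x ∈ K, x.2 = 0) : τ K = 0 := by
  have h₁ := hd 2 two_pos K
  have : K.mapCLM (vscale (2 ^ 2)) = K := by
    conv_rhs => rw [← mapCLM_id K]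
    refine mapCLM_congr fun x hx => ?_
    ext <;> simp [hK x hx]
  rw [this] at h₁
  linarith

theorem CTVal.hull_image_add {V : Type*} [NormedAddCommGroup V] [NormedSpace ℝ V]
    {φ : ConvexBody V → ℝ} (h : CTVal φ) {S : Set V} (hS : S.Finite) (hn : S.Nonempty) (a : V) :
    φ (hull ((fun x => x + a) '' S)) = φ (hull S) := by
  rw [hull_translate hS hn, h.add_pt]

include h hs hd

theorem eq_zero_of_triangle (p q r : ℂ × ℝ) : τ (hull {p, q, r}) = 0 := by
  have key : ∀ (a b : ℝ) (u v : ℂ), τ (hull {0, (u, a), (v, b)}) = 0 := by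
    intro a b
    refine eq_zero_of_det2 (F := fun u v => τ (hull {0, (u, a), (v, b)})) ?_ ?_
    · exact h.cont.comp (continuous_hull_triple (by fun_prop) (by fun_prop) (by fun_prop))
    · intro u v huv
      obtain ⟨δ, h₁, h₂⟩ := exists_shear huv (-a) (-b)
      rw [← hs δ]
      refine eq_zero_of_vscale hd _ fun x hx => ?_
      rw [mapCLM_hull _ (by simp) (by simp)] at hx
      rw [← mem_coe', coe_hull ((Set.toFinite _).image _) (by simp)] at hx
      have hsub : shear δ '' {0, (u, a), (v, b)} ⊆ {x : ℂ × ℝ | x.2 = 0} := by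
        rintro _ ⟨y, rfl | rfl | rfl, rfl⟩ <;> simp [h₁, h₂]
      have hcv : Convex ℝ {x : ℂ × ℝ | x.2 = 0} :=
        convex_hyperplane (LinearMap.snd ℝ ℂ ℝ).isLinear 0
      exact convexHull_min hsub hcv hx
  have := h.hull_image_add (S := {0, q - p, r - p}) (by simp) (by simp) p
  rw [Set.image_insert_eq, Set.image_pair] at this
  simp only [zero_add, sub_add_cancel] at this
  rw [this]
  exact key _ _ _ _

theorem eq_zero_of_vertical {p p' : ℂ × ℝ} (hp : p.1 = p'.1) (q r : ℂ × ℝ) :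
    τ (hull {p, p', q, r}) = 0 := by
  have flat : ∀ {u v : ℂ}, det2 u v ≠ 0 → ∀ a b t,
      τ (hull {0, (0, t), (u, a), (v, b)}) = τ (hull {0, (0, t), (u, 0), (v, 0)}) := by
    intro u v huv a b t
    obtain ⟨δ, h₁, h₂⟩ := exists_shear huv (-a) (-b)
    rw [← hs δ, mapCLM_hull _ (by simp) (by simp)]
    simp only [Set.image_insert_eq, Set.image_singleton, shear_apply, h₁, h₂, Prod.fst_zero,
      Prod.snd_zero, mul_zero,
      Complex.zero_im, add_zero, add_neg_cancel, Prod.mk_zero_zero]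
  have key : ∀ (t a b : ℝ) (u v : ℂ), τ (hull {0, (0, t), (u, a), (v, b)}) = 0 := by
    intro t a b
    refine eq_zero_of_det2 (F := fun u v => τ (hull {0, (0, t), (u, a), (v, b)})) ?_ ?_
    · have hc := continuous_hull_range (V := ℂ × ℝ) (X := ℂ × ℂ)
        (P := fun x => ![0, (0, t), (x.1, a), (x.2, b)])
        (by
          refine continuous_pi fun i => ?_
          fin_cases i <;> simp only [Fin.reduceFinMk, Matrix.cons_val] <;> fun_prop)
      refine (h.cont.comp hc).congr fun x => ?_
      simp only [Function.comp, Matrix.range_cons, Matrix.range_empty, Set.union_empty,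
        Set.singleton_union]
    · intro u v huv
      rw [flat huv]
      have e : ∀ t, τ (hull {0, (0, 2 * t), (u, 0), (v, 0)})
          = 2 * τ (hull {0, (0, t), (u, 0), (v, 0)}) := by
        intro t
        have h₁ := h.edge_split (a := (0 : ℂ × ℝ)) (b := (0, 2 * t)) (p := (0, t))
          (s := {(u, 0), (v, 0)}) (by simp) (by simp)
          ⟨1 / 2, 1 / 2, by norm_num, by norm_num, by norm_num, by ext <;> simp⟩
        rw [eq_zero_of_triangle h hs hd, add_zero] at h₁
        have h₂ := h.hull_image_add (S := {0, (0, t), (u, -t), (v, -t)}) (by simp) (by simp) (0, t)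
        have h₃ : ((0, t + t) : ℂ × ℝ) = (0, 2 * t) := by rw [two_mul]
        simp only [Set.image_insert_eq, Set.image_singleton, zero_add, Prod.mk_add_mk, add_zero,
          neg_add_cancel, h₃] at h₂
        rw [h₁, h₂, flat huv (-t) (-t) t]
        ring
      have e₂ : τ (hull {0, (0, 2 ^ 2 * t), (u, 0), (v, 0)})
          = 2 * τ (hull {0, (0, t), (u, 0), (v, 0)}) := by
        rw [← hd 2 two_pos, mapCLM_hull _ (by simp) (by simp)]
        simp only [Set.image_insert_eq, Set.image_singleton, vscale_apply, map_zero, mul_zero]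
      have e₃ : (2 : ℝ) ^ 2 * t = 2 * (2 * t) := by ring
      rw [e₃, e, e] at e₂
      linarith
  have := h.hull_image_add (S := {0, p' - p, q - p, r - p}) (by simp) (by simp) p
  simp only [Set.image_insert_eq, Set.image_singleton, zero_add, sub_add_cancel] at this
  rw [this]
  have e : p' - p = (0, (p' - p).2) := by ext <;> simp [hp]
  rw [e]
  exact key _ _ _ _ _

theorem eq_zero_of_lists (n : ℕ) : ∀ I J R : List (ℂ × ℝ), I.length + J.length ≤ n →
    I.length + J.length + R.length ≤ 4 → ∀ p p' : ℂ × ℝ, p.1 = p'.1 →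
    p ∈ convexHull ℝ {x | x ∈ I} → p' ∈ convexHull ℝ {x | x ∈ J} →
    τ (hull {x | x ∈ I ∨ x ∈ J ∨ x ∈ R}) = 0 := by
  induction n with
  | zero =>
    intro I J R hn _ p p' _ hp _
    have : I = [] := List.length_eq_zero_iff.1 (by omega)
    simp [this] at hp
  | succ n ih =>
    have step : ∀ (a b : ℂ × ℝ) (I J R : List (ℂ × ℝ)), I.length + 2 + J.length ≤ n + 1 →
        I.length + 2 + J.length + R.length ≤ 4 → ∀ p p' : ℂ × ℝ, p.1 = p'.1 →
        p ∈ convexHull ℝ {x | x ∈ a :: b :: I} → p' ∈ convexHull ℝ {x | x ∈ J} →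
        τ (hull {x | x ∈ a :: b :: I ∨ x ∈ J ∨ x ∈ R}) = 0 := by
      intro a b I J R hn h4 p p' hpp hp hp'
      obtain ⟨q, hq, hpq⟩ := exists_mem_segment_of_mem_convexHull (a := a) (b := b) (p := p)
        (s := {x | x ∈ I}) (by convert hp using 2; ext; simp)
      have hpq' : p ∈ convexHull ℝ {x | x ∈ q :: I} := by convert hpq using 2; ext; simp
      have hJ : {x | x ∈ J}.Nonempty := convexHull_nonempty_iff.1 ⟨p', hp'⟩
      have split := h.edge_split (s := {x | x ∈ I ∨ x ∈ J ∨ x ∈ R})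
        ((List.finite_toSet (I ++ (J ++ R))).subset (by intro x; simp))
        (hJ.mono fun x hx => Or.inr (Or.inl hx)) hq
      have e₁ := ih (q :: I) J [] (by simp; omega) (by simp; omega) p p' hpp hpq' hp'
      have e₂ := ih (q :: I) J (a :: R) (by simp; omega) (by simp; omega) p p' hpp hpq' hp'
      have e₃ := ih (q :: I) J (b :: R) (by simp; omega) (by simp; omega) p p' hpp hpq' hp'
      have e₄ := ih (q :: I) J R (by simp; omega) (by simp; omega) p p' hpp hpq' hp'
      have s₁ : {x | x ∈ a :: b :: I ∨ x ∈ J ∨ x ∈ R}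
          = insert a (insert b {x | x ∈ I ∨ x ∈ J ∨ x ∈ R}) := by ext; simp; tauto
      have s₂ : {x | x ∈ q :: I ∨ x ∈ J ∨ x ∈ a :: R}
          = insert a (insert q {x | x ∈ I ∨ x ∈ J ∨ x ∈ R}) := by ext; simp; tauto
      have s₃ : {x | x ∈ q :: I ∨ x ∈ J ∨ x ∈ b :: R}
          = insert q (insert b {x | x ∈ I ∨ x ∈ J ∨ x ∈ R}) := by ext; simp; tauto
      have s₄ : {x | x ∈ q :: I ∨ x ∈ J ∨ x ∈ R}
          = insert q {x | x ∈ I ∨ x ∈ J ∨ x ∈ R} := by ext; simp; tauto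
      rw [s₂] at e₂
      rw [s₃] at e₃
      rw [s₄] at e₄
      rw [s₁]
      linarith
    intro I J R hn h4 p p' hpp hp hp'
    match I, J with
    | [], _ => simp at hp
    | _, [] => simp at hp'
    | a :: b :: I, J =>
      exact step a b I J R (by simpa using hn) (by simpa using h4) p p' hpp hp hp'
    | I, a :: b :: J =>
      have := step a b J I R (by simp at hn; omega) (by simp at h4; omega) p' p hpp.symm hp' hp
      convert this using 3
      ext; simp only [Set.mem_ofPred_eq]; tauto
    | [a], [b] =>
      simp only [List.mem_singleton, Set.ofPred_eq_eq_singleton, convexHull_singleton,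
        Set.mem_singleton_iff] at hp hp'
      subst hp hp'
      match R with
      | [] =>
        convert eq_zero_of_vertical h hs hd hpp p p using 3
        ext; simp; tauto
      | [c] =>
        convert eq_zero_of_vertical h hs hd hpp p c using 3
        ext; simp; tauto
      | [c, d] =>
        convert eq_zero_of_vertical h hs hd hpp c d using 3
        ext; simp
      | _ :: _ :: _ :: _ => simp at h4; omega

/-- A valuation on `𝒦(ℂ × ℝ)` that is invariant under shears and scales like the square root of
the factor under vertical dilations vanishes. -/
theorem eq_zero_of_shear (K : ConvexBody (ℂ × ℝ)) : τ K = 0 := by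
  classical
  refine h.eq_zero_of_simplices (fun s hne hcard => ?_) K
  have hfr : finrank ℝ (ℂ × ℝ) = 3 := by simp [Complex.finrank_real_complex]
  rw [hfr] at hcard
  obtain ⟨P, hP⟩ := exists_eq_range hne hcard
  have hna : ¬ AffineIndependent ℝ fun i => (P i).1 := fun hai => by
    have := hai.card_le_finrank_succ
    have h₂ := Submodule.finrank_le (vectorSpan ℝ (Set.range fun i => (P i).1))
    rw [Complex.finrank_real_complex] at h₂
    rw [Fintype.card_fin] at this
    exact absurd (this.trans (Nat.succ_le_succ h₂)) (by norm_num)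
  obtain ⟨I, z, hz₁, hz₂⟩ := Convex.radon_partition hna
  have hl : ∀ I : Set (Fin 4), z ∈ convexHull ℝ ((fun i => (P i).1) '' I) →
      ∃ p : ℂ × ℝ, p.1 = z ∧ p ∈ convexHull ℝ
        {x | x ∈ ((Finset.univ.filter (· ∈ I)).toList.map P)} := by
    intro I hz
    have e : {x | x ∈ ((Finset.univ.filter (· ∈ I)).toList.map P)} = P '' I := by
      ext x; simp
    have e₂ : (fun i => (P i).1) '' I = LinearMap.fst ℝ ℂ ℝ '' (P '' I) := by
      rw [Set.image_image]; rfl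
    rw [e₂, ← LinearMap.image_convexHull] at hz
    obtain ⟨p, hp, rfl⟩ := hz
    exact ⟨p, rfl, by rwa [e]⟩
  obtain ⟨p, hp₁, hp⟩ := hl _ hz₁
  obtain ⟨p', hp₁', hp'⟩ := hl _ hz₂
  have hcI : (Finset.univ.filter (· ∈ I)).card + (Finset.univ.filter (· ∈ Iᶜ)).card = 4 := by
    simpa using Finset.card_filter_add_card_filter_not (s := (Finset.univ : Finset (Fin 4)))
      (p := (· ∈ I))
  have := eq_zero_of_lists h hs hd 4 _ _ [] (by simpa using hcI.le) (by simpa using hcI.le)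
    p p' (hp₁.trans hp₁'.symm) hp hp'
  rw [hP]
  convert this using 3
  ext x
  simp only [Set.mem_range, List.mem_map, Finset.mem_toList, Finset.mem_filter, Finset.mem_univ,
    true_and, Set.mem_compl_iff, List.not_mem_nil, or_false, Set.mem_ofPred_eq]
  constructor
  · rintro ⟨i, rfl⟩
    by_cases hi : i ∈ I
    · exact Or.inl ⟨i, hi, rfl⟩
    · exact Or.inr ⟨i, hi, rfl⟩
  · rintro (⟨i, -, rfl⟩ | ⟨i, -, rfl⟩) <;> exact ⟨i, rfl⟩

end Shear

/-- The function `f(K, w) = h(Φ (Z K), w)` attached to a covariant Minkowski valuation `Z` on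
`ℂ × ℂ`. -/
structure CovFun (f : ConvexBody (ℂ × ℂ) → ℂ × ℂ → ℝ) : Prop where
  val : ∀ w, CTVal fun K => f K w
  add_le : ∀ K w w', f K (w + w') ≤ f K w + f K w'
  smul : ∀ K w (t : ℝ), 0 ≤ t → f K (t • w) = t * f K w
  cov : ∀ a b c d : ℂ, a * d - b * c = 1 → ∀ K w,
    f (K.mapCLM (mat a b c d)) (mat a b c d w) = f K w

theorem le_of_forall_pos {F G : ℝ → ℝ} (hF : Continuous F) (hG : Continuous G)
    (h : ∀ t, 0 < t → F t ≤ G t) : F 0 ≤ G 0 := by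
  have h₁ := fun {F : ℝ → ℝ} (hF : Continuous F) =>
    (hF.tendsto 0).mono_left (nhdsWithin_le_nhds (s := Set.Ioi 0))
  refine le_of_tendsto_of_tendsto (h₁ hF) (h₁ hG) ?_
  filter_upwards [self_mem_nhdsWithin] with t ht using h t ht

/-- One-sided Lipschitz bounds along the lower triangular unipotent matrices. -/
def LowLip (χ : ConvexBody (ℂ × ℂ) → ℝ) : Prop :=
  ∀ δ : ℂ, ∃ B : ConvexBody (ℂ × ℂ) → ℝ, Continuous B ∧
    ∀ K (r : ℝ), 0 ≤ r → |χ (K.mapCLM (mat 1 0 (r * δ) 1)) - χ K| ≤ r * B K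

namespace LowLip

variable {χ χ' : ConvexBody (ℂ × ℂ) → ℝ}

theorem add (h : LowLip χ) (h' : LowLip χ') : LowLip fun K => χ K + χ' K := fun δ => by
  obtain ⟨B, hB, hB'⟩ := h δ
  obtain ⟨C, hC, hC'⟩ := h' δ
  refine ⟨fun K => B K + C K, hB.add hC, fun K r hr => ?_⟩
  rw [add_sub_add_comm, mul_add]
  exact (abs_add_le _ _).trans (add_le_add (hB' K r hr) (hC' K r hr))

theorem const_mul (h : LowLip χ) (c : ℝ) : LowLip fun K => c * χ K := fun δ => by
  obtain ⟨B, hB, hB'⟩ := h δ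
  refine ⟨fun K => |c| * B K, hB.const_mul _, fun K r hr => ?_⟩
  rw [← mul_sub, abs_mul, mul_left_comm]
  exact mul_le_mul_of_nonneg_left (hB' K r hr) (abs_nonneg c)

theorem smul (h : LowLip χ) (s : ℝ) : LowLip fun K => χ (s • K) := fun δ => by
  obtain ⟨B, hB, hB'⟩ := h δ
  refine ⟨fun K => B (s • K), hB.comp (continuous_const_smul s), fun K r hr => ?_⟩
  simp only [← mapCLM_smul]
  exact hB' _ r hr

theorem homComp_two (h : LowLip χ) : LowLip (homComp χ 2) := by
  convert ((((h.smul 0).const_mul (35 / 24)).add ((h.smul 1).const_mul (-(13 / 3)))).add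
    ((h.smul 2).const_mul (19 / 4))).add (((h.smul 3).const_mul (-(7 / 3))).add
      ((h.smul 4).const_mul (11 / 24))) using 2 with K
  simp only [homComp, interpCoeff, Nat.cast_zero, Nat.cast_one, Nat.cast_ofNat]
  ring

theorem segDiff (h : LowLip χ) : LowLip (segDiff χ (0, 1)) := fun δ => by
  obtain ⟨B, hB, hB'⟩ := h δ
  refine ⟨fun K => B (K + seg (0, 1)) + B K,
    (hB.comp (continuous_add_const (seg (0, 1)))).add hB, fun K r hr => ?_⟩
  have e : (K + seg (0, 1)).mapCLM (mat 1 0 (r * δ) 1)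
      = K.mapCLM (mat 1 0 (r * δ) 1) + seg (0, 1) := by
    rw [mapCLM_add, mapCLM_seg]
    simp
  rw [_root_.segDiff, _root_.segDiff, ← e, sub_sub_sub_comm, mul_add]
  exact (abs_sub _ _).trans (add_le_add (hB' _ r hr) (hB' _ r hr))

end LowLip

section DegreeTwo

variable {χ : ConvexBody (ℂ × ℂ) → ℝ}

theorem DiagCov.segDiff_left (hc : DiagCov χ) (h : CTVal χ) (hh : HomDeg χ 2) (a : ℂ)
    (K : ConvexBody (ℂ × ℂ)) : segDiff χ (a, 0) K = 0 := by
  have h₁ : ∀ s : ℝ, 0 < s →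
      s * segDiff χ (a, 0) (K.mapCLM (mat (s ^ 2 : ℝ) 0 0 1)) - segDiff χ (a, 0) K = 0 := by
    intro s hs
    have e : seg ((s ^ 2 : ℝ) • ((a, 0) : ℂ × ℂ))
        = (seg (a, 0)).mapCLM (mat (s ^ 2 : ℝ) 0 0 1) := by
      rw [mapCLM_seg]
      simp
    have h₂ := h.segDiff_smul (a, 0) (sq_nonneg s) (K.mapCLM (mat (s ^ 2 : ℝ) 0 0 1))
    have h₃ := hc.scale_left hh hs K
    have h₄ := hc.scale_left hh hs (K + seg (a, 0))
    rw [segDiff, e, ← mapCLM_add] at h₂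
    apply mul_left_cancel₀ (pow_ne_zero 2 hs.ne')
    rw [mul_zero, mul_sub, mul_left_comm, ← h₂, mul_sub, h₃, h₄, segDiff]
    ring
  have hc' : Continuous fun s : ℝ =>
      s * segDiff χ (a, 0) (K.mapCLM (mat (s ^ 2 : ℝ) 0 0 1)) - segDiff χ (a, 0) K := by
    refine (continuous_id.mul (continuous_segDiff h.cont continuous_const ?_)).sub continuous_const
    exact continuous_mapCLM (continuous_mat (by fun_prop) (by fun_prop) (by fun_prop)
      (by fun_prop)) continuous_const
  have := eq_zero_of_forall_pos hc' h₁
  simpa using this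

theorem DiagCov.segDiff_scale_right (hc : DiagCov χ) (h : CTVal χ) (hh : HomDeg χ 2) {s : ℝ}
    (hs : 0 < s) (K : ConvexBody (ℂ × ℂ)) :
    segDiff χ (0, 1) (K.mapCLM (mat 1 0 0 (s ^ 2 : ℝ))) = s * segDiff χ (0, 1) K := by
  have e : seg ((s ^ 2 : ℝ) • ((0, 1) : ℂ × ℂ)) = (seg (0, 1)).mapCLM (mat 1 0 0 (s ^ 2 : ℝ)) := by
    rw [mapCLM_seg]
    simp
  have h₂ := h.segDiff_smul (0, 1) (sq_nonneg s) (K.mapCLM (mat 1 0 0 (s ^ 2 : ℝ)))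
  have h₃ := hc.scale_right hh hs K
  have h₄ := hc.scale_right hh hs (K + seg (0, 1))
  rw [segDiff, e, ← mapCLM_add, h₃, h₄] at h₂
  apply mul_left_cancel₀ (pow_ne_zero 2 hs.ne')
  rw [← h₂, segDiff]
  ring

theorem LowLip.invariant {T : ConvexBody (ℂ × ℂ) → ℝ} (hl : LowLip T)
    (ht : ∀ s : ℝ, 0 < s → ∀ K, T (K.mapCLM (mat 1 0 0 (s ^ 2 : ℝ))) = s * T K) (δ : ℂ)
    (K : ConvexBody (ℂ × ℂ)) : T (K.mapCLM (mat 1 0 δ 1)) = T K := by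
  obtain ⟨B, hB, hB'⟩ := hl δ
  have h₁ : ∀ q : ℝ, 0 < q → |T (K.mapCLM (mat 1 0 δ 1)) - T K|
      ≤ q * B (K.mapCLM (mat 1 0 0 (q ^ 2 : ℝ))) := by
    intro q hq
    have h₂ := hB' (K.mapCLM (mat 1 0 0 (q ^ 2 : ℝ))) (q ^ 2) (sq_nonneg q)
    have e : (K.mapCLM (mat 1 0 0 (q ^ 2 : ℝ))).mapCLM (mat 1 0 ((q ^ 2 : ℝ) * δ) 1)
        = (K.mapCLM (mat 1 0 δ 1)).mapCLM (mat 1 0 0 (q ^ 2 : ℝ)) := by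
      simp [mapCLM_mapCLM, mat_comp]
    rw [e, ht q hq, ht q hq, ← mul_sub, abs_mul, abs_of_pos hq, pow_two q, mul_assoc,
      ← pow_two q] at h₂
    exact le_of_mul_le_mul_left h₂ hq
  have h₂ := le_of_forall_pos continuous_const (G := fun q : ℝ =>
    q * B (K.mapCLM (mat 1 0 0 (q ^ 2 : ℝ)))) ?_ h₁
  · rw [zero_mul] at h₂
    exact sub_eq_zero.1 (abs_nonpos_iff.1 h₂)
  · exact continuous_id.mul (hB.comp (continuous_mapCLM (continuous_mat (by fun_prop)
      (by fun_prop) (by fun_prop) (by fun_prop)) continuous_const))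

/-- The inclusion of `ℂ × iℝ` in `ℂ × ℂ`. -/
def incl3 : ℂ × ℝ →L[ℝ] ℂ × ℂ :=
  (ContinuousLinearMap.fst ℝ ℂ ℝ).prod ((ContinuousLinearMap.snd ℝ ℂ ℝ).smulRight Complex.I)

@[simp] theorem incl3_apply (p : ℂ × ℝ) : incl3 p = (p.1, p.2 * Complex.I) := by simp [incl3]

/-- The projection from `ℂ × ℂ` to `ℂ × ℝ`. -/
def proj3 : ℂ × ℂ →L[ℝ] ℂ × ℝ :=
  (ContinuousLinearMap.fst ℝ ℂ ℂ).prod (Complex.imCLM.comp (ContinuousLinearMap.snd ℝ ℂ ℂ))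

@[simp] theorem proj3_apply (p : ℂ × ℂ) : proj3 p = (p.1, p.2.im) := rfl

theorem DiagCov.segDiff_right (hc : DiagCov χ) (h : CTVal χ) (hh : HomDeg χ 2) (hl : LowLip χ)
    (K : ConvexBody (ℂ × ℂ)) : segDiff χ (0, 1) K = 0 := by
  have ht : ∀ s : ℝ, 0 < s → ∀ K, segDiff χ (0, 1) (K.mapCLM (mat 1 0 0 (s ^ 2 : ℝ)))
    = s * segDiff χ (0, 1) K := fun s hs K => hc.segDiff_scale_right h hh hs K
  have hinv := hl.segDiff.invariant ht
  have hproj : ∀ K, segDiff χ (0, 1) ((K.mapCLM proj3).mapCLM incl3) = segDiff χ (0, 1) K := by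
    intro K
    rw [← h.segDiff_proj (l := Complex.reCLM.comp (ContinuousLinearMap.snd ℝ ℂ ℂ)) (u := (0, 1))
      (by simp) K, mapCLM_mapCLM]
    congr 1
    refine mapCLM_congr fun x _ => ?_
    refine Prod.ext ?_ (Complex.ext ?_ ?_) <;> simp
  have := eq_zero_of_shear (τ := fun K => segDiff χ (0, 1) (K.mapCLM incl3))
    ((h.segDiff _).comp_map incl3) ?_ ?_ (K.mapCLM proj3)
  · rwa [hproj] at this
  · intro δ K
    show segDiff χ (0, 1) ((K.mapCLM (shear δ)).mapCLM incl3) = segDiff χ (0, 1) (K.mapCLM incl3)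
    rw [← hinv δ (K.mapCLM incl3), ← hproj ((K.mapCLM incl3).mapCLM _)]
    simp only [mapCLM_mapCLM]
    congr 1
    refine mapCLM_congr fun x _ => ?_
    ext <;> simp [add_comm]
  · intro q hq K
    show segDiff χ (0, 1) ((K.mapCLM (vscale (q ^ 2))).mapCLM incl3)
      = q * segDiff χ (0, 1) (K.mapCLM incl3)
    rw [← ht q hq]
    simp only [mapCLM_mapCLM]
    congr 1
    refine mapCLM_congr fun x _ => ?_
    refine Prod.ext ?_ (Complex.ext ?_ ?_) <;> simp

end DegreeTwo

namespace CovFun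

variable {f : ConvexBody (ℂ × ℂ) → ℂ × ℂ → ℝ}

theorem twist (hf : CovFun f) (d : ℂ) : CovFun fun K w => f K (d • w) where
  val w := hf.val _
  add_le K w w' := by rw [smul_add]; exact hf.add_le _ _ _
  smul K w t ht := by rw [smul_comm, hf.smul _ _ _ ht]
  cov a b c e h K w := by
    rw [show d • mat a b c e w = mat a b c e (d • w) by
      ext <;> simp <;> ring]
    exact hf.cov a b c e h K _

theorem apply_zero (hf : CovFun f) (K) : f K 0 = 0 := by
  have := hf.smul K 0 0 le_rfl
  simpa using this

theorem diagCov (hf : CovFun f) : DiagCov fun K => f K (1, 0) := by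
  intro t ht K
  have hne : (t : ℂ) ≠ 0 := by exact_mod_cast ht.ne'
  have := hf.cov (t⁻¹ : ℝ) 0 0 t (by push_cast; simp [hne]) K (t • ((1, 0) : ℂ × ℂ))
  rw [hf.smul _ _ _ ht.le] at this
  rw [← this]
  simp [hne]

theorem lower (hf : CovFun f) (δ : ℂ) (K) : f (K.mapCLM (mat 1 0 δ 1)) (1, 0) = f K (1, -δ) := by
  have := hf.cov 1 0 δ 1 (by simp) K (1, -δ)
  simpa using this

theorem lowLip (hf : CovFun f) : LowLip fun K => f K (1, 0) := by
  intro δ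
  refine ⟨fun K => |f K (0, δ)| + |f K (0, -δ)|, ((hf.val _).cont.abs).add ((hf.val _).cont.abs),
    fun K r hr => ?_⟩
  show |f (K.mapCLM (mat 1 0 (r * δ) 1)) (1, 0) - f K (1, 0)| ≤ _
  rw [hf.lower]
  have h₁ := hf.add_le K (1, 0) (r • (0, -δ))
  have h₂ := hf.add_le K (1, -(r * δ)) (r • (0, δ))
  rw [hf.smul _ _ _ hr] at h₁ h₂
  have e₁ : ((1, 0) + r • (0, -δ) : ℂ × ℂ) = (1, -(r * δ)) := by simp
  have e₂ : ((1, -(r * δ)) + r • (0, δ) : ℂ × ℂ) = (1, 0) := by simp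
  rw [e₁] at h₁
  rw [e₂] at h₂
  have k₁ := mul_le_mul_of_nonneg_left (le_abs_self (f K (0, δ))) hr
  have k₂ := mul_le_mul_of_nonneg_left (le_abs_self (f K (0, -δ))) hr
  have k₃ := mul_nonneg hr (abs_nonneg (f K (0, δ)))
  have k₄ := mul_nonneg hr (abs_nonneg (f K (0, -δ)))
  rw [abs_le]
  constructor <;> linarith

theorem homComp_val (hf : CovFun f) (i : ℕ) (w) : CTVal (homComp (fun K => f K w) i) :=
  (hf.val w).homComp i

theorem homComp_homDeg (hf : CovFun f) (i : ℕ) (w) : HomDeg (homComp (fun K => f K w) i) i :=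
  CTVal.homComp_homDeg finrank_plane.le (hf.val w) i

theorem homComp_zero (hf : CovFun f) (K) : homComp (fun K => f K (1, 0)) 0 K = 0 := by
  have h₁ : ∀ K, homComp (fun K => f K (1, 0)) 0 K = homComp (fun K => f K (1, 0)) 0 0 := by
    intro K
    have := hf.homComp_homDeg 0 (1, 0) K 0 le_rfl
    rw [zero_smul', pow_zero, one_mul] at this
    exact this.symm
  have := hf.diagCov.homComp 0 2 two_pos K
  rw [h₁ (mapCLM _ K), h₁ K] at this
  rw [h₁ K]
  linarith

theorem homComp_four (hf : CovFun f) (K) : homComp (fun K => f K (1, 0)) 4 K = 0 :=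
  (hf.diagCov.homComp 4).eq_zero_of_prod (hf.homComp_val 4 _) (hf.homComp_homDeg 4 _) (Or.inl rfl) K

theorem segDiff_homComp_two (hf : CovFun f) (u) (K) :
    segDiff (homComp (fun K => f K (1, 0)) 2) u K = 0 := by
  obtain ⟨c, d⟩ := u
  by_cases hd : d = 0
  · subst hd
    exact (hf.diagCov.homComp 2).segDiff_left (hf.homComp_val 2 _) (hf.homComp_homDeg 2 _) c K
  · have hf' := hf.twist d
    have h₁ := (hf'.diagCov.homComp 2).segDiff_right (hf'.homComp_val 2 _)
      (hf'.homComp_homDeg 2 _) hf'.lowLip.homComp_two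
    have h₂ : ∀ K, homComp (fun K => f K (1, 0)) 2 (K.mapCLM (mat d⁻¹ c 0 d))
        = 1 * homComp (fun K => f K (d • (1, 0))) 2 K := by
      refine homComp_mapCLM (fun K => ?_) 2
      have := hf.cov d⁻¹ c 0 d (by simp [hd]) K (d • (1, 0))
      rw [one_mul, ← this]
      simp [hd]
    have h₃ : K = (K.mapCLM (mat d (-c) 0 d⁻¹)).mapCLM (mat d⁻¹ c 0 d) := by
      rw [mapCLM_mapCLM, mat_comp]
      conv_lhs => rw [← mapCLM_id K, ← mat_one]
      congr 2 <;> field_simp <;> ring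
    have h₄ : seg ((c, d) : ℂ × ℂ) = (seg ((0, 1) : ℂ × ℂ)).mapCLM (mat d⁻¹ c 0 d) := by
      rw [mapCLM_seg]; simp
    rw [h₃, segDiff, h₄, ← mapCLM_add, h₂, h₂, one_mul, one_mul]
    exact h₁ _

theorem homComp_two (hf : CovFun f) (K) : homComp (fun K => f K (1, 0)) 2 K = 0 :=
  (absorbing_of_segDiff hf.segDiff_homComp_two).eq_zero finrank_plane.le (hf.homComp_val 2 _)
    le_rfl (hf.homComp_homDeg 2 _) K

/-- Only the components of degrees `1` and `3` survive. -/
theorem eq_add (hf : CovFun f) (K) : f K (1, 0)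
    = homComp (fun K => f K (1, 0)) 1 K + homComp (fun K => f K (1, 0)) 3 K := by
  have := CTVal.sum_homComp finrank_plane.le (hf.val (1, 0)) K
  rw [hf.homComp_zero, hf.homComp_two, hf.homComp_four] at this
  rw [this]
  ring

/-- The component of degree `1` only depends on the second projection. -/
theorem homComp_one_proj (hf : CovFun f) (K : ConvexBody (ℂ × ℂ)) :
    homComp (fun K => f K (1, 0)) 1 K
      = homComp (fun K => f K (1, 0)) 1 ((K.mapCLM (ContinuousLinearMap.snd ℝ ℂ ℂ)).mapCLM inr2) := by
  have h₁ : ∀ s : ℝ, 0 < s → homComp (fun K => f K (1, 0)) 1 (K.mapCLM (mat (s ^ 2 : ℝ) 0 0 1))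
      - homComp (fun K => f K (1, 0)) 1 K = 0 := by
    intro s hs
    have := (hf.diagCov.homComp 1).scale_left (hf.homComp_homDeg 1 _) hs K
    rw [pow_one] at this
    rw [mul_left_cancel₀ hs.ne' this, sub_self]
  have h₂ := eq_zero_of_forall_pos (F := fun s : ℝ => homComp (fun K => f K (1, 0)) 1
    (K.mapCLM (mat (s ^ 2 : ℝ) 0 0 1)) - homComp (fun K => f K (1, 0)) 1 K) ?_ h₁
  · rw [← sub_eq_zero.1 h₂, mapCLM_mapCLM]
    congr 1
    refine mapCLM_congr fun x _ => ?_
    ext <;> simp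
  · exact ((hf.homComp_val 1 _).cont.comp (continuous_mapCLM (continuous_mat (by fun_prop)
      (by fun_prop) (by fun_prop) (by fun_prop)) continuous_const)).sub continuous_const

end CovFun

section Volume

variable {V : Type*} [NormedAddCommGroup V] [NormedSpace ℝ V]

theorem ConvexBody.eventually_mem_of_mem_interior {K : ConvexBody V} {x : V}
    (hx : x ∈ interior (K : Set V)) : ∀ᶠ L in nhds K, x ∈ L := by
  obtain ⟨r, hr, hrK⟩ := Metric.isOpen_iff.1 isOpen_interior x hx
  filter_upwards [Metric.ball_mem_nhds K (half_pos hr)] with L hL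
  by_contra hxL
  obtain ⟨f, u, hfx, hfL⟩ := geometric_hahn_banach_point_closed L.convex L.isClosed hxL
  obtain ⟨z₀, hz₀⟩ := L.nonempty
  have hf : 0 < ‖f‖ := by
    rw [norm_pos_iff]
    rintro rfl
    have := hfL z₀ hz₀
    simp only [zero_apply] at this hfx
    linarith
  obtain ⟨v, hv, hfv⟩ : ∃ v : V, ‖v‖ < 1 ∧ ‖f‖ / 2 < -f v := by
    obtain ⟨v, hv, hfv⟩ := f.exists_lt_apply_of_lt_opNorm (half_lt_self hf)
    rw [Real.norm_eq_abs] at hfv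
    rcases abs_choice (f v) with h | h <;> rw [h] at hfv
    · exact ⟨-v, by simpa using hv, by simpa using hfv⟩
    · exact ⟨v, hv, hfv⟩
  have hy : x + r • v ∈ K := interior_subset (hrK (by
    rw [Metric.mem_ball, dist_eq_norm, add_sub_cancel_left, norm_smul, Real.norm_eq_abs,
      abs_of_pos hr]
    nlinarith))
  obtain ⟨z, hz, hd⟩ := exists_dist_le (K := K) (L := L) hy
  rw [Metric.mem_ball, dist_comm] at hL
  have h₁ := hfL z hz
  have h₂ := f.le_opNorm (z - (x + r • v))
  rw [← dist_eq_norm, dist_comm, Real.norm_eq_abs] at h₂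
  have h₃ := (le_abs_self _).trans h₂
  simp only [map_sub, map_add, map_smul, smul_eq_mul] at h₃
  have h₄ := mul_le_mul_of_nonneg_left (hd.trans hL.le) hf.le
  nlinarith

variable [MeasurableSpace V] [BorelSpace V]

/-- The volume of a convex body. -/
def vol (μ : Measure V) (K : ConvexBody V) : ℝ := (μ (K : Set V)).toReal

variable [FiniteDimensional ℝ V] (μ : Measure V) [μ.IsAddHaarMeasure]

theorem continuous_vol : Continuous (vol μ) := by
  rw [continuous_iff_continuousAt]
  intro K
  refine (ENNReal.tendsto_toReal K.isCompact.measure_lt_top.ne).comp ?_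
  refine tendsto_measure_of_ae_tendsto_indicator (nhds K) K.isClosed.measurableSet
    (fun L => L.isClosed.measurableSet) (B := Metric.cthickening 1 (K : Set V))
    Metric.isClosed_cthickening.measurableSet (K.isCompact.cthickening).measure_lt_top.ne ?_ ?_
  · filter_upwards [Metric.ball_mem_nhds K one_pos] with L hL x hx
    obtain ⟨z, hz, hd⟩ := exists_dist_le (K := L) (L := K) hx
    exact Metric.mem_cthickening_of_dist_le _ z _ _ hz (hd.trans (Metric.mem_ball.1 hL).le)
  · have h₀ : μ (frontier (K : Set V)) = 0 := K.convex.addHaar_frontier μ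
    filter_upwards [measure_eq_zero_iff_ae_notMem.1 h₀] with x hx
    by_cases hxK : x ∈ (K : Set V)
    · have hxi : x ∈ interior (K : Set V) := by
        by_contra hxi
        exact hx ⟨subset_closure hxK, hxi⟩
      filter_upwards [eventually_mem_of_mem_interior hxi] with L hL
      exact iff_of_true hL hxK
    · obtain ⟨r, hr, hrK⟩ := Metric.isOpen_iff.1 K.isClosed.isOpen_compl x hxK
      filter_upwards [Metric.ball_mem_nhds K hr] with L hL
      refine iff_of_false (fun hxL => ?_) hxK
      obtain ⟨z, hz, hd⟩ := exists_dist_le (K := L) (L := K) hxL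
      refine hrK (Metric.mem_ball.2 ?_) hz
      rw [dist_comm]
      exact hd.trans_lt (Metric.mem_ball.1 hL)

theorem vol_ctval : CTVal (vol μ) where
  cont := continuous_vol μ
  transl K x := by
    have : (K.translate x : Set V) = x +ᵥ (K : Set V) := rfl
    rw [vol, this, measure_vadd]
    rfl
  val K L hU hI := by
    have h := measure_union_add_inter (μ := μ) (K : Set V) L.isClosed.measurableSet
    have hu : μ ((K : Set V) ∪ L) ≠ ⊤ := (K.isCompact.union L.isCompact).measure_lt_top.ne
    have hi : μ ((K : Set V) ∩ L) ≠ ⊤ :=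
      (K.isCompact.inter_right L.isClosed).measure_lt_top.ne
    have := congrArg ENNReal.toReal h
    rwa [ENNReal.toReal_add hu hi, ENNReal.toReal_add K.isCompact.measure_lt_top.ne
      L.isCompact.measure_lt_top.ne] at this

theorem vol_homDeg : HomDeg (vol μ) (finrank ℝ V) := by
  intro K t ht
  rw [vol, coe_smul, Measure.addHaar_smul, ENNReal.toReal_mul,
    ENNReal.toReal_ofReal (abs_nonneg _), abs_of_nonneg (by positivity)]
  rfl

end Volume

theorem vol_mono {V : Type*} [NormedAddCommGroup V] [NormedSpace ℝ V] [MeasurableSpace V]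
    (μ : Measure V) [IsFiniteMeasureOnCompacts μ] {K L : ConvexBody V} (h : (K : Set V) ⊆ L) :
    vol μ K ≤ vol μ L :=
  ENNReal.toReal_mono L.isCompact.measure_lt_top.ne (measure_mono h)

section Polynomial

variable {V : Type*} [NormedAddCommGroup V] [NormedSpace ℝ V] [FiniteDimensional ℝ V]
  {φ : ConvexBody V → ℝ}

/-- The expansion of `s ↦ φ (K + s L)` at infinity. -/
theorem CTVal.eval_add_smul (hd : finrank ℝ V ≤ 4) (h : CTVal φ) {d : ℕ} (hh : HomDeg φ d)
    (K L : ConvexBody V) {s : ℝ} (hs : 0 < s) :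
    s ^ 4 * φ (K + s • L) = s ^ d * (s ^ 4 * _root_.homComp (fun K => φ (K + L)) 0 K
      + s ^ 3 * _root_.homComp (fun K => φ (K + L)) 1 K
      + s ^ 2 * _root_.homComp (fun K => φ (K + L)) 2 K
      + s * _root_.homComp (fun K => φ (K + L)) 3 K
      + _root_.homComp (fun K => φ (K + L)) 4 K) := by
  have h₁ := (h.comp_add L).sum_homComp hd (s⁻¹ • K)
  have h₂ := hh (s⁻¹ • K + L) s hs.le
  rw [smul_add, smul_smul, mul_inv_cancel₀ hs.ne', one_smul'] at h₂
  simp only [(h.comp_add L).homComp_homDeg hd _ K s⁻¹ (inv_nonneg.2 hs.le)] at h₁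
  rw [h₂, h₁]
  field_simp

theorem CTVal.homComp_add_top (hd : finrank ℝ V ≤ 4) (h : CTVal φ) (hh : HomDeg φ 4)
    (K L : ConvexBody V) : _root_.homComp (fun K => φ (K + L)) 4 K = φ K := by
  have hc : Continuous fun s : ℝ => φ (K + s • L) :=
    h.cont.comp (continuous_const.add (continuous_id.smul continuous_const))
  have := eq_zero_of_forall_pos (F := fun s : ℝ => φ (K + s • L)
    - (s ^ 4 * _root_.homComp (fun K => φ (K + L)) 0 K
      + s ^ 3 * _root_.homComp (fun K => φ (K + L)) 1 K
      + s ^ 2 * _root_.homComp (fun K => φ (K + L)) 2 K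
      + s * _root_.homComp (fun K => φ (K + L)) 3 K
      + _root_.homComp (fun K => φ (K + L)) 4 K)) (hc.sub (by fun_prop)) (fun s hs => by
        rw [sub_eq_zero]
        exact mul_left_cancel₀ (pow_ne_zero 4 hs.ne') (h.eval_add_smul hd hh K L hs))
  simp only [zero_smul', add_zero] at this
  linarith

theorem CTVal.homComp_add_of_two (hd : finrank ℝ V ≤ 4) (h : CTVal φ) (hh : HomDeg φ 2)
    (K L : ConvexBody V) : _root_.homComp (fun K => φ (K + L)) 2 K = φ K ∧
      _root_.homComp (fun K => φ (K + L)) 3 K = 0 ∧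
      _root_.homComp (fun K => φ (K + L)) 4 K = 0 := by
  have hc : Continuous fun s : ℝ => φ (K + s • L) :=
    h.cont.comp (continuous_const.add (continuous_id.smul continuous_const))
  have h₁ := fun s hs => h.eval_add_smul hd hh K L (s := s) hs
  generalize _root_.homComp (fun K => φ (K + L)) 0 K = c₀ at *
  generalize _root_.homComp (fun K => φ (K + L)) 1 K = c₁ at *
  generalize _root_.homComp (fun K => φ (K + L)) 2 K = c₂ at *
  generalize _root_.homComp (fun K => φ (K + L)) 3 K = c₃ at *
  generalize _root_.homComp (fun K => φ (K + L)) 4 K = c₄ at *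
  have e₄ : c₄ = 0 := by
    have := eq_zero_of_forall_pos (F := fun s : ℝ => s ^ 2 * φ (K + s • L)
      - (s ^ 4 * c₀ + s ^ 3 * c₁ + s ^ 2 * c₂ + s * c₃ + c₄))
      (((continuous_pow 2).mul hc).sub (by fun_prop)) (fun s hs => by
        apply mul_left_cancel₀ (pow_ne_zero 2 hs.ne')
        linear_combination h₁ s hs)
    simp only [ne_eq, OfNat.ofNat_ne_zero, not_false_eq_true, zero_pow, zero_mul] at this
    linarith
  have e₃ : c₃ = 0 := by
    have := eq_zero_of_forall_pos (F := fun s : ℝ => s * φ (K + s • L)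
      - (s ^ 3 * c₀ + s ^ 2 * c₁ + s * c₂ + c₃))
      ((continuous_id.mul hc).sub (by fun_prop)) (fun s hs => by
        apply mul_left_cancel₀ (pow_ne_zero 3 hs.ne')
        linear_combination h₁ s hs + s ^ 2 * e₄)
    simp only [ne_eq, OfNat.ofNat_ne_zero, not_false_eq_true, zero_pow, zero_mul] at this
    linarith
  refine ⟨?_, e₃, e₄⟩
  have := eq_zero_of_forall_pos (F := fun s : ℝ => φ (K + s • L)
      - (s ^ 2 * c₀ + s * c₁ + c₂)) (hc.sub (by fun_prop)) (fun s hs => by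
        apply mul_left_cancel₀ (pow_ne_zero 4 hs.ne')
        linear_combination h₁ s hs + s ^ 2 * e₄ + s ^ 3 * e₃)
  simp only [zero_smul', add_zero, ne_eq, OfNat.ofNat_ne_zero, not_false_eq_true, zero_pow,
    zero_mul] at this
  linarith

end Polynomial

section MixedVolume

theorem coe_sum_body {V ι : Type*} [NormedAddCommGroup V] [NormedSpace ℝ V] (s : Finset ι)
    (K : ι → ConvexBody V) : ((∑ i ∈ s, K i : ConvexBody V) : Set V) = ∑ i ∈ s, (K i : Set V) := by
  classical
  induction s using Finset.induction_on with
  | empty => simp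
  | insert a s ha ih => rw [Finset.sum_insert ha, Finset.sum_insert ha, coe_add, ih]

theorem vol_pt {V : Type*} [NormedAddCommGroup V] [NormedSpace ℝ V] [MeasurableSpace V]
    [BorelSpace V] [FiniteDimensional ℝ V] [Nontrivial V] (μ : Measure V) [μ.IsAddHaarMeasure]
    (x : V) : vol μ (pt x) = 0 := by
  simp [vol, coe_pt]

/-- Twice the planar mixed volume. -/
def mix2 (M L : ConvexBody ℂ) : ℝ := vol volume (L + M) - vol volume L - vol volume M

theorem two_mul_mixedVol (M L : ConvexBody ℂ) : 2 * mixedVol volume ![M, L] = mix2 M L := by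
  have h₀ := vol_pt (volume : Measure ℂ) 0
  rw [pt_zero] at h₀
  simp only [vol] at h₀
  have e : (Finset.univ : Finset (Finset (Fin 2))) = {∅, {0}, {1}, {0, 1}} := by decide
  rw [mixedVol, e, Finset.sum_insert (by decide), Finset.sum_insert (by decide),
    Finset.sum_insert (by decide), Finset.sum_singleton]
  simp only [← coe_sum_body, mix2, vol]
  rw [Finset.sum_empty, Finset.sum_singleton, Finset.sum_singleton,
    Finset.sum_pair (by decide), h₀]
  simp only [Matrix.cons_val_zero, Matrix.cons_val_one, Finset.card_empty, Finset.card_singleton]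
  rw [Finset.card_pair (by decide), add_comm L M]
  norm_num
  ring

theorem mixedVol_four {V : Type*} [NormedAddCommGroup V] [NormedSpace ℝ V] [MeasurableSpace V]
    [BorelSpace V] [FiniteDimensional ℝ V] (hV : finrank ℝ V = 4) (μ : Measure V)
    [μ.IsAddHaarMeasure] (K N : ConvexBody V) : mixedVol μ ![K, K, K, N]
      = 1 / 4 * homComp (fun K => vol μ (K + N)) 3 K := by
  have h := vol_ctval μ
  have hh := vol_homDeg μ
  rw [hV] at hh
  have h4 := h.homComp_add_top hV.le hh K N
  have hp : ∀ t : ℝ, 0 ≤ t → vol μ (t • K + N) = homComp (fun K => vol μ (K + N)) 0 K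
      + t * homComp (fun K => vol μ (K + N)) 1 K + t ^ 2 * homComp (fun K => vol μ (K + N)) 2 K
      + t ^ 3 * homComp (fun K => vol μ (K + N)) 3 K + t ^ 4 * vol μ K := fun t ht => by
    rw [(h.comp_add N).sum_homComp hV.le (t • K)]
    simp only [(h.comp_add N).homComp_homDeg hV.le _ K t ht]
    rw [h4]
    ring
  have h₀ := hp 0 le_rfl
  have h₁ := hp 1 zero_le_one
  have h₂ := hp 2 zero_le_two
  have h₃ := hp 3 zero_le_three
  have k₂ := hh K 2 zero_le_two
  have k₃ := hh K 3 zero_le_three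
  have k₀ := hh.zero_body (by norm_num)
  have e₂ : K + K = (2 : ℝ) • K := (two_smul_body K).symm
  have e₃ : K + (2 : ℝ) • K = (3 : ℝ) • K := by
    have := (add_smul' K zero_le_one zero_le_two).symm
    rw [one_smul'] at this
    rw [this]
    norm_num
  rw [one_smul'] at h₁
  rw [zero_smul', zero_add] at h₀
  have e : (Finset.univ : Finset (Finset (Fin 4))) = {∅, {0}, {1}, {2}, {3}, {0, 1}, {0, 2},
      {0, 3}, {1, 2}, {1, 3}, {2, 3}, {0, 1, 2}, {0, 1, 3}, {0, 2, 3}, {1, 2, 3},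
      {0, 1, 2, 3}} := by decide
  generalize homComp (fun K => vol μ (K + N)) 0 K = c₀ at *
  generalize homComp (fun K => vol μ (K + N)) 1 K = c₁ at *
  generalize homComp (fun K => vol μ (K + N)) 2 K = c₂ at *
  generalize homComp (fun K => vol μ (K + N)) 3 K = c₃ at *
  simp only [vol] at h₀ h₁ h₂ h₃ k₀ k₂ k₃
  rw [mixedVol, e]
  simp only [← coe_sum_body]
  repeat rw [Finset.sum_insert (by decide)]
  simp only [Finset.sum_singleton]
  repeat rw [Finset.sum_insert (by decide)]
  simp only [Finset.sum_singleton, Finset.sum_empty]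
  simp only [← add_assoc, Matrix.cons_val, e₂, e₃, h₀, h₁, h₂, h₃, k₀, k₂, k₃]
  simp [Nat.factorial]
  ring

end MixedVolume

section Parallelogram

variable {V : Type*} [NormedAddCommGroup V] [NormedSpace ℝ V] {φ : ConvexBody V → ℝ}

theorem ConvexBody.seg_neg (a : V) : seg (-a) = seg a + pt (-a) := by
  rw [seg, seg, ← hull_translate (by simp) (by simp), Set.image_pair, Set.pair_comm]
  simp

theorem CTVal.par_smul (h : CTVal φ) (hs : ∀ u, φ (seg u) = 0) (a b : V) (r : ℝ) :
    φ (seg (r • a) + seg b) = |r| * φ (seg a + seg b) := by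
  have hpos : ∀ r : ℝ, 0 ≤ r → φ (seg (r • a) + seg b) = r * φ (seg a + seg b) := fun r hr => by
    rw [add_comm, h.add_seg_smul _ _ hr, hs, zero_add, _root_.segDiff, hs, sub_zero,
      add_comm (seg b)]
  rcases le_total 0 r with hr | hr
  · rw [hpos r hr, abs_of_nonneg hr]
  · have := hpos (-r) (by linarith)
    rw [neg_smul, ConvexBody.seg_neg, add_right_comm, h.add_pt] at this
    rw [this, abs_of_nonpos hr]

theorem CTVal.par_shear (h : CTVal φ) (hs : ∀ u, φ (seg u) = 0) {a : V} {l : V →L[ℝ] ℝ}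
    (hl : l a = 1) (b : V) (r : ℝ) : φ (seg a + seg (b + r • a)) = φ (seg a + seg b) := by
  have key : ∀ c : V, φ (seg a + seg c) = φ (seg a + seg (c - l c • a)) := fun c => by
    have := h.segDiff_proj hl (seg c)
    simp only [mapCLM_seg, projAlong_apply, _root_.segDiff, hs, sub_zero] at this
    rw [add_comm, ← this, add_comm]
  rw [key, key b, map_add, map_smul, hl]
  congr 3
  simp only [smul_eq_mul, mul_one, add_smul]
  abel

theorem CTVal.seg_eq_zero (h : CTVal φ) {k : ℕ} (hh : HomDeg φ (k + 2)) (u : V) :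
    φ (seg u) = 0 := by
  have h1 := h.add_seg_smul 0 u (r := 2) (by norm_num)
  have h0 : φ 0 = 0 := hh.zero_body (by omega)
  have h2 := hh (seg u) 2 (by norm_num)
  rw [_root_.segDiff, zero_add, zero_add, h0, ← smul_seg, h2] at h1
  have : (2 : ℝ) ≤ 2 ^ (k + 1) := by
    rw [pow_succ]; nlinarith [one_le_pow₀ (M₀ := ℝ) (a := 2) (n := k) (by norm_num)]
  rw [pow_succ] at h1
  nlinarith [h1]

end Parallelogram

section Plane

variable {ρ : ConvexBody ℂ → ℝ}

theorem finrank_complex_le : finrank ℝ ℂ ≤ 4 := by rw [Complex.finrank_real_complex]; norm_num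

theorem CTVal.par_eq (h : CTVal ρ) (hh : HomDeg ρ 2) (a b : ℂ) :
    ρ (seg a + seg b) = |det2 a b| * ρ (seg 1 + seg Complex.I) := by
  have hs := h.seg_eq_zero (k := 0) hh
  have hI : ∀ (a : ℂ) (r : ℝ), ρ (seg a + seg (r • a)) = 0 := fun a r => by
    rw [add_comm, h.par_smul hs, ← two_smul_body, smul_seg, hs, mul_zero]
  have key : ∀ a b : ℂ, a.re ≠ 0 →
      ρ (seg a + seg b) = |det2 a b| * ρ (seg 1 + seg Complex.I) := by
    intro a b ha
    have hb : b = (det2 a b / a.re) • Complex.I + (b.re / a.re) • a := by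
      apply Complex.ext <;> simp [det2] <;> field_simp
      ring
    have ha' : a = (a.re • (1 : ℂ)) + a.im • Complex.I := by apply Complex.ext <;> simp
    have e1 : ρ (seg a + seg b) = ρ (seg a + seg ((det2 a b / a.re) • Complex.I)) := by
      conv_lhs => rw [hb]
      exact h.par_shear hs (l := a.re⁻¹ • Complex.reCLM) (by simp [ha]) _ _
    have e2 : ρ (seg Complex.I + seg a) = ρ (seg Complex.I + seg (a.re • (1 : ℂ))) := by
      conv_lhs => rw [ha']
      exact h.par_shear hs (l := Complex.imCLM) (by simp) _ _
    rw [e1, add_comm, h.par_smul hs, e2, add_comm, h.par_smul hs, ← mul_assoc, ← abs_mul,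
      div_mul_cancel₀ _ ha]
  by_cases ha : a.re = 0
  · by_cases hb : b.re = 0
    · have e : a = a.im • Complex.I := by apply Complex.ext <;> simp [ha]
      have e' : b = b.im • Complex.I := by apply Complex.ext <;> simp [hb]
      rw [e, e', h.par_smul hs, hI]
      simp [det2]
    · rw [add_comm, key b a hb, show det2 b a = -det2 a b by simp only [det2]; ring, abs_neg]
  · exact key a b ha

theorem vol_homDeg_two : HomDeg (vol (volume : Measure ℂ)) 2 := by
  have := vol_homDeg (volume : Measure ℂ)
  rwa [Complex.finrank_real_complex] at this

theorem vol_seg (a : ℂ) : vol volume (seg a) = 0 :=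
  (vol_ctval volume).seg_eq_zero (k := 0) vol_homDeg_two a

theorem vol_square : vol volume (seg 1 + seg Complex.I) = 1 := by
  have : ((seg 1 + seg Complex.I : ConvexBody ℂ) : Set ℂ)
      = Complex.measurableEquivRealProd ⁻¹' (Set.Icc 0 1 ×ˢ Set.Icc 0 1) := by
    ext z
    rw [mem_coe', mem_add_iff]
    simp only [mem_seg, Set.mem_preimage, Set.mem_prod, Set.mem_Icc,
      Complex.measurableEquivRealProd_apply]
    constructor
    · rintro ⟨_, ⟨s, hs, hs', rfl⟩, _, ⟨t, ht, ht', rfl⟩, rfl⟩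
      simp [hs, hs', ht, ht']
    · rintro ⟨⟨h1, h2⟩, h3, h4⟩
      exact ⟨_, ⟨z.re, h1, h2, rfl⟩, _, ⟨z.im, h3, h4, rfl⟩, by apply Complex.ext <;> simp⟩
  rw [vol, this, Complex.volume_preserving_equiv_real_prod.measure_preimage_equiv,
    Measure.volume_eq_prod, Measure.prod_prod]
  simp

theorem vol_par (a b : ℂ) : vol volume (seg a + seg b) = |det2 a b| := by
  rw [(vol_ctval volume).par_eq vol_homDeg_two, vol_square, mul_one]

theorem vol_mapCLM {V : Type*} [NormedAddCommGroup V] [NormedSpace ℝ V] [MeasurableSpace V]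
    [BorelSpace V] [FiniteDimensional ℝ V] (μ : Measure V) [μ.IsAddHaarMeasure] (f : V →L[ℝ] V)
    (K : ConvexBody V) :
    vol μ (K.mapCLM f) = |LinearMap.det (f : V →ₗ[ℝ] V)| * vol μ K := by
  rw [vol, coe_mapCLM, Measure.addHaar_image_continuousLinearMap, ENNReal.toReal_mul,
    ENNReal.toReal_ofReal (abs_nonneg _)]
  rfl

end Plane

section Triangle

variable {V V' : Type*} [NormedAddCommGroup V] [NormedSpace ℝ V] [NormedAddCommGroup V']
  [NormedSpace ℝ V']

/-- The triangle with vertices `0`, `p`, `r`. -/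
def ConvexBody.tri (p r : V) : ConvexBody V := hull {0, p, r}

namespace ConvexBody

theorem tri_comm (p r : V) : tri p r = tri r p := by rw [tri, tri, Set.pair_comm]

theorem mapCLM_tri (f : V →L[ℝ] V') (p r : V) : (tri p r).mapCLM f = tri (f p) (f r) := by
  rw [tri, mapCLM_hull f (by simp) (by simp), tri]
  simp [Set.image_insert_eq]

theorem smul_tri (t : ℝ) (p r : V) : t • tri p r = tri (t • p) (t • r) := by
  rw [smul_eq_mapCLM, mapCLM_tri]; simp

theorem tri_zero_left (p : V) : tri 0 p = seg p := by simp [tri, seg]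

theorem tri_self (p : V) : tri p p = seg p := by simp [tri, seg]

theorem hull_triple (a b c : V) : hull {a, b, c} = tri (b - a) (c - a) + pt a := by
  rw [tri, ← hull_translate (by simp) (by simp)]
  simp [Set.image_insert_eq]

theorem continuous_tri {X : Type*} [TopologicalSpace X] {p r : X → V} (hp : Continuous p)
    (hr : Continuous r) : Continuous fun x => tri (p x) (r x) :=
  continuous_hull_triple continuous_const hp hr

theorem seg_add_seg (a b : V) : seg a + seg b = hull {0, a, a + b, b} := by
  rw [seg, seg, hull_add_hull (by simp) (by simp) (by simp) (by simp)]
  congr 1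
  ext x
  simp only [Set.mem_add, Set.mem_insert_iff, Set.mem_singleton_iff]
  aesop

end ConvexBody

variable {φ : ConvexBody V → ℝ}

theorem CTVal.hull_pair (h : CTVal φ) (a b : V) : φ (hull {a, b}) = φ (seg (b - a)) := by
  rw [hull_pair_eq, h.add_pt]

theorem CTVal.hull_triple (h : CTVal φ) (a b c : V) :
    φ (hull {a, b, c}) = φ (tri (b - a) (c - a)) := by
  rw [ConvexBody.hull_triple, h.add_pt]

theorem CTVal.seg_neg (h : CTVal φ) (a : V) : φ (seg (-a)) = φ (seg a) := by
  rw [ConvexBody.seg_neg, h.add_pt]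

theorem midpoint_mem_segment_sub (a b : V) : (1 / 2 : ℝ) • (a + b) ∈ segment ℝ a b :=
  ⟨1 / 2, 1 / 2, by norm_num, by norm_num, by norm_num, by simp [smul_add]⟩

/-- Splitting a parallelogram along its diagonal. -/
theorem CTVal.par_split (h : CTVal φ) (a b : V) :
    φ (seg a + seg b) + φ (seg (a + b)) = φ (tri a (a + b)) + φ (tri b (a + b)) := by
  set m : V := (1 / 2 : ℝ) • (a + b) with hm
  have hm1 : m ∈ segment ℝ a b := midpoint_mem_segment_sub a b
  have hm2 : m ∈ convexHull ℝ {0, a + b} := by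
    rw [convexHull_pair]
    simpa only [zero_add] using midpoint_mem_segment_sub 0 (a + b)
  have := h.edge_split (s := {0, a + b}) (by simp) (by simp) hm1
  have key : ∀ c : V, hull {c, m, 0, a + b} = tri c (a + b) := fun c => by
    rw [Set.insert_comm, hull_insert_of_mem (by simp), tri, Set.insert_comm]
    exact convexHull_mono (Set.subset_insert _ _) hm2
  rw [hull_insert_of_mem (by simp) hm2, key, Set.insert_comm m, key] at this
  rw [← this, seg_add_seg, seg]
  congr 3
  ext x
  simp only [Set.mem_insert_iff, Set.mem_singleton_iff]
  tauto

end Triangle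

section MixedArea

theorem mix2_comm (M L : ConvexBody ℂ) : mix2 M L = mix2 L M := by
  rw [mix2, mix2, add_comm]; ring

theorem mix2_eq (M L : ConvexBody ℂ) :
    mix2 M L = homComp (fun K => vol volume (K + M)) 1 L := by
  have h := vol_ctval (volume : Measure ℂ)
  have h' := h.comp_add M
  have hs := h'.sum_homComp finrank_complex_le
  obtain ⟨h2, h3, h4⟩ := h.homComp_add_of_two finrank_complex_le vol_homDeg_two L M
  have h0 : homComp (fun K => vol volume (K + M)) 0 L = vol volume M := by
    have e := hs 0
    have z : ∀ i, i ≠ 0 → homComp (fun K => vol volume (K + M)) i 0 = 0 := fun i hi =>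
      (h'.homComp_homDeg finrank_complex_le i).zero_body hi
    rw [z 1 (by simp), z 2 (by simp), z 3 (by simp), z 4 (by simp), zero_add] at e
    have e2 := h'.homComp_homDeg finrank_complex_le 0 L 0 le_rfl
    rw [zero_smul'] at e2
    simp only [pow_zero, one_mul] at e2
    rw [← e2]; linarith
  have := hs L
  rw [h2, h3, h4, h0] at this
  rw [mix2]; linarith

theorem mix2_ctval (M : ConvexBody ℂ) : CTVal (mix2 M) := by
  rw [funext (mix2_eq M)]
  exact ((vol_ctval volume).comp_add M).homComp 1

theorem mix2_homDeg (M : ConvexBody ℂ) : HomDeg (mix2 M) 1 := by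
  rw [funext (mix2_eq M)]
  exact ((vol_ctval volume).comp_add M).homComp_homDeg finrank_complex_le 1

theorem mix2_add (M K L : ConvexBody ℂ) : mix2 M (K + L) = mix2 M K + mix2 M L :=
  (mix2_ctval M).additive finrank_complex_le (mix2_homDeg M) K L

theorem mix2_mono {M K L : ConvexBody ℂ} (h : (K : Set ℂ) ⊆ L) : mix2 M K ≤ mix2 M L := by
  have key : ∀ t : ℝ, 0 < t →
      mix2 M K + t * vol volume K ≤ mix2 M L + t * vol volume L := by
    intro t ht
    have e : ∀ K : ConvexBody ℂ, vol volume (t • K + M)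
        = t * mix2 M K + t ^ 2 * vol volume K + vol volume M := fun K => by
      have h1 := mix2_homDeg M K t ht.le
      rw [mix2, vol_homDeg_two K t ht.le] at h1
      linarith
    have hm : vol volume (t • K + M) ≤ vol volume (t • L + M) := by
      apply vol_mono
      intro x hx
      rw [mem_coe', mem_add_iff] at hx ⊢
      obtain ⟨_, ⟨y, hy, rfl⟩, z, hz, rfl⟩ := hx
      exact ⟨_, ⟨y, h hy, rfl⟩, z, hz, rfl⟩
    rw [e, e] at hm
    by_contra hlt
    push Not at hlt
    nlinarith
  have := le_of_forall_pos (F := fun t => mix2 M K + t * vol volume K)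
    (G := fun t => mix2 M L + t * vol volume L) (by fun_prop) (by fun_prop) key
  simpa using this

theorem mix2_par (a b : ℂ) : mix2 (seg a) (seg b) = |det2 a b| := by
  rw [mix2, add_comm, vol_par, vol_seg, vol_seg]; ring

theorem vol_neg_tri (p r : ℂ) : vol volume (tri (-p) (-r)) = vol volume (tri p r) := by
  have := vol_mapCLM (volume : Measure ℂ) (-ContinuousLinearMap.id ℝ ℂ) (tri p r)
  rw [mapCLM_tri] at this
  have e : LinearMap.det ((-ContinuousLinearMap.id ℝ ℂ : ℂ →L[ℝ] ℂ) : ℂ →ₗ[ℝ] ℂ) = 1 := by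
    have : ((-ContinuousLinearMap.id ℝ ℂ : ℂ →L[ℝ] ℂ) : ℂ →ₗ[ℝ] ℂ) = (-1 : ℝ) • LinearMap.id := by
      ext; simp
    rw [this, LinearMap.det_smul, Complex.finrank_real_complex]
    simp
  rw [e] at this
  simpa using this

theorem vol_tri (p r : ℂ) : 2 * vol volume (tri p r) = |det2 p r| := by
  have h := vol_ctval (volume : Measure ℂ)
  have h1 := h.par_split p (r - p)
  have e2 : tri (r - p) r = tri (-p) (-r) + pt r := by
    rw [tri, tri, ← hull_translate (by simp) (by simp)]
    congr 1
    ext x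
    simp [Set.image_insert_eq, sub_eq_neg_add, or_comm]
    tauto
  rw [add_sub_cancel, e2, h.add_pt, vol_neg_tri, vol_par, vol_seg] at h1
  have : det2 p (r - p) = det2 p r := by simp [det2]; ring
  rw [this] at h1
  linarith

theorem mix2_self (M : ConvexBody ℂ) : mix2 M M = 2 * vol volume M := by
  rw [mix2, ← two_smul_body, vol_homDeg_two M 2 (by norm_num)]; ring

end MixedArea

theorem CTVal.add_two_seg {V : Type*} [NormedAddCommGroup V] [NormedSpace ℝ V]
    {φ : ConvexBody V → ℝ} (h : CTVal φ) (X : ConvexBody V) (u v : V) {r : ℝ} (hr : 0 ≤ r) :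
    φ (X + seg (r • u) + seg (r • v)) = φ X + r * (_root_.segDiff φ u X + _root_.segDiff φ v X)
      + r ^ 2 * _root_.segDiff (_root_.segDiff φ u) v X := by
  rw [h.add_seg_smul _ _ hr, h.add_seg_smul _ _ hr, (h.segDiff v).add_seg_smul _ _ hr,
    segDiff_comm φ u v]
  ring

section Product

/-- The product of two planar bodies. -/
def prodBody (A B : ConvexBody ℂ) : ConvexBody (ℂ × ℂ) := A.mapCLM inl2 + B.mapCLM inr2

/-- The unit square. -/
def square : ConvexBody ℂ := seg 1 + seg Complex.I

variable {χ : ConvexBody (ℂ × ℂ) → ℝ}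

theorem prodBody_mapCLM (A B : ConvexBody ℂ) (r s : ℝ) :
    (prodBody A B).mapCLM (mat r 0 0 s) = prodBody (r • A) (s • B) := by
  rw [prodBody, prodBody, mapCLM_add, mapCLM_mapCLM, mapCLM_mapCLM, smul_eq_mapCLM, smul_eq_mapCLM,
    mapCLM_mapCLM, mapCLM_mapCLM]
  congr 2 <;> ext z <;> simp

theorem CTVal.prod_left (h : CTVal χ) (B : ConvexBody ℂ) : CTVal fun A => χ (prodBody A B) :=
  h.comp inl2 (B.mapCLM inr2)

theorem CTVal.prod_right (h : CTVal χ) (A : ConvexBody ℂ) : CTVal fun B => χ (prodBody A B) := by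
  simpa only [prodBody, add_comm] using h.comp inr2 (A.mapCLM inl2)

theorem DiagCov.prod_left_homDeg (hc : DiagCov χ) (h : CTVal χ) (hh : HomDeg χ 3)
    (B : ConvexBody ℂ) : HomDeg (fun A => χ (prodBody A B)) 1 := by
  refine homDeg_of_pos (h.prod_left B).cont fun K t ht => ?_
  have := hc.scale_left hh (Real.sqrt_pos.2 ht) (prodBody K B)
  rw [Real.sq_sqrt ht.le, ← Complex.ofReal_one, prodBody_mapCLM, one_smul'] at this
  have hs := Real.sq_sqrt ht.le
  have h0 := Real.sqrt_pos.2 ht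
  apply mul_left_cancel₀ h0.ne'
  rw [this]
  linear_combination (√t * χ (prodBody K B)) * hs

theorem DiagCov.prod_right_homDeg (hc : DiagCov χ) (h : CTVal χ) (hh : HomDeg χ 3)
    (A : ConvexBody ℂ) : HomDeg (fun B => χ (prodBody A B)) 2 := by
  refine homDeg_of_pos (h.prod_right A).cont fun K t ht => ?_
  have := hc.scale_right hh (Real.sqrt_pos.2 ht) (prodBody A K)
  rw [Real.sq_sqrt ht.le, ← Complex.ofReal_one, prodBody_mapCLM, one_smul'] at this
  have hs := Real.sq_sqrt ht.le
  rw [this]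
  linear_combination ((√t ^ 2 + t) * χ (prodBody A K)) * hs

theorem DiagCov.prod_par (hc : DiagCov χ) (h : CTVal χ) (hh : HomDeg χ 3) (A : ConvexBody ℂ)
    (u v : ℂ) : χ (prodBody A (seg u + seg v)) = |det2 u v| * χ (prodBody A square) :=
  (h.prod_right A).par_eq (hc.prod_right_homDeg h hh A) u v

theorem DiagCov.segDiff_prod (hc : DiagCov χ) (h : CTVal χ) (hh : HomDeg χ 3) (A : ConvexBody ℂ)
    (u v : ℂ × ℂ) : segDiff (segDiff χ u) v (A.mapCLM inl2)
      = |det2 u.2 v.2| * χ (prodBody A square) := by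
  rw [hc.segDiff_segDiff_inl (m := 0) h hh, pow_zero, one_mul, ← hc.prod_par h hh]
  have hs := (h.prod_right A).seg_eq_zero (k := 0) (hc.prod_right_homDeg h hh A)
  have e : ∀ w : ℂ, seg ((0, w) : ℂ × ℂ) = (seg w).mapCLM inr2 := fun w => by
    rw [mapCLM_seg]; rfl
  have e0 : (0 : ConvexBody ℂ).mapCLM inr2 = 0 := by
    rw [← pt_zero, mapCLM_pt, map_zero, pt_zero]
  have h0 := hs 0
  have h1 := hs u.2
  have h2 := hs v.2
  rw [seg_zero] at h0
  simp only [prodBody, e0, add_zero] at h0 h1 h2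
  simp only [segDiff, e, h0, h1, h2, prodBody, mapCLM_add, ← add_assoc]
  rw [add_right_comm]
  ring

theorem DiagCov.segDiff_tri (hc : DiagCov χ) (h : CTVal χ) (hh : HomDeg χ 3) {a b : ℂ}
    (hd : det2 a b ≠ 0) {s : ℝ} (hs : 0 < s) :
    segDiff (segDiff χ (0, a)) (b, s * b)
      (tri (a, ((s - 1 : ℝ) : ℂ) * a) (b, ((s - 1 : ℝ) : ℂ) * b))
      = |det2 a b| * χ (prodBody (tri (s * a) b) square) := by
  let D : ℂ → ℂ × ℂ →L[ℝ] ℝ := fun w =>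
    w.im • Complex.reCLM.comp (ContinuousLinearMap.snd ℝ ℂ ℂ)
      - w.re • Complex.imCLM.comp (ContinuousLinearMap.snd ℝ ℂ ℂ)
  have hD : ∀ w p, D w p = det2 p.2 w := fun w p => by simp [D, det2]; ring
  have hself : ∀ z, det2 z z = 0 := fun z => by simp [det2]; ring
  have hmul : ∀ (r : ℝ) (z w : ℂ), det2 (r * z) w = r * det2 z w := fun r z w => by
    simp [det2]; ring
  have hsw : det2 b a = -det2 a b := by simp only [det2]; ring
  have h1 : ((det2 a b)⁻¹ • D b) ((0, a) : ℂ × ℂ) = 1 := by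
    simp [hD, hd]
  have h2 : ((-(s * det2 a b)⁻¹) • D a) ((b, s * b) : ℂ × ℂ) = 1 := by
    simp only [smul_apply, hD, hmul, hsw, smul_eq_mul]
    field_simp
  have e1 := (h.segDiff (b, s * b)).segDiff_proj h1
    (tri (a, ((s - 1 : ℝ) : ℂ) * a) (b, ((s - 1 : ℝ) : ℂ) * b))
  have e2 := (h.segDiff (0, a)).segDiff_proj h2 (tri (a, 0) (b, ((s - 1 : ℝ) : ℂ) * b))
  have t1 : (tri ((a, ((s - 1 : ℝ) : ℂ) * a) : ℂ × ℂ) (b, ((s - 1 : ℝ) : ℂ) * b)).mapCLM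
      (projAlong ((det2 a b)⁻¹ • D b) (0, a)) = tri (a, 0) (b, ((s - 1 : ℝ) : ℂ) * b) := by
    have k1 : ((det2 a b)⁻¹ • D b) ((a, ((s - 1 : ℝ) : ℂ) * a) : ℂ × ℂ) = s - 1 := by
      simp only [smul_apply, hD, hmul, smul_eq_mul]
      field_simp
    have k2 : ((det2 a b)⁻¹ • D b) ((b, ((s - 1 : ℝ) : ℂ) * b) : ℂ × ℂ) = 0 := by
      simp only [smul_apply, hD, hmul, hself, smul_eq_mul, mul_zero]
    rw [mapCLM_tri, projAlong_apply, projAlong_apply, k1, k2]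
    congr 1 <;> simp
  have t2 : (tri ((a, 0) : ℂ × ℂ) (b, ((s - 1 : ℝ) : ℂ) * b)).mapCLM
      (projAlong ((-(s * det2 a b)⁻¹) • D a) (b, s * b))
      = (tri a ((s⁻¹ : ℝ) • b)).mapCLM inl2 := by
    rw [mapCLM_tri, mapCLM_tri]
    congr 1
    · ext <;> simp [hD, det2]
    · have : ((-(s * det2 a b)⁻¹) • D a) ((b, ((s - 1 : ℝ) : ℂ) * b) : ℂ × ℂ) = (s - 1) / s := by
        simp only [smul_apply, hD, hmul, hsw, smul_eq_mul]
        field_simp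
      rw [projAlong_apply, this]
      have hs' : (s : ℂ) ≠ 0 := by exact_mod_cast hs.ne'
      ext1
      · simp
        field_simp
        ring
      · simp
        field_simp
        ring
  rw [segDiff_comm, ← e1, t1, segDiff_comm, ← e2, t2, hc.segDiff_prod h hh]
  have e3 : tri (s * a) b = s • tri a ((s⁻¹ : ℝ) • b) := by
    rw [smul_tri, smul_smul, mul_inv_cancel₀ hs.ne', one_smul]
    rfl
  have := hc.prod_left_homDeg h hh square (tri a ((s⁻¹ : ℝ) • b)) s hs.le
  simp only at this
  rw [e3, this]
  have : det2 a (s * b) = s * det2 a b := by simp [det2]; ring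
  simp only [this, abs_mul, abs_of_pos hs]
  ring

end Product

/-- The inequality on triangles which characterizes mixed areas. -/
def TriIneq (χ : ConvexBody ℂ → ℝ) : Prop :=
  ∀ a b : ℂ, 2 * χ (tri a b) ≤ χ (tri (a + a) b) + χ (seg b)

namespace CovFun

variable {f : ConvexBody (ℂ × ℂ) → ℂ × ℂ → ℝ}

theorem two_mul_le (hf : CovFun f) (δ : ℂ) (K) : 2 * f K (1, 0)
    ≤ f (K.mapCLM (mat 1 0 δ 1)) (1, 0) + f (K.mapCLM (mat 1 0 (-δ) 1)) (1, 0) := by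
  rw [hf.lower, hf.lower]
  have h1 := hf.add_le K (1, -δ) (1, - -δ)
  have h2 := hf.smul K (1, 0) 2 (by norm_num)
  have : ((1, -δ) + (1, - -δ) : ℂ × ℂ) = (2 : ℝ) • (1, 0) := by
    ext <;> simp; norm_num
  rw [this, h2] at h1
  exact h1

theorem two_mul_homComp_le (hf : CovFun f) (δ : ℂ) (K) {i : ℕ} (hi : i = 1 ∨ i = 3) :
    2 * homComp (fun K => f K (1, 0)) i K
    ≤ homComp (fun K => f K (1, 0)) i (K.mapCLM (mat 1 0 δ 1))
      + homComp (fun K => f K (1, 0)) i (K.mapCLM (mat 1 0 (-δ) 1)) := by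
  have key : ∀ t : ℝ, 0 < t → _ := fun t ht => hf.two_mul_le δ (t • K)
  have e : ∀ (i : ℕ) (K) (t : ℝ), 0 < t → homComp (fun K => f K (1, 0)) i (t • K)
      = t ^ i * homComp (fun K => f K (1, 0)) i K := fun i K t ht =>
    hf.homComp_homDeg i (1, 0) K t ht.le
  have hadd := hf.eq_add
  generalize homComp (fun K => f K (1, 0)) = F at *
  simp only [hadd, mapCLM_smul] at key
  set K₁ := K.mapCLM (mat 1 0 δ 1)
  set K₂ := K.mapCLM (mat 1 0 (-δ) 1)
  rcases hi with rfl | rfl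
  · have := le_of_forall_pos (F := fun t => 2 * (F 1 K + t ^ 2 * F 3 K))
      (G := fun t => F 1 K₁ + t ^ 2 * F 3 K₁ + (F 1 K₂ + t ^ 2 * F 3 K₂)) (by fun_prop)
      (by fun_prop) (fun t ht => ?_)
    · simpa using this
    · have := key t ht
      simp only [e _ _ _ ht] at this
      refine le_of_mul_le_mul_left ?_ ht
      linarith
  · have := le_of_forall_pos (F := fun t => 2 * (t ^ 2 * F 1 K + F 3 K))
      (G := fun t => t ^ 2 * F 1 K₁ + F 3 K₁ + (t ^ 2 * F 1 K₂ + F 3 K₂)) (by fun_prop)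
      (by fun_prop) (fun t ht => ?_)
    · simpa using this
    · have := key t⁻¹ (inv_pos.2 ht)
      simp only [e _ _ _ (inv_pos.2 ht)] at this
      have h3 := mul_le_mul_of_nonneg_left this (pow_pos ht 3).le
      field_simp at h3
      linarith

theorem triIneq_one (hf : CovFun f) :
    TriIneq fun B => homComp (fun K => f K (1, 0)) 1 (B.mapCLM inr2) := by
  intro a b
  have := hf.two_mul_homComp_le 1 (tri (a, a) (0, b)) (Or.inl rfl)
  rw [hf.homComp_one_proj (tri (a, a) (0, b)),
    hf.homComp_one_proj ((tri (a, a) (0, b)).mapCLM (mat 1 0 1 1)),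
    hf.homComp_one_proj ((tri (a, a) (0, b)).mapCLM (mat 1 0 (-1) 1))] at this
  simpa [mapCLM_tri, tri_zero_left] using this

theorem triIneq_three (hf : CovFun f) :
    TriIneq fun A => homComp (fun K => f K (1, 0)) 3 (prodBody A square) := by
  have hle := fun δ K => hf.two_mul_homComp_le δ K (Or.inr rfl)
  have hc := hf.diagCov.homComp 3
  have h := hf.homComp_val 3 (1, 0)
  have hh := hf.homComp_homDeg 3 (1, 0)
  set χ := homComp (fun K => f K (1, 0)) 3
  have hcont : ∀ {p r : ℂ × ℂ → ℂ}, Continuous p → Continuous r →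
      Continuous fun x => χ (prodBody (tri (p x) (r x)) square) := fun hp hr =>
    (h.prod_left square).cont.comp (continuous_tri hp hr)
  have hpos : ∀ a b, det2 a b ≠ 0 → ∀ δ : ℝ, 0 < δ → δ < 1 →
      2 * χ (prodBody (tri a b) square)
        ≤ χ (prodBody (tri (((1 + δ : ℝ) : ℂ) * a) b) square)
          + χ (prodBody (tri (((1 - δ : ℝ) : ℂ) * a) b) square) := by
    intro a b hd δ h0 h1
    have hX : ∀ t : ℝ, 0 < t → _ := fun t ht => hle δ
      (tri (a, 0) (b, 0) + seg (t⁻¹ • (0, a)) + seg (t⁻¹ • (b, b)))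
    have hX' : ∀ c : ℂ, ∀ t : ℝ,
        (tri (a, 0) (b, 0) + seg (t⁻¹ • (0, a)) + seg (t⁻¹ • (b, b))).mapCLM (mat 1 0 c 1)
        = tri (a, c * a) (b, c * b) + seg (t⁻¹ • (0, a)) + seg (t⁻¹ • (b, (1 + c) * b)) := by
      intro c t
      rw [mapCLM_add, mapCLM_add, mapCLM_tri, mapCLM_seg, mapCLM_seg, map_smul, map_smul]
      simp [add_mul, add_comm]
    simp only [hX'] at hX
    have key : 2 * segDiff (segDiff χ (0, a)) (b, b) (tri (a, 0) (b, 0))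
        ≤ segDiff (segDiff χ (0, a)) (b, (1 + δ) * b) (tri (a, δ * a) (b, δ * b))
          + segDiff (segDiff χ (0, a)) (b, (1 + -δ) * b) (tri (a, -δ * a) (b, -δ * b)) := by
      generalize tri (a, (0 : ℂ)) (b, 0) = X at *
      generalize tri (a, δ * a) (b, δ * b) = Y at *
      generalize tri (a, -δ * a) (b, -δ * b) = Z at *
      clear hX'
      generalize (1 + (δ : ℂ)) * b = y at *
      generalize (1 + -(δ : ℂ)) * b = z at *
      have := le_of_forall_pos
        (F := fun t => 2 * (t ^ 2 * χ X + t * (segDiff χ (0, a) X + segDiff χ (b, b) X)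
          + segDiff (segDiff χ (0, a)) (b, b) X))
        (G := fun t => (t ^ 2 * χ Y + t * (segDiff χ (0, a) Y + segDiff χ (b, y) Y)
            + segDiff (segDiff χ (0, a)) (b, y) Y)
          + (t ^ 2 * χ Z + t * (segDiff χ (0, a) Z + segDiff χ (b, z) Z)
            + segDiff (segDiff χ (0, a)) (b, z) Z))
        (by fun_prop) (by fun_prop) (fun t ht => ?_)
      · simpa using this
      · have := hX t ht
        rw [h.add_two_seg _ _ _ (inv_pos.2 ht).le, h.add_two_seg _ _ _ (inv_pos.2 ht).le,
          h.add_two_seg _ _ _ (inv_pos.2 ht).le] at this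
        have h3 := mul_le_mul_of_nonneg_left this (pow_pos ht 2).le
        field_simp at h3
        linarith
    have e := fun (s : ℝ) (hs : 0 < s) => hc.segDiff_tri h hh hd hs
    have e0 := e 1 one_pos
    have e1 := e (1 + δ) (by linarith)
    have e2 := e (1 - δ) (by linarith)
    rw [add_sub_cancel_left] at e1
    rw [sub_sub_cancel_left] at e2
    simp only [sub_self, Complex.ofReal_zero, zero_mul, Complex.ofReal_one, one_mul] at e0
    simp only [Complex.ofReal_add, Complex.ofReal_sub, Complex.ofReal_one, Complex.ofReal_neg]
      at e1 e2 ⊢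
    rw [e0, e1, ← sub_eq_add_neg, e2, ← mul_add, mul_left_comm] at key
    exact le_of_mul_le_mul_left key (abs_pos.2 hd)
  intro a b
  have hF := eq_zero_of_det2 (F := fun a b => max 0 (2 * χ (prodBody (tri a b) square)
      - (χ (prodBody (tri (a + a) b) square) + χ (prodBody (tri 0 b) square)))) ?_ (fun a b hd => ?_)
      a b
  · have := (max_eq_left_iff.1 hF)
    rw [tri_zero_left] at this
    simp only
    linarith
  · exact continuous_const.max (((hcont continuous_fst continuous_snd).const_mul 2).sub
      ((hcont (continuous_fst.add continuous_fst) continuous_snd).add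
        (hcont continuous_const continuous_snd)))
  · apply max_eq_left
    have hc2 : ∀ p : ℝ → ℂ, Continuous p →
        Continuous fun t : ℝ => χ (prodBody (tri (p t * a) b) square) := fun p hp =>
      (h.prod_left square).cont.comp (continuous_tri (hp.mul continuous_const) continuous_const)
    have := le_of_forall_pos (F := fun _ => 2 * χ (prodBody (tri a b) square))
      (G := fun t => χ (prodBody (tri (((1 + max (1 - t) (1 / 2) : ℝ) : ℂ) * a) b) square)
          + χ (prodBody (tri (((1 - max (1 - t) (1 / 2) : ℝ) : ℂ) * a) b) square))
      (by fun_prop) ((hc2 _ (by fun_prop)).add (hc2 _ (by fun_prop)))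
      (fun t ht => hpos a b hd _ (by positivity) (max_lt (by linarith) (by norm_num)))
    have e : max (1 - 0 : ℝ) (1 / 2) = 1 := by norm_num
    simp only [e] at this
    simp only [sub_self, Complex.ofReal_zero, zero_mul, Complex.ofReal_add, Complex.ofReal_one,
      add_mul, one_mul] at this
    linarith

end CovFun

section EdgeFunction

/-- The value of `χ` on the right triangle with hypotenuse `[0, p]` below the diagonal, up to the
orientation of the triangle. -/
def areaBelow (χ : ConvexBody ℂ → ℝ) (p : ℂ) : ℝ :=
  if 0 ≤ p.im then χ (tri (p.re : ℂ) p)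
  else χ (seg (p.re : ℂ)) + χ (seg p) - χ (tri (p.re : ℂ) p)

/-- The contribution of an edge of a positively oriented polygon to `χ`. -/
def edgeFun (χ : ConvexBody ℂ → ℝ) (p : ℂ) : ℝ :=
  if 0 ≤ p.re then χ (seg p) - areaBelow χ p else areaBelow χ (-p)

variable {χ : ConvexBody ℂ → ℝ}

theorem HomDeg.seg_zero {k : ℕ} (hh : HomDeg χ (k + 1)) : χ (seg 0) = 0 := by
  rw [ConvexBody.seg_zero]; exact hh.zero_body (by omega)

theorem continuous_areaBelow (hχ : Continuous χ) : Continuous (areaBelow χ) := by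
  have h₁ : Continuous fun p : ℂ => χ (tri (p.re : ℂ) p) :=
    hχ.comp (continuous_tri (by fun_prop) continuous_id)
  have h₂ : Continuous fun p : ℂ => χ (seg (p.re : ℂ)) :=
    hχ.comp (continuous_seg.comp (by fun_prop))
  have h₃ : Continuous fun p : ℂ => χ (seg p) := hχ.comp continuous_seg
  refine Continuous.if_le h₁ ((h₂.add h₃).sub h₁) continuous_const Complex.continuous_im
    fun p hp => ?_
  have : (p.re : ℂ) = p := by apply Complex.ext <;> simp [← hp]
  rw [this, tri_self]
  ring

theorem areaBelow_smul (hh : HomDeg χ 1) (p : ℂ) {t : ℝ} (ht : 0 ≤ t) :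
    areaBelow χ (t • p) = t * areaBelow χ p := by
  rcases ht.eq_or_lt with rfl | ht
  · simp [areaBelow, tri_self, hh.seg_zero]
  have h := fun K => hh K t ht.le
  have e : ((t • p).re : ℂ) = t • (p.re : ℂ) := by simp
  rw [areaBelow, areaBelow, e, ← smul_tri, ← smul_seg, ← smul_seg, h, h, h]
  simp only [Complex.smul_im, smul_eq_mul, mul_nonneg_iff_of_pos_left ht]
  split_ifs <;> ring

theorem edgeFun_of_nonneg {p : ℂ} (hp : 0 ≤ p.re) : edgeFun χ p = χ (seg p) - areaBelow χ p := by
  simp [edgeFun, hp]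

theorem edgeFun_of_nonpos (h : CTVal χ) (hh : HomDeg χ 1) {p : ℂ} (hp : p.re ≤ 0) :
    edgeFun χ p = areaBelow χ (-p) := by
  rcases hp.lt_or_eq with hp | hp
  · simp [edgeFun, hp]
  · have e : p = p.im • Complex.I := by apply Complex.ext <;> simp [hp]
    have e' := h.seg_neg p
    simp only [edgeFun, hp, areaBelow, Complex.neg_im, Complex.neg_re, Left.nonneg_neg_iff,
      Complex.ofReal_zero, neg_zero, tri_zero_left, hh.seg_zero, e']
    rcases lt_trichotomy 0 p.im with h0 | h0 | h0
    · simp [h0.le, h0]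
    · have : p = 0 := by apply Complex.ext <;> simp [hp, ← h0]
      simp [this, hh.seg_zero]
    · simp [h0.le, h0]

theorem edgeFun_add_neg (h : CTVal χ) (hh : HomDeg χ 1) (p : ℂ) :
    edgeFun χ p + edgeFun χ (-p) = χ (seg p) := by
  rcases le_total 0 p.re with hp | hp
  · rw [edgeFun_of_nonneg hp, edgeFun_of_nonpos h hh (by simpa using hp), neg_neg]; ring
  · rw [edgeFun_of_nonpos h hh hp, edgeFun_of_nonneg (by simpa using hp), h.seg_neg]; ring

theorem continuous_edgeFun (h : CTVal χ) (hh : HomDeg χ 1) : Continuous (edgeFun χ) := by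
  have h₁ := continuous_areaBelow h.cont
  refine Continuous.if_le ((h.cont.comp continuous_seg).sub h₁) (h₁.comp continuous_neg)
    continuous_const Complex.continuous_re fun p hp => ?_
  exact (edgeFun_of_nonneg hp.le).symm.trans (edgeFun_of_nonpos h hh hp.ge)

theorem edgeFun_smul (h : CTVal χ) (hh : HomDeg χ 1) (p : ℂ) {t : ℝ} (ht : 0 ≤ t) :
    edgeFun χ (t • p) = t * edgeFun χ p := by
  rcases le_total 0 p.re with hp | hp
  · rw [edgeFun_of_nonneg hp, edgeFun_of_nonneg (by simpa using mul_nonneg ht hp),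
      areaBelow_smul hh _ ht, ← smul_seg, hh _ _ ht]
    ring
  · rw [edgeFun_of_nonpos h hh hp,
      edgeFun_of_nonpos h hh (by simpa using mul_nonpos_of_nonneg_of_nonpos ht hp), ← smul_neg,
      areaBelow_smul hh _ ht]

theorem CTVal.tri_split (h : CTVal χ) {a b p c : ℂ} (hp : p ∈ segment ℝ a b) :
    χ (hull {a, b, c}) + χ (seg (c - p)) = χ (hull {a, p, c}) + χ (hull {p, b, c}) := by
  have := h.edge_split (s := {c}) (by simp) (by simp) hp
  rwa [h.hull_pair] at this

theorem mem_vertical {p q r : ℂ} (h : p.re = q.re) (h' : r.re = q.re) (h1 : p.im ≤ r.im)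
    (h2 : r.im ≤ q.im) : r ∈ segment ℝ p q := by
  rcases (h1.trans h2).eq_or_lt with e | e
  · have : r = p := by apply Complex.ext <;> linarith
    rw [this]; exact left_mem_segment ℝ p q
  · have hne : q.im - p.im ≠ 0 := by linarith
    refine ⟨(q.im - r.im) / (q.im - p.im), (r.im - p.im) / (q.im - p.im),
      div_nonneg (by linarith) (by linarith), div_nonneg (by linarith) (by linarith), ?_, ?_⟩
    · field_simp; ring
    · apply Complex.ext
      · simp only [Complex.add_re, Complex.smul_re, smul_eq_mul, h, h']
        field_simp; ring
      · simp only [Complex.add_im, Complex.smul_im, smul_eq_mul]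
        field_simp; ring

theorem CTVal.tri_right_vertical (h : CTVal χ) {p q : ℂ} (hpq : p.re = q.re) (him : p.im ≤ q.im) :
    χ (tri p q) = areaBelow χ q - areaBelow χ p + χ (seg p) := by
  have hxp : (p.re : ℂ) = (q.re : ℂ) := by rw [hpq]
  have ht : ∀ a b : ℂ, hull {a, b, 0} = tri a b := fun a b => by
    rw [tri]; congr 1; ext; simp; tauto
  have hs := fun a b p hp => h.tri_split (c := 0) (a := a) (b := b) (p := p) hp
  simp only [ht, zero_sub, h.seg_neg] at hs
  simp only [areaBelow, hxp]
  by_cases h1 : 0 ≤ p.im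
  · have := hs (q.re : ℂ) q p (mem_vertical (by simp) hpq (by simpa using h1) him)
    simp only [h1, h1.trans him, if_true]
    linarith
  · by_cases h2 : 0 ≤ q.im
    · have := hs p q (q.re : ℂ) (mem_vertical hpq (by simp) (by simpa using (not_le.1 h1).le)
        (by simpa using h2))
      rw [tri_comm p (q.re : ℂ)] at this
      simp only [h1, h2, if_true, if_false]
      linarith
    · have := hs p (q.re : ℂ) q (mem_vertical (by simp [hpq]) (by simp) him
        (by simpa using (not_le.1 h2).le))
      rw [tri_comm p (q.re : ℂ), tri_comm q (q.re : ℂ)] at this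
      simp only [h1, h2, if_false]
      linarith

theorem CTVal.tri_add (h : CTVal χ) (hh : HomDeg χ 1) (p r : ℂ) :
    χ (tri p r) + χ (tri (r - p) r) = χ (seg p) + χ (seg (r - p)) + χ (seg r) := by
  have := h.par_split p (r - p)
  rw [add_sub_cancel, h.additive finrank_complex_le hh] at this
  exact this.symm

theorem CTVal.tri_left_vertical (h : CTVal χ) (hh : HomDeg χ 1) {p q : ℂ} (hq : q.re = 0)
    (him : 0 ≤ q.im) : χ (tri q p)
      = χ (seg q) + χ (seg p) - areaBelow χ p + areaBelow χ (p - q) := by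
  have h1 := h.tri_add hh q p
  have h2 := h.tri_right_vertical (p := p - q) (q := p) (by simp [hq]) (by simpa using him)
  linarith

theorem CTVal.tri_eq_of_right (h : CTVal χ) (hh : HomDeg χ 1) {p r : ℂ} (hd : 0 < det2 p r)
    (hp : 0 ≤ p.re) (hr : 0 ≤ r.re) :
    χ (tri p r) = edgeFun χ p + edgeFun χ (r - p) + edgeFun χ (-r) := by
  have hd' : 0 < p.re * r.im - p.im * r.re := hd
  have ha := fun (z : ℂ) (t : ℝ) ht => areaBelow_smul hh z (t := t) ht
  have hw := fun (z : ℂ) (t : ℝ) (ht : 0 ≤ t) => hh (seg z) t ht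
  simp only [smul_seg, pow_one] at hw
  rw [edgeFun_of_nonneg hp, edgeFun_of_nonpos h hh (p := -r) (by simpa using hr), neg_neg]
  rcases le_or_gt p.re r.re with hpr | hpr
  · have hr0 : 0 < r.re := by
      rcases hr.eq_or_lt with e | e
      · have : p.re = 0 := by linarith
        rw [← e, this] at hd'; linarith
      · exact e
    rw [edgeFun_of_nonneg (by simpa using hpr)]
    set t := p.re / r.re with ht
    have ht0 : 0 ≤ t := by positivity
    have ht1 : t ≤ 1 := (div_le_one hr0).2 hpr
    have hre : (t • r).re = p.re := by
      simp [ht, hr0.ne']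
    have him : p.im ≤ (t • r).im := by
      simp only [Complex.smul_im, smul_eq_mul, ht]
      rw [div_mul_eq_mul_div, le_div_iff₀ hr0]
      linarith
    have hmem : t • r ∈ segment ℝ 0 r := ⟨1 - t, t, by linarith, ht0, by ring, by simp⟩
    have hs := h.tri_split (c := p) hmem
    have e1 : hull {0, r, p} = tri p r := tri_comm _ _
    have e2 : hull {0, t • r, p} = tri p (t • r) := tri_comm _ _
    have e3 : χ (hull {t • r, r, p}) = χ (tri (t • r - p) (r - p)) := by
      rw [← h.hull_triple]; congr 2; ext; simp; tauto
    rw [e1, e2, e3, h.tri_right_vertical hre.symm him,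
      h.tri_left_vertical hh (q := t • r - p) (p := r - p) (by rw [Complex.sub_re, hre, sub_self])
        (by rw [Complex.sub_im]; linarith), ← neg_sub (t • r) p, h.seg_neg,
      sub_sub_sub_cancel_right] at hs
    have e4 : r - t • r = (1 - t) • r := by rw [sub_smul, one_smul]
    rw [e4, ha _ _ ht0, ha _ _ (by linarith)] at hs
    linarith
  · have hp0 : 0 < p.re := by linarith
    rw [edgeFun_of_nonpos h hh (p := r - p) (by simpa using hpr.le), neg_sub]
    set t := r.re / p.re with ht
    have ht0 : 0 ≤ t := by positivity
    have ht1 : t ≤ 1 := (div_le_one hp0).2 hpr.le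
    have hre : (t • p).re = r.re := by
      simp [ht, hp0.ne']
    have him : (t • p).im ≤ r.im := by
      simp only [Complex.smul_im, smul_eq_mul, ht]
      rw [div_mul_eq_mul_div, div_le_iff₀ hp0]
      linarith
    have hmem : t • p ∈ segment ℝ 0 p := ⟨1 - t, t, by linarith, ht0, by ring, by simp⟩
    have hs := h.tri_split (c := r) hmem
    have e3 : χ (hull {t • p, p, r}) = χ (tri (r - t • p) (p - t • p)) := by
      rw [h.hull_triple, tri_comm]
    have e1 : hull {0, p, r} = tri p r := rfl
    have e2 : hull {0, t • p, r} = tri (t • p) r := rfl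
    rw [e1, e2, e3, h.tri_right_vertical hre him,
      h.tri_left_vertical hh (q := r - t • p) (p := p - t • p)
        (by rw [Complex.sub_re, hre, sub_self]) (by rw [Complex.sub_im]; linarith),
      sub_sub_sub_cancel_right] at hs
    have e4 : p - t • p = (1 - t) • p := by rw [sub_smul, one_smul]
    rw [e4, ha _ _ ht0, ha _ _ (by linarith), hw _ _ ht0, hw _ _ (by linarith)] at hs
    linarith

theorem CTVal.tri_eq (h : CTVal χ) (hh : HomDeg χ 1) {p r : ℂ} (hd : 0 < det2 p r) :
    χ (tri p r) = edgeFun χ p + edgeFun χ (r - p) + edgeFun χ (-r) := by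
  have hd' : 0 < p.re * r.im - p.im * r.re := hd
  by_cases h1 : 0 ≤ p.re ∧ 0 ≤ r.re
  · exact h.tri_eq_of_right hh hd h1.1 h1.2
  rcases le_total p.re r.re with hpr | hpr
  · have hp : p.re ≤ 0 := by
      by_contra! hp
      exact h1 ⟨hp.le, hp.le.trans hpr⟩
    have := h.tri_eq_of_right hh (p := r - p) (r := -p) (by simp [det2]; linarith)
      (by simpa using hpr) (by simpa using hp)
    have e : χ (tri (r - p) (-p)) = χ (tri p r) := by
      rw [show (-p : ℂ) = 0 - p from (zero_sub p).symm, ← h.hull_triple, tri]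
      congr 2; ext; simp only [Set.mem_insert_iff, Set.mem_singleton_iff]; tauto
    rw [← e, this, neg_neg, show -p - (r - p) = -r by ring]
    ring
  · have hr : r.re ≤ 0 := by
      by_contra! hr
      exact h1 ⟨hr.le.trans hpr, hr.le⟩
    have := h.tri_eq_of_right hh (p := -r) (r := p - r) (by simp [det2]; linarith)
      (by simpa using hr) (by simpa using hpr)
    have e : χ (tri (-r) (p - r)) = χ (tri p r) := by
      rw [show (-r : ℂ) = 0 - r from (zero_sub r).symm, ← h.hull_triple, tri]
      congr 2; ext; simp only [Set.mem_insert_iff, Set.mem_singleton_iff]; tauto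
    rw [← e, this, neg_sub, show p - r - -r = p by ring]
    ring

theorem CTVal.seg_le_tri (h : CTVal χ) (hh : HomDeg χ 1) (ht : TriIneq χ) (b c : ℂ) :
    χ (seg c) ≤ χ (tri b c) := by
  set a := b - (1 / 2 : ℝ) • c with ha
  have hca : c = (2 : ℝ) • (b - a) := by
    rw [ha, sub_sub_cancel, smul_smul]; norm_num
  set m := (2 / 3 : ℝ) • ((2 : ℝ) • a + b) with hm
  have hm1 : m ∈ segment ℝ ((2 : ℝ) • a) ((2 : ℝ) • b) :=
    ⟨2 / 3, 1 / 3, by norm_num, by norm_num, by norm_num, by rw [hm]; module⟩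
  have hm0 : m ∈ segment ℝ 0 ((2 : ℝ) • a + b) :=
    ⟨1 / 3, 2 / 3, by norm_num, by norm_num, by norm_num, by rw [hm]; module⟩
  have hmem : ∀ z : ℂ, hull (insert m {z, (2 : ℝ) • a, (2 : ℝ) • b})
      = hull {z, (2 : ℝ) • a, (2 : ℝ) • b} := fun z =>
    hull_insert_of_mem (Set.toFinite _) (segment_subset_convexHull (by simp) (by simp) hm1)
  have hs := h.edge_split (s := {(2 : ℝ) • a, (2 : ℝ) • b}) (Set.toFinite _) (by simp) hm0
  rw [Set.insert_comm 0 m, hmem, hmem, hull_insert_of_mem (Set.toFinite _)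
    (segment_subset_convexHull (by simp) (by simp) hm1), h.hull_pair] at hs
  have e1 : hull {0, (2 : ℝ) • a + b, (2 : ℝ) • a, (2 : ℝ) • b} = tri (a + a) b + seg b := by
    rw [tri, seg, hull_add_hull (Set.toFinite _) (by simp) (Set.toFinite _) (by simp),
      ← hull_insert_of_mem (p := b) (Set.toFinite _) (segment_subset_convexHull
        (x := 0) (y := (2 : ℝ) • b) (by simp) (by simp)
        ⟨1 / 2, 1 / 2, by norm_num, by norm_num, by norm_num, by module⟩)]
    congr 1
    ext z
    simp only [Set.mem_add, Set.mem_insert_iff, Set.mem_singleton_iff, two_smul, exists_eq_or_imp,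
      exists_eq_left, zero_add, add_zero]
    constructor
    · rintro (rfl | rfl | rfl | rfl | rfl) <;> simp
    · rintro ((rfl | rfl) | (rfl | rfl) | (rfl | rfl)) <;> simp
  have e2 : χ (hull {0, (2 : ℝ) • a, (2 : ℝ) • b}) = 2 * χ (tri a b) := by
    rw [h.hull_triple, sub_zero, sub_zero, ← smul_tri, hh _ _ (by norm_num), pow_one]
  have e3 : χ (hull {(2 : ℝ) • a + b, (2 : ℝ) • a, (2 : ℝ) • b}) = χ (tri b c) := by
    rw [Set.insert_comm, h.hull_triple, add_sub_cancel_left, ← smul_sub, hca]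
  rw [e1, e2, e3, ← smul_sub, ← hca, h.additive finrank_complex_le hh] at hs
  have := ht a b
  linarith

end EdgeFunction

section PlanarFunctionals

variable {χ : ConvexBody ℂ → ℝ}

theorem edgeFun_add_le (h : CTVal χ) (hh : HomDeg χ 1) (ht : TriIneq χ) (p q : ℂ) :
    edgeFun χ (p + q) ≤ edgeFun χ p + edgeFun χ q := by
  have key : ∀ p q : ℂ, 0 < det2 p q → edgeFun χ (p + q) ≤ edgeFun χ p + edgeFun χ q := by
    intro p q hd
    have h1 := h.tri_eq hh (p := p) (r := p + q) (by
      have : det2 p (p + q) = det2 p q := by simp [det2]; ring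
      rwa [this])
    have h2 := h.seg_le_tri hh ht p (p + q)
    rw [← edgeFun_add_neg h hh (p + q), h1, add_sub_cancel_left] at h2
    linarith
  have hc := continuous_edgeFun h hh
  have := eq_zero_of_det2 (F := fun u v => max 0 (edgeFun χ (u + v) - edgeFun χ u - edgeFun χ v))
    (by fun_prop) (fun u v huv => max_eq_left ?_) p q
  · have := max_eq_left_iff.1 this
    linarith
  · rcases lt_or_gt_of_ne huv with hd | hd
    · have := key v u (by simp only [det2] at hd ⊢; linarith)
      rw [add_comm v u] at this
      linarith
    · have := key u v hd
      linarith

/-- A sublinear function on the plane is, up to a rotation, a support function. -/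
theorem exists_body_of_sublinear {h : ℂ → ℝ} (hadd : ∀ p q, h (p + q) ≤ h p + h q)
    (hsmul : ∀ p, ∀ t : ℝ, 0 ≤ t → h (t • p) = t * h p) :
    ∃ N : ConvexBody ℂ, (∀ x ∈ N, ∀ u, det2 x u ≤ h u) ∧ ∀ u, ∃ x ∈ N, det2 x u = h u := by
  have h0 : h 0 = 0 := by simpa using hsmul 0 0 le_rfl
  set S : Set ℂ := {x | ∀ u, det2 x u ≤ h u} with hS
  have hext : ∀ u, u ≠ 0 → ∃ x ∈ S, det2 x u = h u := by
    intro u hu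
    obtain ⟨g, hg, hgle⟩ := exists_extension_of_le_sublinear
      (LinearPMap.mkSpanSingleton (K := ℝ) u (h u) hu) h (fun c hc x => hsmul x c hc.le) hadd (by
        rintro ⟨x, hx⟩
        obtain ⟨t, rfl⟩ := Submodule.mem_span_singleton.1 hx
        rw [LinearPMap.mkSpanSingleton'_apply, smul_eq_mul, RingHom.id_apply]
        rcases le_total 0 t with ht | ht
        · exact (hsmul u t ht).ge
        · have h1 := hadd u (-u)
          rw [add_neg_cancel, h0] at h1
          have h2 := hsmul (-u) (-t) (by linarith)
          rw [smul_neg, neg_smul, neg_neg] at h2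
          change t * h u ≤ h (t • u)
          rw [h2]
          nlinarith)
    have hdet : ∀ v, det2 ⟨g Complex.I, -g 1⟩ v = g v := by
      intro v
      have : v = v.re • (1 : ℂ) + v.im • Complex.I := by apply Complex.ext <;> simp
      conv_rhs => rw [this, map_add, map_smul, map_smul]
      simp only [det2, smul_eq_mul]
      ring
    refine ⟨⟨g Complex.I, -g 1⟩, fun v => (hdet v).trans_le (hgle v), ?_⟩
    rw [hdet]
    have := hg ⟨u, Submodule.mem_span_singleton_self u⟩
    rw [this]
    exact LinearPMap.mkSpanSingleton_apply ℝ ℝ hu (h u)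
  have hconv : Convex ℝ S := by
    intro x hx y hy a b ha hb hab u
    have h1 := mul_le_mul_of_nonneg_left (hx u) ha
    have h2 := mul_le_mul_of_nonneg_left (hy u) hb
    have : h u = a * h u + b * h u := by rw [← add_mul, hab, one_mul]
    rw [this]
    refine le_trans (le_of_eq ?_) (add_le_add h1 h2)
    simp [det2]; ring
  have hclosed : IsClosed S := by
    rw [hS, Set.ofPred_forall]
    exact isClosed_iInter fun u => isClosed_le (by unfold det2; fun_prop) continuous_const
  have hbdd : Bornology.IsBounded S := by
    refine ((Metric.isBounded_Icc (-h (-Complex.I)) (h Complex.I)).reProdIm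
      (Metric.isBounded_Icc (-h 1) (h (-1)))).subset fun x hx => ?_
    have h1 := hx Complex.I
    have h2 := hx (-Complex.I)
    have h3 := hx 1
    have h4 := hx (-1)
    simp [det2] at h1 h2 h3 h4
    simp only [Complex.mem_reProdIm, Set.mem_Icc]
    exact ⟨⟨by linarith, by linarith⟩, by linarith, by linarith⟩
  obtain ⟨x₀, hx₀, -⟩ := hext 1 one_ne_zero
  refine ⟨⟨S, hconv, Metric.isCompact_of_isClosed_isBounded hclosed hbdd, ⟨x₀, hx₀⟩⟩,
    fun x hx => hx, fun u => ?_⟩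
  by_cases hu : u = 0
  · exact ⟨x₀, hx₀, by simp [hu, det2, h0]⟩
  · exact hext u hu

theorem mem_tri_of_nonneg {p r : ℂ} {a b : ℝ} (ha : 0 ≤ a) (hb : 0 ≤ b) {ρ : ℝ} (hab : a + b ≤ ρ) :
    a • p + b • r ∈ ρ • tri p r := by
  rcases (add_nonneg ha hb |>.trans hab).eq_or_lt with h | h
  · have h1 : a = 0 := by linarith
    have h2 : b = 0 := by linarith
    subst h1 h2
    rw [← h, zero_smul', zero_smul, zero_smul, add_zero]
    exact Set.mem_singleton 0
  · refine ⟨(a / ρ) • p + (b / ρ) • r, ?_, ?_⟩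
    · change _ ∈ ((tri p r : ConvexBody ℂ) : Set ℂ)
      rw [tri, coe_hull (Set.toFinite _) (by simp), Set.insert_comm, Set.pair_comm,
        mem_convexHull_insert_insert_iff (by simp)]
      refine ⟨0, by simp, a / ρ, b / ρ, 1 - a / ρ - b / ρ, by positivity, by positivity, ?_,
        by ring, by simp⟩
      rw [sub_sub, ← add_div, sub_nonneg]
      exact (div_le_one h).2 hab
    · simp only [smul_add, smul_smul]
      rw [mul_div_cancel₀ _ h.ne', mul_div_cancel₀ _ h.ne']

theorem exists_mix2_eq (h : CTVal χ) (hh : HomDeg χ 1) (ht : TriIneq χ) :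
    ∃ N, ∀ K, χ K = mix2 N K := by
  obtain ⟨N, hN, hN'⟩ := exists_body_of_sublinear (edgeFun_add_le h hh ht)
    fun p t ht => edgeFun_smul h hh p ht
  have htri : ∀ p r, 0 < det2 p r → mix2 N (tri p r) ≤ χ (tri p r) := by
    intro p r hd
    rw [h.tri_eq hh hd]
    set H := edgeFun χ p + edgeFun χ (r - p) + edgeFun χ (-r) with hH
    set d := det2 p r with hd'
    set y := (-(edgeFun χ (-r) / d)) • p + (-(edgeFun χ p / d)) • r with hy
    have hsub : (N : Set ℂ) ⊆ ((H / d) • tri p r + pt y : ConvexBody ℂ) := by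
      intro x hx
      have h1 := hN x hx (-r)
      have h2 := hN x hx p
      have h3 := hN x hx (r - p)
      change x ∈ (H / d) • tri p r + pt y
      rw [mem_add_pt]
      have : x - y = ((det2 x r + edgeFun χ (-r)) / d) • p
          + ((det2 p x + edgeFun χ p) / d) • r := by
        have : x = (det2 x r / d) • p + (det2 p x / d) • r := by
          apply Complex.ext
          · simp only [Complex.add_re, Complex.smul_re, smul_eq_mul]
            field_simp
            simp only [hd', det2]; ring
          · simp only [Complex.add_im, Complex.smul_im, smul_eq_mul]
            field_simp
            simp only [hd', det2]; ring
        conv_lhs => rw [this, hy]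
        module
      rw [this]
      simp only [det2, Complex.neg_re, Complex.neg_im, Complex.sub_re, Complex.sub_im] at h1 h2 h3
      refine mem_tri_of_nonneg (div_nonneg ?_ hd.le) (div_nonneg ?_ hd.le) ?_
      · simp only [det2]; linarith
      · simp only [det2]; linarith
      · rw [← add_div]
        gcongr
        simp only [det2]; linarith
    have hnn : 0 ≤ H := by
      have h1 := edgeFun_add_le h hh ht p (r - p)
      have h2 := edgeFun_add_neg h hh r
      have h3 := edgeFun_add_le h hh ht r (-r)
      have h4 := edgeFun_smul h hh 0 le_rfl
      rw [zero_smul, zero_mul] at h4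
      rw [add_sub_cancel] at h1
      rw [add_neg_cancel, h4] at h3
      linarith
    calc mix2 N (tri p r) = mix2 (tri p r) N := mix2_comm _ _
      _ ≤ mix2 (tri p r) ((H / d) • tri p r + pt y) := mix2_mono hsub
      _ = H / d * mix2 (tri p r) (tri p r) := by
        rw [(mix2_ctval _).add_pt, mix2_homDeg _ _ _ (div_nonneg hnn hd.le), pow_one]
      _ = H := by
        rw [mix2_self, vol_tri, abs_of_pos hd, div_mul_cancel₀ _ hd.ne']
  have hseg : ∀ a, χ (seg a) ≤ mix2 N (seg a) := by
    intro a
    rw [← edgeFun_add_neg h hh]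
    obtain ⟨x, hx, hxa⟩ := hN' a
    obtain ⟨y, hy, hya⟩ := hN' (-a)
    have hsub : ((seg (x - y) + pt y : ConvexBody ℂ) : Set ℂ) ⊆ N := by
      rw [← hull_pair_eq, coe_hull (Set.toFinite _) (by simp)]
      exact convexHull_min (by rintro _ (rfl | rfl) <;> assumption) N.convex
    rw [mix2_comm]
    refine le_trans ?_ (mix2_mono hsub)
    rw [(mix2_ctval _).add_pt, mix2_par]
    refine le_trans (le_of_eq ?_) (neg_le_abs _)
    rw [← hxa, ← hya]
    simp only [det2, Complex.neg_re, Complex.neg_im, Complex.sub_re, Complex.sub_im]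
    ring
  have hD := h.sub (mix2_ctval N)
  have hDh : HomDeg (fun K => χ K - mix2 N K) 1 := fun K t ht => by
    simp only
    rw [hh K t ht, mix2_homDeg N K t ht, mul_sub]
  have hzero : ∀ p r, 0 < det2 p r → χ (tri p r) - mix2 N (tri p r) = 0 := by
    intro p r hd
    have h1 := htri p r hd
    have h2 := htri r (r - p) (by simp [det2] at hd ⊢; linarith)
    have h3 := hD.tri_add hDh p r
    have h4 := hseg p
    have h5 := hseg r
    have h6 := hseg (r - p)
    rw [tri_comm] at h2
    linarith
  have hT : ∀ p r, χ (tri p r) - mix2 N (tri p r) = 0 := by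
    refine eq_zero_of_det2 (F := fun p r => χ (tri p r) - mix2 N (tri p r)) ?_ fun p r hd => ?_
    · exact hD.cont.comp (continuous_tri continuous_fst continuous_snd)
    · rcases lt_or_gt_of_ne hd with hd | hd
      · simp only [tri_comm p r]
        exact hzero r p (by simp only [det2] at hd ⊢; linarith)
      · exact hzero p r hd
  have hall : ∀ a b c : ℂ, χ (hull {a, b, c}) - mix2 N (hull {a, b, c}) = 0 := fun a b c => by
    have := hD.hull_triple a b c
    exact this.trans (hT _ _)
  refine ⟨N, fun K => sub_eq_zero.1 (hD.eq_zero_of_simplices (fun s hs hcard => ?_) K)⟩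
  rw [Complex.finrank_real_complex] at hcard
  have h1 : 1 ≤ s.card := hs.card_pos
  interval_cases hc : s.card
  · obtain ⟨a, rfl⟩ := Finset.card_eq_one.1 hc
    simpa using hall a a a
  · obtain ⟨a, b, -, rfl⟩ := Finset.card_eq_two.1 hc
    simpa using hall a a b
  · obtain ⟨a, b, c, -, -, -, rfl⟩ := Finset.card_eq_three.1 hc
    simpa using hall a b c

end PlanarFunctionals

section SupportFunction

variable {V V' : Type*} [NormedAddCommGroup V] [NormedSpace ℝ V]
  [NormedAddCommGroup V'] [NormedSpace ℝ V']

theorem le_hSupp {K : ConvexBody V} {p : V → ℝ} (hp : Continuous p) {x : V} (hx : x ∈ K) :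
    p x ≤ hSupp K p :=
  le_csSup (K.isCompact.image hp).bddAbove (Set.mem_image_of_mem _ hx)

theorem hSupp_le {K : ConvexBody V} {p : V → ℝ} {c : ℝ} (h : ∀ x ∈ K, p x ≤ c) : hSupp K p ≤ c :=
  csSup_le (K.nonempty.image _) (Set.forall_mem_image.2 h)

theorem exists_hSupp_eq (K : ConvexBody V) {p : V → ℝ} (hp : Continuous p) :
    ∃ x ∈ K, hSupp K p = p x := by
  obtain ⟨x, hx, h⟩ := K.isCompact.exists_isMaxOn K.nonempty hp.continuousOn
  exact ⟨x, hx, le_antisymm (hSupp_le fun y hy => h hy) (le_hSupp hp hx)⟩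

theorem hSupp_add (K L : ConvexBody V) (p : V →L[ℝ] ℝ) :
    hSupp (K + L) p = hSupp K p + hSupp L p := by
  apply le_antisymm
  · refine hSupp_le fun x hx => ?_
    obtain ⟨a, ha, b, hb, rfl⟩ := mem_add_iff.1 hx
    rw [map_add]
    exact add_le_add (le_hSupp p.continuous ha) (le_hSupp p.continuous hb)
  · obtain ⟨a, ha, ha'⟩ := exists_hSupp_eq K p.continuous
    obtain ⟨b, hb, hb'⟩ := exists_hSupp_eq L p.continuous
    rw [ha', hb', ← map_add]
    exact le_hSupp p.continuous (mem_add_iff.2 ⟨a, ha, b, hb, rfl⟩)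

theorem hSupp_mapCLM (f : V →L[ℝ] V') (K : ConvexBody V) (p : V' → ℝ) :
    hSupp (K.mapCLM f) p = hSupp K fun x => p (f x) := by
  rw [hSupp, hSupp, coe_mapCLM, Set.image_image]

theorem hSupp_smul (K : ConvexBody V) (p : V →L[ℝ] ℝ) {t : ℝ} (ht : 0 ≤ t) :
    hSupp (t • K) p = t * hSupp K p := by
  apply le_antisymm
  · refine hSupp_le fun x hx => ?_
    obtain ⟨a, ha, rfl⟩ := mem_smul_iff.1 hx
    simp only [map_smul, smul_eq_mul]
    exact mul_le_mul_of_nonneg_left (le_hSupp p.continuous ha) ht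
  · obtain ⟨a, ha, ha'⟩ := exists_hSupp_eq K p.continuous
    rw [ha', ← smul_eq_mul, ← map_smul]
    exact le_hSupp p.continuous (mem_smul_iff.2 ⟨a, ha, rfl⟩)

theorem hSupp_const_mul (K : ConvexBody V) (p : V → ℝ) {t : ℝ} (ht : 0 ≤ t) :
    hSupp K (fun x => t * p x) = t * hSupp K p := by
  rw [hSupp, hSupp, ← smul_eq_mul t (sSup _), ← Real.sSup_smul_of_nonneg ht]
  congr 1
  ext y
  simp [Set.mem_smul_set]

theorem hSupp_pt (x : V) (p : V → ℝ) : hSupp (pt x) p = p x := by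
  rw [hSupp, coe_pt, Set.image_singleton, csSup_singleton]

theorem hSupp_zero_fun (K : ConvexBody V) : hSupp K (fun _ => 0) = 0 :=
  le_antisymm (hSupp_le fun _ _ => le_rfl) (le_hSupp continuous_const K.nonempty.some_mem)

theorem hSupp_add_fun_le (K : ConvexBody V) {p q : V → ℝ} (hp : Continuous p) (hq : Continuous q) :
    hSupp K (fun x => p x + q x) ≤ hSupp K p + hSupp K q :=
  hSupp_le fun _ hx => add_le_add (le_hSupp hp hx) (le_hSupp hq hx)

theorem subset_of_hSupp_le {K L : ConvexBody V} (h : ∀ p : V →L[ℝ] ℝ, hSupp K p ≤ hSupp L p) :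
    (K : Set V) ⊆ L := by
  intro x hx
  by_contra hxL
  obtain ⟨p, u, hp, hu⟩ := geometric_hahn_banach_closed_point L.convex L.isClosed hxL
  have h1 : hSupp L p ≤ u := hSupp_le fun y hy => (hp y hy).le
  have h2 := le_hSupp p.continuous (show x ∈ K from hx)
  linarith [h p]

theorem eq_of_hSupp_eq {K L : ConvexBody V} (h : ∀ p : V →L[ℝ] ℝ, hSupp K p = hSupp L p) :
    K = L :=
  SetLike.coe_injective
    ((subset_of_hSupp_le fun p => (h p).le).antisymm (subset_of_hSupp_le fun p => (h p).ge))

theorem hSupp_le_add_dist (K L : ConvexBody V) (p : V →L[ℝ] ℝ) :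
    hSupp K p ≤ hSupp L p + ‖p‖ * dist K L := by
  refine hSupp_le fun x hx => ?_
  obtain ⟨y, hy, hxy⟩ := exists_dist_le K L hx
  have h1 := le_hSupp p.continuous hy
  have h2 : p x - p y ≤ ‖p‖ * dist x y := by
    rw [← map_sub, dist_eq_norm]
    exact (le_abs_self _).trans (p.le_opNorm _)
  have h3 := mul_le_mul_of_nonneg_left hxy (norm_nonneg p)
  linarith

theorem continuous_hSupp_left (p : V →L[ℝ] ℝ) : Continuous fun K : ConvexBody V => hSupp K p := by
  refine (LipschitzWith.of_le_add_mul ‖p‖₊ fun K L => ?_).continuous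
  exact hSupp_le_add_dist K L p

theorem continuous_hSupp_right {X : Type*} [TopologicalSpace X] (K : ConvexBody V)
    {F : X → V → ℝ} (hF : Continuous (Function.uncurry F)) : Continuous fun x => hSupp K (F x) :=
  K.isCompact.continuous_sSup hF

theorem CTVal.of_hSupp (p : V →L[ℝ] ℝ) {Z : ConvexBody V' → ConvexBody V} (hc : Continuous Z)
    (ht : IsTranslationInvariant Z) (hv : IsMinkowskiValuation Z) :
    CTVal fun K => hSupp (Z K) p where
  cont := (continuous_hSupp_left p).comp hc
  transl K x := by simp only [ht K x]
  val K L hU hI := by rw [← hSupp_add, hv, hSupp_add]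

end SupportFunction

/-- The real linear functional `c ↦ Re (c * conj α)` on the plane. -/
def circlePairing (α : ℂ) : ℂ →L[ℝ] ℝ :=
  Complex.reCLM.comp (LinearMap.toContinuousLinearMap (LinearMap.mulRight ℝ (starRingEnd ℂ α)))

theorem circlePairing_apply (α c : ℂ) : circlePairing α c = (c * (starRingEnd ℂ) α).re := rfl

theorem coe_circlePairing (α : ℂ) :
    (circlePairing α : ℂ → ℝ) = fun c => (c * (starRingEnd ℂ) α).re := rfl

theorem exists_eq_smul_circlePairing (p : ℂ →L[ℝ] ℝ) :
    ∃ α ∈ Metric.sphere (0 : ℂ) 1, ∃ t : ℝ, 0 ≤ t ∧ p = t • circlePairing α := by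
  set z : ℂ := ⟨p 1, p Complex.I⟩ with hz
  have hp : ∀ c, p c = (c * (starRingEnd ℂ) z).re := by
    intro c
    have : c = c.re • (1 : ℂ) + c.im • Complex.I := by apply Complex.ext <;> simp
    conv_lhs => rw [this, map_add, map_smul, map_smul]
    simp [hz]
  by_cases h0 : z = 0
  · refine ⟨1, by simp, 0, le_rfl, ?_⟩
    ext c
    rw [hp, h0]; simp
  · refine ⟨(‖z‖⁻¹ : ℝ) • z, ?_, ‖z‖, norm_nonneg _, ?_⟩
    · simp [h0]
    · have hn : ‖z‖ ≠ 0 := norm_ne_zero_iff.2 h0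
      ext c
      rw [hp]
      simp [circlePairing_apply]
      field_simp

theorem subset_of_circle {K L : ConvexBody ℂ}
    (h : ∀ α ∈ Metric.sphere (0 : ℂ) 1, hSupp K (circlePairing α) ≤ hSupp L (circlePairing α)) :
    (K : Set ℂ) ⊆ L := by
  refine subset_of_hSupp_le fun p => ?_
  obtain ⟨α, hα, t, ht, rfl⟩ := exists_eq_smul_circlePairing p
  have e : ((t • circlePairing α : ℂ →L[ℝ] ℝ) : ℂ → ℝ) = fun x => t * circlePairing α x := rfl
  rw [e, hSupp_const_mul _ _ ht, hSupp_const_mul _ _ ht]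
  exact mul_le_mul_of_nonneg_left (h α hα) ht

section SurfaceAreaMeasure

open CompactlySupported

/-- The support function of a planar body on the unit circle. -/
def circleSupp (L : ConvexBody ℂ) : C_c(Metric.sphere (0 : ℂ) 1, ℝ) :=
  CompactlySupportedContinuousMap.continuousMapEquiv
    ⟨fun α => hSupp L (circlePairing α), continuous_hSupp_right L (by
      simp only [coe_circlePairing, Function.uncurry_def]; fun_prop)⟩

theorem circleSupp_apply (L : ConvexBody ℂ) (α : Metric.sphere (0 : ℂ) 1) :
    circleSupp L α = hSupp L (circlePairing α) := rfl

theorem circleSupp_add (K L : ConvexBody ℂ) : circleSupp (K + L) = circleSupp K + circleSupp L := by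
  ext α
  exact hSupp_add _ _ _

theorem circleSupp_smul (K : ConvexBody ℂ) {t : ℝ} (ht : 0 ≤ t) :
    circleSupp (t • K) = t • circleSupp K := by
  ext α
  exact hSupp_smul _ _ ht

theorem subset_of_circleSupp_le {K L : ConvexBody ℂ} (h : circleSupp K ≤ circleSupp L) :
    (K : Set ℂ) ⊆ L :=
  subset_of_circle fun α hα => h ⟨α, hα⟩

/-- The closed unit disc. -/
def disc : ConvexBody ℂ :=
  ⟨Metric.closedBall 0 1, convex_closedBall 0 1, isCompact_closedBall 0 1, ⟨0, by simp⟩⟩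

theorem one_le_circleSupp_disc (α : Metric.sphere (0 : ℂ) 1) : 1 ≤ circleSupp disc α := by
  have h1 : ‖(α : ℂ)‖ = 1 := by simp
  have h2 : (α : ℂ) ∈ disc := by
    change (α : ℂ) ∈ Metric.closedBall 0 1
    simp
  refine le_trans (le_of_eq ?_) (le_hSupp (circlePairing α).continuous h2)
  rw [circlePairing_apply, Complex.mul_conj, Complex.normSq_eq_norm_sq, h1]
  simp

/-- The upper bounds for a positive extension of `φ` given by differences of support functions. -/
def supportBounds (φ : ConvexBody ℂ → ℝ) (g : C_c(Metric.sphere (0 : ℂ) 1, ℝ)) : Set ℝ :=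
  {x | ∃ L L' : ConvexBody ℂ, g + circleSupp L' ≤ circleSupp L ∧ x = φ L - φ L'}

theorem smul_le_smul_circle {f g : C_c(Metric.sphere (0 : ℂ) 1, ℝ)} (h : f ≤ g) {t : ℝ}
    (ht : 0 ≤ t) : t • f ≤ t • g :=
  fun α => mul_le_mul_of_nonneg_left (h α) ht

variable {φ : ConvexBody ℂ → ℝ}

theorem exists_abs_le (g : C_c(Metric.sphere (0 : ℂ) 1, ℝ)) :
    ∃ C : ℝ, 0 ≤ C ∧ ∀ α, |g α| ≤ C := by
  obtain ⟨C, hC⟩ := isCompact_univ.exists_bound_of_continuousOn g.continuous.continuousOn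
  exact ⟨max C 0, le_max_right _ _, fun α => (hC α trivial).trans (le_max_left _ _)⟩

theorem supportBounds_nonempty (g : C_c(Metric.sphere (0 : ℂ) 1, ℝ)) :
    (supportBounds φ g).Nonempty := by
  obtain ⟨C, hC, h⟩ := exists_abs_le g
  refine ⟨_, C • disc, 0, fun α => ?_, rfl⟩
  have h1 := one_le_circleSupp_disc α
  have h2 : circleSupp 0 α = 0 := by
    rw [circleSupp_apply, ← pt_zero, hSupp_pt, map_zero]
  simp only [CompactlySupportedContinuousMap.coe_add, Pi.add_apply, circleSupp_smul _ hC,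
    CompactlySupportedContinuousMap.smul_apply, smul_eq_mul, h2]
  nlinarith [(le_abs_self _).trans (h α)]

theorem supportBounds_bddBelow (hadd : ∀ K L, φ (K + L) = φ K + φ L)
    (hmono : ∀ K L : ConvexBody ℂ, (K : Set ℂ) ⊆ L → φ K ≤ φ L)
    (g : C_c(Metric.sphere (0 : ℂ) 1, ℝ)) : BddBelow (supportBounds φ g) := by
  obtain ⟨C, hC, h⟩ := exists_abs_le g
  refine ⟨-φ (C • disc), ?_⟩
  rintro _ ⟨L, L', hle, rfl⟩
  have : circleSupp L' ≤ circleSupp (L + C • disc) := by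
    intro α
    have h1 := one_le_circleSupp_disc α
    have h2 := hle α
    simp only [circleSupp_add, CompactlySupportedContinuousMap.coe_add, Pi.add_apply,
      circleSupp_smul _ hC, CompactlySupportedContinuousMap.smul_apply, smul_eq_mul] at h2 ⊢
    nlinarith [(neg_abs_le _).trans' (neg_le_neg (h α))]
  have := hmono _ _ (subset_of_circleSupp_le this)
  rw [hadd] at this
  linarith

/-- A monotone Minkowski linear functional on planar bodies is given by integration of the support
function. -/
theorem exists_measure_integral_eq (hadd : ∀ K L, φ (K + L) = φ K + φ L)
    (hsmul : ∀ (t : ℝ) K, 0 ≤ t → φ (t • K) = t * φ K)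
    (hmono : ∀ K L : ConvexBody ℂ, (K : Set ℂ) ⊆ L → φ K ≤ φ L) :
    ∃ σ : Measure ℂ, IsFiniteMeasure σ ∧ σ (Metric.sphere (0 : ℂ) 1)ᶜ = 0 ∧
      ∀ L, ∫ α, hSupp L (circlePairing α) ∂σ = φ L := by
  have hbdd := supportBounds_bddBelow hadd hmono
  obtain ⟨Λ, -, hΛ⟩ := exists_extension_of_le_sublinear
    (E := C_c(Metric.sphere (0 : ℂ) 1, ℝ)) (⊥ : _ →ₗ.[ℝ] ℝ) (fun g => sInf (supportBounds φ g))
    (fun c hc g => by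
      rw [← smul_eq_mul, ← Real.sInf_smul_of_nonneg hc.le]
      congr 1
      ext x
      simp only [Set.mem_smul_set, supportBounds, Set.mem_ofPred_eq]
      constructor
      · rintro ⟨L, L', hle, rfl⟩
        refine ⟨_, ⟨c⁻¹ • L, c⁻¹ • L', ?_, rfl⟩, ?_⟩
        · intro α
          have h := mul_le_mul_of_nonneg_left (hle α) (inv_pos.2 hc).le
          change c⁻¹ * (c * g α + circleSupp L' α) ≤ c⁻¹ * circleSupp L α at h
          rw [mul_add, inv_mul_cancel_left₀ hc.ne'] at h
          rwa [circleSupp_smul _ (inv_pos.2 hc).le, circleSupp_smul _ (inv_pos.2 hc).le]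
        · rw [hsmul _ _ (inv_pos.2 hc).le, hsmul _ _ (inv_pos.2 hc).le, smul_eq_mul]
          field_simp
      · rintro ⟨_, ⟨L, L', hle, rfl⟩, rfl⟩
        refine ⟨c • L, c • L', ?_, ?_⟩
        · rw [circleSupp_smul _ hc.le, circleSupp_smul _ hc.le, ← smul_add]
          exact smul_le_smul_circle hle hc.le
        · rw [hsmul _ _ hc.le, hsmul _ _ hc.le, smul_eq_mul]; ring)
    (fun g g' => by
      rw [← csInf_add (supportBounds_nonempty g) (hbdd g) (supportBounds_nonempty g') (hbdd g')]
      refine csInf_le_csInf (hbdd _) ((supportBounds_nonempty g).add (supportBounds_nonempty g')) ?_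
      rintro _ ⟨_, ⟨L, L', hL, rfl⟩, _, ⟨M, M', hM, rfl⟩, rfl⟩
      refine ⟨L + M, L' + M', ?_, ?_⟩
      · rw [circleSupp_add, circleSupp_add, add_add_add_comm]
        exact add_le_add hL hM
      · simp only [hadd]; ring)
    (by
      rintro ⟨x, hx⟩
      have hx0 : x = 0 := (Submodule.mem_bot ℝ).1 hx
      subst hx0
      have : (⊥ : C_c(Metric.sphere (0 : ℂ) 1, ℝ) →ₗ.[ℝ] ℝ) ⟨0, hx⟩ = 0 := rfl
      rw [this]
      refine le_csInf (supportBounds_nonempty _) ?_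
      rintro _ ⟨L, L', hle, rfl⟩
      rw [zero_add] at hle
      exact sub_nonneg.2 (hmono _ _ (subset_of_circleSupp_le hle)))
  have h0 : φ 0 = 0 := by
    have := hadd 0 0
    rw [add_zero] at this
    linarith
  have hs0 : circleSupp 0 = 0 := by
    ext α
    change hSupp 0 (circlePairing α) = 0
    rw [← pt_zero, hSupp_pt, map_zero]
  have hle : ∀ g L L', g + circleSupp L' ≤ circleSupp L → Λ g ≤ φ L - φ L' := fun g L L' h =>
    (hΛ g).trans (csInf_le (hbdd g) ⟨L, L', h, rfl⟩)
  have hval : ∀ L, Λ (circleSupp L) = φ L := by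
    intro L
    have h1 := hle (circleSupp L) L 0 (by rw [hs0, add_zero])
    have h2 := hle (-circleSupp L) 0 L (by rw [hs0, neg_add_cancel])
    rw [map_neg] at h2
    linarith
  let Λ' : C_c(Metric.sphere (0 : ℂ) 1, ℝ) →ₚ[ℝ] ℝ :=
    { Λ with
      monotone' := fun f g hfg => by
        have := hle (f - g) 0 0 (by rw [hs0, add_zero]; exact sub_nonpos.2 hfg)
        rw [map_sub, h0, sub_zero] at this
        exact sub_nonpos.1 this }
  set ν := RealRMK.rieszMeasure Λ' with hν
  have hemb : MeasurableEmbedding (Subtype.val : Metric.sphere (0 : ℂ) 1 → ℂ) :=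
    MeasurableEmbedding.subtype_coe Metric.isClosed_sphere.measurableSet
  refine ⟨ν.map Subtype.val, inferInstance, ?_, fun L => ?_⟩
  · rw [hemb.map_apply]
    have : (Subtype.val : Metric.sphere (0 : ℂ) 1 → ℂ) ⁻¹' (Metric.sphere (0 : ℂ) 1)ᶜ = ∅ := by
      ext x; simp
    rw [this, measure_empty]
  · rw [hemb.integral_map]
    exact (RealRMK.integral_rieszMeasure Λ' (circleSupp L)).trans (hval L)

theorem exists_isSurfaceAreaMeasure (M : ConvexBody ℂ) :
    ∃ σ : Measure ℂ, IsSurfaceAreaMeasure M σ := by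
  obtain ⟨σ, h1, h2, h3⟩ := exists_measure_integral_eq (φ := mix2 M) (mix2_add M)
    (fun t K ht => by rw [mix2_homDeg M K t ht, pow_one]) (fun K L h => mix2_mono h)
  refine ⟨σ, h1, h2, fun L => ?_⟩
  rw [two_mul_mixedVol]
  exact h3 L

end SurfaceAreaMeasure

section MixedVolumeOfThree

variable {V V' : Type*} [NormedAddCommGroup V] [NormedSpace ℝ V] [MeasurableSpace V] [BorelSpace V]
  [FiniteDimensional ℝ V] (μ : Measure V) [μ.IsAddHaarMeasure]

/-- The coefficient of `s ^ 3` in the polynomial `s ↦ μ (s K + N)`; in dimension four this is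
`4 V(K, K, K, N)`. -/
def mix3 (N K : ConvexBody V) : ℝ := homComp (fun K => vol μ (K + N)) 3 K

theorem mix3_ctval (N : ConvexBody V) : CTVal (mix3 μ N) := ((vol_ctval μ).comp_add N).homComp 3

theorem mix3_homDeg (hV : finrank ℝ V ≤ 4) (N : ConvexBody V) : HomDeg (mix3 μ N) 3 :=
  ((vol_ctval μ).comp_add N).homComp_homDeg hV 3

theorem mix3_mapCLM (f : V →L[ℝ] V) (N K : ConvexBody V) :
    mix3 μ (N.mapCLM f) (K.mapCLM f) = |LinearMap.det (f : V →ₗ[ℝ] V)| * mix3 μ N K :=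
  homComp_mapCLM (fun K => by rw [← mapCLM_add, vol_mapCLM]) 3 K

theorem mix3_smul (hV : finrank ℝ V = 4) (N K : ConvexBody V) {t : ℝ} (ht : 0 < t) :
    mix3 μ (t • N) K = t * mix3 μ N K := by
  have h := mix3_mapCLM μ (t • ContinuousLinearMap.id ℝ V) N K
  rw [← smul_eq_mapCLM, ← smul_eq_mapCLM, mix3_homDeg μ hV.le _ K t ht.le] at h
  have hd : LinearMap.det ((t • ContinuousLinearMap.id ℝ V : V →L[ℝ] V) : V →ₗ[ℝ] V) = t ^ 4 := by
    rw [ContinuousLinearMap.toLinearMap_smul, LinearMap.det_smul, hV]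
    simp
  rw [hd, abs_of_pos (by positivity)] at h
  have : t ^ 3 * (mix3 μ (t • N) K - t * mix3 μ N K) = 0 := by linarith
  have := (mul_eq_zero.1 this).resolve_left (by positivity)
  linarith

theorem mix3_zero (hV : finrank ℝ V = 4) (K : ConvexBody V) : mix3 μ 0 K = 0 := by
  have h : ∀ n : ℕ, vol μ ((n : ℝ) • K + 0)
      = 0 + 0 * n + 0 * (n : ℝ) ^ 2 + 0 * (n : ℝ) ^ 3 + vol μ K * (n : ℝ) ^ 4 := fun n => by
    rw [add_zero, vol_homDeg μ K n n.cast_nonneg, hV]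
    ring
  exact (interpCoeff_poly h).2.2.2.1

theorem mixedVol_eq_mix3 (hV : finrank ℝ V = 4) (K N : ConvexBody V) :
    mixedVol μ ![K, K, K, N] = 1 / 4 * mix3 μ N K := mixedVol_four hV μ K N

end MixedVolumeOfThree

section Plane

variable (μ : Measure (ℂ × ℂ)) [μ.IsAddHaarMeasure]

theorem abs_det_mat_diag {t : ℝ} (ht : 0 < t) :
    |LinearMap.det ((mat (t⁻¹ : ℝ) 0 0 t : ℂ × ℂ →L[ℝ] ℂ × ℂ) : ℂ × ℂ →ₗ[ℝ] ℂ × ℂ)| = 1 := by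
  have : ((mat (t⁻¹ : ℝ) 0 0 t : ℂ × ℂ →L[ℝ] ℂ × ℂ) : ℂ × ℂ →ₗ[ℝ] ℂ × ℂ)
      = LinearMap.prodMap (t⁻¹ • LinearMap.id) (t • LinearMap.id) := by
    ext p <;> simp
  rw [this, LinearMap.det_prodMap, LinearMap.det_smul, LinearMap.det_smul,
    Complex.finrank_real_complex]
  simp only [LinearMap.det_id]
  rw [show (t⁻¹ ^ 2 * 1 * (t ^ 2 * 1) : ℝ) = 1 by field_simp, abs_one]

theorem mix3_diagCov (N : ConvexBody ℂ) : DiagCov (mix3 μ (N.mapCLM inl2)) := by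
  intro t ht K
  have h := mix3_mapCLM μ (mat (t⁻¹ : ℝ) 0 0 t) (t • N.mapCLM inl2) K
  rw [abs_det_mat_diag ht, one_mul, mix3_smul μ finrank_plane _ _ ht] at h
  rw [← h, smul_eq_mapCLM, mapCLM_mapCLM, mapCLM_mapCLM]
  congr 2
  ext z
  · simp [ht.ne']
  · simp

theorem coe_prodBody (A B : ConvexBody ℂ) : (prodBody A B : Set (ℂ × ℂ)) = (A : Set ℂ) ×ˢ B := by
  ext ⟨x, y⟩
  simp only [prodBody, coe_add, coe_mapCLM, Set.mem_add, Set.mem_image, Set.mem_prod]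
  constructor
  · rintro ⟨_, ⟨a, ha, rfl⟩, _, ⟨b, hb, rfl⟩, h⟩
    simp only [ContinuousLinearMap.inl_apply, ContinuousLinearMap.inr_apply, Prod.mk_add_mk,
      add_zero, zero_add, Prod.mk.injEq] at h
    exact ⟨h.1 ▸ ha, h.2 ▸ hb⟩
  · rintro ⟨hx, hy⟩
    exact ⟨_, ⟨x, hx, rfl⟩, _, ⟨y, hy, rfl⟩, by simp⟩

theorem exists_vol_prodBody : ∃ c : ℝ, 0 < c ∧ ∀ A B,
    vol μ (prodBody A B) = c * (vol volume A * vol volume B) := by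
  have h := Measure.isAddLeftInvariant_eq_smul μ ((volume : Measure ℂ).prod (volume : Measure ℂ))
  have hpos := Measure.addHaarScalarFactor_pos_of_isAddHaarMeasure μ
    ((volume : Measure ℂ).prod (volume : Measure ℂ))
  refine ⟨_, NNReal.coe_pos.2 hpos, fun A B => ?_⟩
  have e : vol μ (prodBody A B) = ((μ.addHaarScalarFactor ((volume : Measure ℂ).prod volume)
      • (volume : Measure ℂ).prod volume) (prodBody A B : Set (ℂ × ℂ))).toReal := by rw [← h, vol]
  rw [e, coe_prodBody, Measure.smul_apply, ENNReal.smul_def, smul_eq_mul, Measure.prod_prod,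
    ENNReal.toReal_mul,
    ENNReal.toReal_mul]
  rfl

theorem exists_mix3_prodBody : ∃ c : ℝ, 0 < c ∧ ∀ N A : ConvexBody ℂ,
    mix3 μ (N.mapCLM inl2) (prodBody A square) = c * mix2 N A := by
  obtain ⟨c, hc, h⟩ := exists_vol_prodBody μ
  refine ⟨c, hc, fun N A => ?_⟩
  have e : ∀ n : ℕ, vol μ ((n : ℝ) • prodBody A square + N.mapCLM inl2)
      = 0 + 0 * n + c * vol volume N * (n : ℝ) ^ 2 + c * mix2 N A * (n : ℝ) ^ 3
        + c * vol volume A * (n : ℝ) ^ 4 := fun n => by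
    have hn : (0 : ℝ) ≤ n := n.cast_nonneg
    have h₁ : (n : ℝ) • prodBody A square + N.mapCLM inl2
        = prodBody ((n : ℝ) • A + N) ((n : ℝ) • square) := by
      have : (n : ℝ) • prodBody A square = prodBody ((n : ℝ) • A) ((n : ℝ) • square) := by
        rw [← prodBody_mapCLM, smul_eq_mapCLM]
        congr 1
        ext z <;> simp
      rw [this, prodBody, prodBody, mapCLM_add]
      abel
    have h₂ := mix2_homDeg N A n hn
    rw [mix2, vol_homDeg_two A n hn] at h₂
    have h₃ : vol volume ((n : ℝ) • A + N) = n ^ 1 * mix2 N A + n ^ 2 * vol volume A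
      + vol volume N := by linarith
    rw [h₁, h, h₃, vol_homDeg_two _ n hn, square, vol_square]
    ring
  exact (interpCoeff_poly e).2.2.2.1

end Plane

theorem ConvexBody.mapCLM_zero {V V' : Type*} [NormedAddCommGroup V] [NormedSpace ℝ V]
    [NormedAddCommGroup V'] [NormedSpace ℝ V'] (K : ConvexBody V) :
    K.mapCLM (0 : V →L[ℝ] V') = 0 := by
  refine SetLike.coe_injective ?_
  rw [coe_mapCLM, coe_zero]
  exact K.nonempty.image_const 0

section PlaneCovariance

variable (μ : Measure (ℂ × ℂ)) [μ.IsAddHaarMeasure]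

/-- The map `x ↦ conj (det (x, w))`. -/
def conjDet (w : ℂ × ℂ) : ℂ × ℂ →L[ℝ] ℂ :=
  (Complex.conjCLE : ℂ →L[ℝ] ℂ).comp
    (w.2 • ContinuousLinearMap.fst ℝ ℂ ℂ - w.1 • ContinuousLinearMap.snd ℝ ℂ ℂ)

@[simp] theorem conjDet_apply (w x : ℂ × ℂ) :
    conjDet w x = (starRingEnd ℂ) (w.2 * x.1 - w.1 * x.2) := by simp [conjDet]

/-- The map `c ↦ c • w`. -/
def smulVec (w : ℂ × ℂ) : ℂ →L[ℝ] ℂ × ℂ :=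
  inl2.comp (w.1 • ContinuousLinearMap.id ℝ ℂ) + inr2.comp (w.2 • ContinuousLinearMap.id ℝ ℂ)

@[simp] theorem smulVec_apply (w : ℂ × ℂ) (c : ℂ) : smulVec w c = (w.1 * c, w.2 * c) := by
  simp [smulVec]

theorem abs_det_mat {a b c d : ℂ} (h : a * d - b * c = 1) :
    |LinearMap.det ((mat a b c d : ℂ × ℂ →L[ℝ] ℂ × ℂ) : ℂ × ℂ →ₗ[ℝ] ℂ × ℂ)| = 1 := by
  have : ((mat a b c d : ℂ × ℂ →L[ℝ] ℂ × ℂ) : ℂ × ℂ →ₗ[ℝ] ℂ × ℂ)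
      = (Matrix.toLin (Basis.finTwoProd ℂ) (Basis.finTwoProd ℂ)
          !![a, b; c, d]).restrictScalars ℝ := by
    ext p <;> simp [Matrix.toLin_finTwoProd_apply]
  rw [this, LinearMap.det_restrictScalars, LinearMap.det_toLin, Matrix.det_fin_two_of, h]
  simp

/-- The support function of `D_M K + (Φ⁻¹ ∘ Π_N) K` in coordinates. -/
def modelFun (M N : ConvexBody ℂ) (K : ConvexBody (ℂ × ℂ)) (w : ℂ × ℂ) : ℝ :=
  mix2 M (K.mapCLM (conjDet w)) + 1 / 4 * mix3 μ (N.mapCLM (smulVec w)) K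

theorem modelFun_mat (M N : ConvexBody ℂ) {a b c d : ℂ} (h : a * d - b * c = 1)
    (K : ConvexBody (ℂ × ℂ)) (w : ℂ × ℂ) :
    modelFun μ M N (K.mapCLM (mat a b c d)) (mat a b c d w) = modelFun μ M N K w := by
  have h₁ : (conjDet (mat a b c d w)).comp (mat a b c d) = conjDet w := by
    refine ContinuousLinearMap.ext fun x => ?_
    simp only [ContinuousLinearMap.comp_apply, conjDet_apply, mat_apply]
    congr 1
    linear_combination (w.2 * x.1 - w.1 * x.2) * h
  have h₂ : smulVec (mat a b c d w) = (mat a b c d).comp (smulVec w) := by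
    refine ContinuousLinearMap.ext fun x => ?_
    simp only [ContinuousLinearMap.comp_apply, smulVec_apply, mat_apply, Prod.mk.injEq]
    constructor <;> ring
  rw [modelFun, modelFun, mapCLM_mapCLM, h₁, h₂, ← mapCLM_mapCLM, mix3_mapCLM, abs_det_mat h,
    one_mul]

theorem modelFun_zero (M N : ConvexBody ℂ) (K : ConvexBody (ℂ × ℂ)) : modelFun μ M N K 0 = 0 := by
  have h₁ : conjDet 0 = 0 := ContinuousLinearMap.ext fun x => by simp
  have h₂ : smulVec 0 = 0 := ContinuousLinearMap.ext fun x => by simp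
  rw [modelFun, h₁, h₂, mapCLM_zero, mapCLM_zero, mix3_zero μ finrank_plane,
    (mix2_homDeg M).zero_body one_ne_zero]
  simp

namespace CovFun

variable {f : ConvexBody (ℂ × ℂ) → ℂ × ℂ → ℝ}

theorem exists_homComp_one (hf : CovFun f) : ∃ M : ConvexBody ℂ, ∀ K : ConvexBody (ℂ × ℂ),
    homComp (fun K => f K (1, 0)) 1 K = mix2 M (K.mapCLM (conjDet (1, 0))) := by
  set φ := homComp (fun K => f K (1, 0)) 1 with hφ
  set r : ℂ →L[ℝ] ℂ := -(Complex.conjCLE : ℂ →L[ℝ] ℂ) with hr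
  have hval := ((hf.homComp_val 1 (1, 0)).comp_map inr2).comp_map r
  obtain ⟨M, hM⟩ := exists_mix2_eq (χ := fun B => φ ((B.mapCLM r).mapCLM inr2)) hval
    (fun B t ht => by
      have := hf.homComp_homDeg 1 (1, 0) ((B.mapCLM r).mapCLM inr2) t ht
      rwa [← mapCLM_smul, ← mapCLM_smul] at this)
    (fun a b => by
      have := hf.triIneq_one (r a) (r b)
      rw [← map_add, ← mapCLM_tri, ← mapCLM_tri, ← mapCLM_seg] at this
      exact this)
  refine ⟨M, fun K => ?_⟩
  have h₂ : (K.mapCLM (conjDet (1, 0))).mapCLM r = K.mapCLM (ContinuousLinearMap.snd ℝ ℂ ℂ) := by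
    rw [mapCLM_mapCLM]
    refine congrArg (mapCLM · K) (ContinuousLinearMap.ext fun x => ?_)
    simp [hr]
  rw [← hM, h₂]
  exact hf.homComp_one_proj K

theorem exists_homComp_three (hf : CovFun f) : ∃ N : ConvexBody ℂ, ∀ K : ConvexBody (ℂ × ℂ),
    homComp (fun K => f K (1, 0)) 3 K = 1 / 4 * mix3 μ (N.mapCLM inl2) K := by
  obtain ⟨c, hc, h⟩ := exists_mix3_prodBody μ
  have hφ := hf.homComp_val 3 (1, 0)
  have hφ₃ := hf.homComp_homDeg 3 (1, 0)
  have hφc := hf.diagCov.homComp 3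
  have hφt := hf.triIneq_three
  set φ := homComp (fun K => f K (1, 0)) 3
  obtain ⟨N, hN⟩ := exists_mix2_eq (χ := fun A => 4 / c * φ (prodBody A square))
    ((hφ.prod_left square).const_mul _)
    (fun A t ht => by
      have := hφc.prod_left_homDeg hφ hφ₃ square A t ht
      simp only at this ⊢
      rw [this]
      ring)
    (fun x y => by
      have := mul_le_mul_of_nonneg_left (hφt x y) (by positivity : (0 : ℝ) ≤ 4 / c)
      simp only at this ⊢
      linarith)
  refine ⟨N, fun K => ?_⟩
  have hm := mix3_ctval μ (N.mapCLM inl2)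
  have hm₃ := mix3_homDeg μ finrank_plane.le (N.mapCLM inl2)
  have hmc := mix3_diagCov μ N
  have := DiagCov.eq_zero_of_prod (χ := fun K => φ K - 1 / 4 * mix3 μ (N.mapCLM inl2) K)
    (fun t ht K => by simp only [hφc t ht K, hmc t ht K]; ring)
    (hφ.sub (hm.const_mul _)) (k := 3)
    (fun K t ht => by simp only [hφ₃ K t ht, hm₃ K t ht]; ring)
    (Or.inr ⟨rfl, fun A u v => by
      have e₁ := hφc.prod_par hφ hφ₃ A u v
      have e₂ := hmc.prod_par hm hm₃ A u v
      have e₃ := hN A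
      simp only [prodBody] at e₁ e₂ e₃
      rw [e₁, e₂]
      have e₄ := h N A
      rw [prodBody] at e₄
      rw [e₄, ← e₃]
      field_simp
      ring⟩) K
  linarith

theorem exists_modelFun (hf : CovFun f) :
    ∃ M N : ConvexBody ℂ, ∀ K w, f K w = modelFun μ M N K w := by
  obtain ⟨M, hM⟩ := hf.exists_homComp_one
  obtain ⟨N, hN⟩ := hf.exists_homComp_three μ
  have key : ∀ K, f K (1, 0) = modelFun μ M N K (1, 0) := fun K => by
    rw [hf.eq_add, hM, hN, modelFun]
    congr 4
    ext z <;> simp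
  have gen : ∀ a b c d : ℂ, a * d - b * c = 1 → ∀ K, f K (a, c) = modelFun μ M N K (a, c) := by
    intro a b c d h K
    have hK : K = (K.mapCLM (mat d (-b) (-c) a)).mapCLM (mat a b c d) := by
      rw [mapCLM_mapCLM, mat_comp, show a * d + b * -c = 1 by linear_combination h,
        show a * -b + b * a = 0 by ring, show c * d + d * -c = 0 by ring,
        show c * -b + d * a = 1 by linear_combination h, mat_one, mapCLM_id]
    have hw : ((a, c) : ℂ × ℂ) = mat a b c d (1, 0) := by simp
    rw [hK, hw, hf.cov a b c d h, modelFun_mat μ M N h, key]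
  refine ⟨M, N, fun K ⟨a, c⟩ => ?_⟩
  by_cases ha : a = 0
  · by_cases hc : c = 0
    · subst ha hc
      exact (hf.apply_zero K).trans (modelFun_zero μ M N K).symm
    · exact gen a (-c⁻¹) c 0 (by field_simp; simp) K
  · exact gen a 0 c a⁻¹ (by field_simp; simp) K

end CovFun

end PlaneCovariance

section SupportConvergence

variable {V : Type*} [NormedAddCommGroup V] [NormedSpace ℝ V]

theorem hSupp_add_clm_le (K : ConvexBody V) (p q : V →L[ℝ] ℝ) :
    hSupp K (p + q : V →L[ℝ] ℝ) ≤ hSupp K p + hSupp K q :=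
  hSupp_add_fun_le K p.continuous q.continuous

theorem hSupp_smul_clm (K : ConvexBody V) (p : V →L[ℝ] ℝ) {t : ℝ} (ht : 0 ≤ t) :
    hSupp K (t • p : V →L[ℝ] ℝ) = t * hSupp K p := hSupp_const_mul K p ht

theorem hSupp_zero_clm (K : ConvexBody V) : hSupp K (0 : V →L[ℝ] ℝ) = 0 := hSupp_zero_fun K

theorem hSupp_le_mul_norm {K : ConvexBody V} {R : ℝ}
    (h : ∀ p : V →L[ℝ] ℝ, ‖p‖ ≤ 1 → hSupp K p ≤ R) (p : V →L[ℝ] ℝ) : hSupp K p ≤ R * ‖p‖ := by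
  rcases eq_or_ne p 0 with rfl | hp
  · rw [hSupp_zero_clm, norm_zero, mul_zero]
  have hn : 0 < ‖p‖ := norm_pos_iff.2 hp
  have h₁ := h (‖p‖⁻¹ • p) (by rw [norm_smul, norm_inv, norm_norm, inv_mul_cancel₀ hn.ne'])
  rw [hSupp_smul_clm K p (by positivity), inv_mul_le_iff₀ hn] at h₁
  linarith

theorem hSupp_le_add_of_net {K L : ConvexBody V} {R η : ℝ} {t : Set (V →L[ℝ] ℝ)}
    (hR : 0 ≤ R) (hK : ∀ p : V →L[ℝ] ℝ, ‖p‖ ≤ 1 → hSupp K p ≤ R)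
    (hL : ∀ p : V →L[ℝ] ℝ, ‖p‖ ≤ 1 → hSupp L p ≤ R)
    (ht : ∀ p : V →L[ℝ] ℝ, ‖p‖ ≤ 1 → ∃ q ∈ t, ‖p - q‖ ≤ η)
    (h : ∀ q ∈ t, hSupp K q ≤ hSupp L q + η) (p : V →L[ℝ] ℝ) (hp : ‖p‖ ≤ 1) :
    hSupp K p ≤ hSupp L p + (2 * R + 1) * η := by
  obtain ⟨q, hq, hpq⟩ := ht p hp
  have h₁ := hSupp_add_clm_le K q (p - q)
  have h₂ := hSupp_add_clm_le L p (q - p)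
  rw [add_sub_cancel] at h₁ h₂
  have h₃ := hSupp_le_mul_norm hK (p - q)
  have h₄ := hSupp_le_mul_norm hL (q - p)
  rw [norm_sub_rev] at h₄
  linarith [h q hq, mul_le_mul_of_nonneg_left hpq hR]

variable [FiniteDimensional ℝ V]

/-- The closed ball of radius `r` as a convex body. -/
def ballBody (V : Type*) [NormedAddCommGroup V] [NormedSpace ℝ V] [FiniteDimensional ℝ V] {r : ℝ}
    (hr : 0 ≤ r) : ConvexBody V :=
  ⟨Metric.closedBall 0 r, convex_closedBall 0 r, isCompact_closedBall 0 r, ⟨0, by simpa⟩⟩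

theorem mem_ballBody {r : ℝ} {hr : 0 ≤ r} {x : V} : x ∈ ballBody V hr ↔ ‖x‖ ≤ r := by
  rw [← mem_closedBall_zero_iff]
  rfl

theorem norm_le_hSupp_ballBody {r : ℝ} (hr : 0 ≤ r) (p : V →L[ℝ] ℝ) :
    r * ‖p‖ ≤ hSupp (ballBody V hr) p := by
  rcases hr.eq_or_lt with rfl | hr'
  · rw [zero_mul]
    simpa using le_hSupp (K := ballBody V hr) p.continuous (x := 0) (mem_ballBody.2 (by simp))
  rw [mul_comm, ← le_div_iff₀ hr']
  have hS : 0 ≤ hSupp (ballBody V hr) p := by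
    simpa using le_hSupp (K := ballBody V hr) p.continuous (x := 0) (mem_ballBody.2 (by simpa))
  refine p.opNorm_le_bound (by positivity) fun x => ?_
  rcases eq_or_ne x 0 with rfl | hx
  · simp
  have hn : 0 < ‖x‖ := norm_pos_iff.2 hx
  have key : ∀ s : ℝ, |s| = 1 → s * p x ≤ hSupp (ballBody V hr) p / r * ‖x‖ := by
    intro s hs
    have := le_hSupp (K := ballBody V hr) p.continuous (x := (s * (r / ‖x‖)) • x)
      (mem_ballBody.2 (by
        rw [norm_smul, norm_mul, Real.norm_eq_abs, hs, norm_div, norm_norm,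
          Real.norm_of_nonneg hr, one_mul, div_mul_cancel₀ _ hn.ne']))
    rw [map_smul, smul_eq_mul] at this
    rw [div_mul_eq_mul_div, le_div_iff₀ hr']
    calc s * p x * r = s * (r / ‖x‖) * p x * ‖x‖ := by field_simp
      _ ≤ _ := mul_le_mul_of_nonneg_right this hn.le
  rw [Real.norm_eq_abs, abs_le]
  constructor
  · linarith [key (-1) (by simp)]
  · linarith [key 1 (by simp)]

theorem exists_near_of_hSupp_le {K L : ConvexBody V} {r : ℝ} (hr : 0 ≤ r)
    (h : ∀ p : V →L[ℝ] ℝ, ‖p‖ ≤ 1 → hSupp K p ≤ hSupp L p + r) :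
    ∀ x ∈ K, ∃ y ∈ L, dist x y ≤ r := by
  intro x hx
  have hsub : (K : Set V) ⊆ (L + ballBody V hr : ConvexBody V) := by
    refine subset_of_hSupp_le fun p => ?_
    rw [hSupp_add]
    refine le_trans ?_ (add_le_add_right (norm_le_hSupp_ballBody hr p) _)
    rcases eq_or_ne p 0 with rfl | hp
    · rw [hSupp_zero_clm, hSupp_zero_clm, norm_zero, mul_zero, add_zero]
    have hn : 0 < ‖p‖ := norm_pos_iff.2 hp
    have h₁ := h (‖p‖⁻¹ • p) (by rw [norm_smul, norm_inv, norm_norm, inv_mul_cancel₀ hn.ne'])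
    rw [hSupp_smul_clm K p (by positivity), hSupp_smul_clm L p (by positivity)] at h₁
    have h₂ := mul_le_mul_of_nonneg_left h₁ hn.le
    field_simp at h₂
    linarith
  obtain ⟨y, hy, z, hz, rfl⟩ := mem_add_iff.1 (hsub hx)
  exact ⟨y, hy, by simpa using mem_ballBody.1 hz⟩

theorem exists_net {η : ℝ} (hη : 0 < η) : ∃ t : Set (V →L[ℝ] ℝ), t.Finite ∧
    ∀ p : V →L[ℝ] ℝ, ‖p‖ ≤ 1 → ∃ q ∈ t, ‖p - q‖ ≤ η := by
  obtain ⟨t, -, ht, h⟩ := (isCompact_closedBall (0 : V →L[ℝ] ℝ) 1).finite_cover_balls hη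
  refine ⟨t, ht, fun p hp => ?_⟩
  obtain ⟨q, hq, hpq⟩ := Set.mem_iUnion₂.1 (h (mem_closedBall_zero_iff.2 hp))
  exact ⟨q, hq, by rw [← dist_eq_norm]; exact (Metric.mem_ball.1 hpq).le⟩

theorem hSupp_le_of_net {K : ConvexBody V} {R : ℝ} {t : Set (V →L[ℝ] ℝ)}
    (ht : ∀ p : V →L[ℝ] ℝ, ‖p‖ ≤ 1 → ∃ q ∈ t, ‖p - q‖ ≤ 1 / 2) (h : ∀ q ∈ t, hSupp K q ≤ R)
    (p : V →L[ℝ] ℝ) (hp : ‖p‖ ≤ 1) : hSupp K p ≤ 2 * R := by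
  have hc : Continuous fun p : V →L[ℝ] ℝ => hSupp K p :=
    continuous_hSupp_right K (by simp only [Function.uncurry_def]; fun_prop)
  obtain ⟨m, hm, hmax⟩ := (isCompact_closedBall (0 : V →L[ℝ] ℝ) 1).exists_isMaxOn
    ⟨0, by simp⟩ hc.continuousOn
  have hmax' : ∀ p : V →L[ℝ] ℝ, ‖p‖ ≤ 1 → hSupp K p ≤ hSupp K m := fun p hp =>
    hmax (mem_closedBall_zero_iff.2 hp)
  obtain ⟨q, hq, hmq⟩ := ht m (mem_closedBall_zero_iff.1 hm)
  have h₁ := hSupp_add_clm_le K q (m - q)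
  rw [add_sub_cancel] at h₁
  have h₂ := hSupp_le_mul_norm hmax' (m - q)
  have h₀ : 0 ≤ hSupp K m := by
    rw [← hSupp_zero_clm K]
    exact hmax' 0 (by simp)
  have h₃ := mul_le_mul_of_nonneg_left hmq h₀
  linarith [h q hq, hmax' p hp]

/-- A map into convex bodies is continuous as soon as all its support functionals are. -/
theorem continuous_of_hSupp {X : Type*} [TopologicalSpace X] {Z : X → ConvexBody V}
    (h : ∀ p : V →L[ℝ] ℝ, Continuous fun x => hSupp (Z x) p) : Continuous Z := by
  rw [continuous_iff_continuousAt]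
  intro x₀
  refine Metric.tendsto_nhds.2 fun ε hε => ?_
  obtain ⟨t, ht, htn⟩ := exists_net (V := V) (η := 1 / 2) (by norm_num)
  obtain ⟨C, hC⟩ := (ht.image fun q : V →L[ℝ] ℝ => hSupp (Z x₀) q).bddAbove
  have hC' : ∀ q ∈ t, hSupp (Z x₀) q ≤ C := fun q hq => hC (Set.mem_image_of_mem _ hq)
  set R := max (2 * (C + 1)) 0 with hR
  have hR₀ : 0 ≤ R := le_max_right _ _
  obtain ⟨t', ht', htn'⟩ := exists_net (V := V) (η := ε / (2 * (2 * R + 1))) (by positivity)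
  have hη : 0 < ε / (2 * (2 * R + 1)) := by positivity
  have ev₁ : ∀ᶠ x in nhds x₀, ∀ q ∈ t, hSupp (Z x) q < C + 1 := by
    rw [ht.eventually_all]
    exact fun q hq => (h q).continuousAt.eventually_lt_const (by linarith [hC' q hq])
  have ev₂ : ∀ᶠ x in nhds x₀, ∀ q ∈ t',
      dist (hSupp (Z x) q) (hSupp (Z x₀) q) < ε / (2 * (2 * R + 1)) := by
    rw [ht'.eventually_all]
    exact fun q hq => Metric.tendsto_nhds.1 (h q).continuousAt _ hη
  filter_upwards [ev₁, ev₂] with x h₁ h₂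
  have hb : ∀ K : ConvexBody V, (∀ q ∈ t, hSupp K q ≤ C + 1) →
      ∀ p : V →L[ℝ] ℝ, ‖p‖ ≤ 1 → hSupp K p ≤ R := fun K hK p hp =>
    (hSupp_le_of_net htn hK p hp).trans (le_max_left _ _)
  have hx := hb (Z x) fun q hq => (h₁ q hq).le
  have hx₀ := hb (Z x₀) fun q hq => by linarith [hC' q hq]
  have hd : ∀ q ∈ t', |hSupp (Z x) q - hSupp (Z x₀) q| ≤ ε / (2 * (2 * R + 1)) := fun q hq =>
    (h₂ q hq).le
  have he : (2 * R + 1) * (ε / (2 * (2 * R + 1))) = ε / 2 := by field_simp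
  have hKL := hSupp_le_add_of_net hR₀ hx hx₀ htn' fun q hq => by linarith [(abs_le.1 (hd q hq)).2]
  have hLK := hSupp_le_add_of_net hR₀ hx₀ hx htn' fun q hq => by linarith [(abs_le.1 (hd q hq)).1]
  rw [he] at hKL hLK
  refine lt_of_le_of_lt (dist_le_of_mem (by positivity) (exists_near_of_hSupp_le (by positivity) hKL)
    fun y hy => ?_) (half_lt_self hε)
  obtain ⟨z, hz, hyz⟩ := exists_near_of_hSupp_le (by positivity) hLK y hy
  exact ⟨z, hz, by rwa [dist_comm]⟩

end SupportConvergence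

section Coordinates

variable {W : Type*} [NormedAddCommGroup W] [NormedSpace ℂ W]
  (b : Basis (Fin 2) ℂ W)

theorem toMatrix_det_eq_one {g : W →ₗ[ℂ] W} (hg : LinearMap.det g = 1) :
    LinearMap.toMatrix b b g 0 0 * LinearMap.toMatrix b b g 1 1
      - LinearMap.toMatrix b b g 0 1 * LinearMap.toMatrix b b g 1 0 = 1 := by
  rw [← Matrix.det_fin_two, LinearMap.det_toMatrix, hg]

theorem apply_smul_eq (p : W →L[ℝ] ℝ) (z : ℂ) (v : W) :
    p (z • v) = (z * (p v - Complex.I * p (Complex.I • v))).re := by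
  have : z • v = z.re • v + z.im • (Complex.I • v) := by
    conv_lhs => rw [← Complex.re_add_im z, add_smul, mul_smul]
    simp only [Complex.coe_smul]
  rw [this, map_add, map_smul, map_smul]
  simp

variable [FiniteDimensional ℂ W]

/-- The coordinates with respect to a basis with two elements. -/
def coordEquiv : W ≃L[ℝ] ℂ × ℂ :=
  ((b.equivFun.trans (LinearEquiv.finTwoArrow ℂ ℂ)).restrictScalars ℝ).toContinuousLinearEquiv

theorem coordEquiv_apply (x : W) : coordEquiv b x = (b.coord 0 x, b.coord 1 x) := rfl

theorem coordEquiv_symm_apply (p : ℂ × ℂ) : (coordEquiv b).symm p = p.1 • b 0 + p.2 • b 1 := by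
  rw [ContinuousLinearEquiv.symm_apply_eq, coordEquiv_apply]
  simp

theorem coord_symm_zero (p : ℂ × ℂ) : b.coord 0 ((coordEquiv b).symm p) = p.1 :=
  congrArg Prod.fst ((coordEquiv b).apply_symm_apply p)

theorem coord_symm_one (p : ℂ × ℂ) : b.coord 1 ((coordEquiv b).symm p) = p.2 :=
  congrArg Prod.snd ((coordEquiv b).apply_symm_apply p)

theorem coordEquiv_map (g : W →ₗ[ℂ] W) (x : W) :
    coordEquiv b (g x) = mat (LinearMap.toMatrix b b g 0 0) (LinearMap.toMatrix b b g 0 1)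
      (LinearMap.toMatrix b b g 1 0) (LinearMap.toMatrix b b g 1 1) (coordEquiv b x) := by
  have h := LinearMap.toMatrix_mulVec_repr b b g x
  have h₀ := congrFun h 0
  have h₁ := congrFun h 1
  simp only [Matrix.mulVec, dotProduct, Fin.sum_univ_two] at h₀ h₁
  rw [mat_apply, coordEquiv_apply, coordEquiv_apply]
  simp only [Basis.coord_apply]
  rw [h₀, h₁]

theorem cdet_map {g : W →ₗ[ℂ] W} (hg : LinearMap.det g = 1) (x w : W) :
    cdet b (g x) (g w) = cdet b x w := by
  have h := toMatrix_det_eq_one b hg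
  have hx := coordEquiv_map b g x
  have hw := coordEquiv_map b g w
  simp only [coordEquiv_apply, mat_apply, Prod.mk.injEq] at hx hw
  simp only [cdet, hx, hw]
  linear_combination (b.coord 0 x * b.coord 1 w - b.coord 1 x * b.coord 0 w) * h

theorem exists_equiv_mat {a c₁ c₂ d : ℂ} (h : a * d - c₁ * c₂ = 1) : ∃ g : W ≃L[ℂ] W,
    LinearMap.det ((g : W →L[ℂ] W) : W →ₗ[ℂ] W) = 1 ∧
      ∀ x, coordEquiv b (g x) = mat a c₁ c₂ d (coordEquiv b x) := by
  set A : Matrix (Fin 2) (Fin 2) ℂ := !![a, c₁; c₂, d] with hA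
  have hdet : LinearMap.det (Matrix.toLin b b A) = 1 := by
    rw [LinearMap.det_toLin, hA, Matrix.det_fin_two_of, h]
  refine ⟨(LinearMap.equivOfDetNeZero (Matrix.toLin b b A) (by simp [hdet])).toContinuousLinearEquiv,
    hdet, fun x => ?_⟩
  have := coordEquiv_map b (Matrix.toLin b b A) x
  rw [LinearMap.toMatrix_toLin] at this
  exact this

/-- The real linear functional `x ↦ Re det(x, w)`. -/
def reDet (w : W) : W →L[ℝ] ℝ := Complex.reCLM.comp (cdetCLM b w)

theorem coe_reDet (w : W) : (reDet b w : W → ℝ) = fun x => (cdet b x w).re := by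
  ext x
  simp [reDet, cdetCLM, cdet, mul_comm]

theorem exists_eq_reDet (p : W →L[ℝ] ℝ) : ∃ w, p = reDet b w := by
  set w := (coordEquiv b).symm (-(p (b 1) - Complex.I * p (Complex.I • b 1)),
    p (b 0) - Complex.I * p (Complex.I • b 0)) with hw
  refine ⟨w, ContinuousLinearMap.ext fun x => ?_⟩
  have e : reDet b w x = (cdet b x w).re := congrFun (coe_reDet b w) x
  rw [e, cdet, hw, coord_symm_zero, coord_symm_one]
  have hx : x = b.coord 0 x • b 0 + b.coord 1 x • b 1 := by
    conv_lhs => rw [← (coordEquiv b).symm_apply_apply x, coordEquiv_symm_apply]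
    rfl
  conv_lhs => rw [hx, map_add, apply_smul_eq p _ (b 0), apply_smul_eq p _ (b 1), ← Complex.add_re]
  congr 1
  simp only
  ring

end Coordinates

section Classification

variable {W : Type*} [NormedAddCommGroup W] [NormedSpace ℂ W] [FiniteDimensional ℂ W]
  (b : Basis (Fin 2) ℂ W)

theorem modelFun_ctval (ν : Measure (ℂ × ℂ)) [ν.IsAddHaarMeasure] (M N : ConvexBody ℂ) (w : ℂ × ℂ) :
    CTVal fun K => modelFun ν M N K w :=
  ((mix2_ctval M).comp_map _).add ((mix3_ctval ν _).const_mul _)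

theorem integral_eq_mix2 {M : ConvexBody ℂ} {σ : Measure ℂ} (h : IsSurfaceAreaMeasure M σ)
    (K : ConvexBody W) (w : W) : ∫ α, hSupp K (fun x => (cdet b (α • x) w).re) ∂σ
      = mix2 M ((K.mapCLM (coordEquiv b : W →L[ℝ] ℂ × ℂ)).mapCLM (conjDet (coordEquiv b w))) := by
  rw [← two_mul_mixedVol, ← h.2.2]
  congr 1
  ext α
  rw [hSupp_mapCLM, hSupp_mapCLM]
  congr 1
  ext x
  simp only [ContinuousLinearEquiv.coe_coe, conjDet_apply, ← map_mul, Complex.conj_re,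
    coordEquiv_apply, cdet, map_smul, smul_eq_mul]
  congr 1
  ring

section Measure

variable [MeasurableSpace W] [BorelSpace W] (μ : Measure W) [μ.IsAddHaarMeasure]

theorem mixedVol_eq_mix3_coord (hW : finrank ℂ W = 2) (N : ConvexBody ℂ) (K : ConvexBody W)
    (w : W) :
    mixedVol μ ![K, K, K, dotBody N w] = 1 / 4 * mix3 (μ.map (coordEquiv b))
      (N.mapCLM (smulVec (coordEquiv b w))) (K.mapCLM (coordEquiv b : W →L[ℝ] ℂ × ℂ)) := by
  have hd : finrank ℝ W = 4 := by rw [finrank_real_of_complex, hW]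
  have hN : N.mapCLM (smulVec (coordEquiv b w))
      = (dotBody N w).mapCLM (coordEquiv b : W →L[ℝ] ℂ × ℂ) := by
    rw [dotBody, mapCLM_mapCLM]
    refine congrArg (mapCLM · N) (ContinuousLinearMap.ext fun c => ?_)
    simp [coordEquiv_apply, mul_comm]
  have hvol : ∀ K : ConvexBody W,
      vol (μ.map (coordEquiv b)) (K.mapCLM (coordEquiv b : W →L[ℝ] ℂ × ℂ)) = vol μ K := fun K => by
    rw [vol, Measure.map_apply (coordEquiv b).continuous.measurable
      (ConvexBody.isClosed _).measurableSet, coe_mapCLM]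
    rw [ContinuousLinearEquiv.coe_coe, Set.preimage_image_eq _ (coordEquiv b).injective, vol]
  rw [mixedVol_eq_mix3 μ hd, hN]
  congr 1
  have := homComp_mapCLM (φ := fun K => vol μ (K + dotBody N w))
    (ψ := fun K => vol (μ.map (coordEquiv b))
      (K + (dotBody N w).mapCLM (coordEquiv b : W →L[ℝ] ℂ × ℂ)))
    (f := (coordEquiv b : W →L[ℝ] ℂ × ℂ)) (c := 1)
    (fun K => by rw [← mapCLM_add, hvol, one_mul]) 3 K
  rw [one_mul] at this
  exact this.symm

theorem rhs_eq_modelFun (hW : finrank ℂ W = 2) {M : ConvexBody ℂ} (N : ConvexBody ℂ)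
    {σ : Measure ℂ} (h : IsSurfaceAreaMeasure M σ) (K : ConvexBody W) (w : W) :
    (∫ α, hSupp K (fun x => (cdet b (α • x) w).re) ∂σ) + mixedVol μ ![K, K, K, dotBody N w]
      = modelFun (μ.map (coordEquiv b)) M N (K.mapCLM (coordEquiv b : W →L[ℝ] ℂ × ℂ))
        (coordEquiv b w) := by
  rw [integral_eq_mix2 b h, mixedVol_eq_mix3_coord b μ hW, modelFun]

end Measure

variable {Z : ConvexBody W → ConvexBody W}

theorem mapCLM_coord_symm (K : ConvexBody W) :
    (K.mapCLM (coordEquiv b : W →L[ℝ] ℂ × ℂ)).mapCLM ((coordEquiv b).symm : ℂ × ℂ →L[ℝ] W) = K := by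
  rw [mapCLM_mapCLM, ContinuousLinearEquiv.coe_symm_comp_coe, mapCLM_id]

theorem covFun_of_covariant (hc : Continuous Z) (ht : IsTranslationInvariant Z)
    (hv : IsMinkowskiValuation Z) (hs : IsSLCovariant Z) :
    CovFun fun K w => hSupp (Z (K.mapCLM ((coordEquiv b).symm : ℂ × ℂ →L[ℝ] W)))
      (reDet b ((coordEquiv b).symm w)) where
  val w := (CTVal.of_hSupp _ hc ht hv).comp_map _
  add_le K w w' := by
    have : reDet b ((coordEquiv b).symm (w + w'))
        = reDet b ((coordEquiv b).symm w) + reDet b ((coordEquiv b).symm w') := by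
      refine ContinuousLinearMap.ext fun x => ?_
      rw [map_add, add_apply]
      simp only [coe_reDet, cdet, map_add, ← Complex.add_re]
      congr 1
      ring
    rw [this]
    exact hSupp_add_clm_le _ _ _
  smul K w t ht := by
    have : reDet b ((coordEquiv b).symm (t • w)) = t • reDet b ((coordEquiv b).symm w) := by
      refine ContinuousLinearMap.ext fun x => ?_
      rw [map_smul, smul_apply]
      have hs : ∀ v : W, t • v = (t : ℂ) • v := fun v => (Complex.coe_smul t v).symm
      simp only [coe_reDet, cdet, hs, map_smul, smul_eq_mul, ← Complex.re_ofReal_mul]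
      congr 1
      ring
    rw [this, hSupp_smul_clm _ _ ht]
  cov a c₁ c₂ d h K w := by
    obtain ⟨g, hg, hge⟩ := exists_equiv_mat b h
    have h₁ : ∀ p, (coordEquiv b).symm (mat a c₁ c₂ d p) = g ((coordEquiv b).symm p) := fun p => by
      rw [ContinuousLinearEquiv.symm_apply_eq, hge, ContinuousLinearEquiv.apply_symm_apply]
    have h₂ : (K.mapCLM (mat a c₁ c₂ d)).mapCLM ((coordEquiv b).symm : ℂ × ℂ →L[ℝ] W)
        = (K.mapCLM ((coordEquiv b).symm : ℂ × ℂ →L[ℝ] W)).mapCLM (cReal (g : W →ₗ[ℂ] W)) := by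
      rw [mapCLM_mapCLM, mapCLM_mapCLM]
      exact congrArg (mapCLM · K) (ContinuousLinearMap.ext h₁)
    rw [h₁, h₂, hs g hg, hSupp_mapCLM]
    congr 1
    ext x
    rw [coe_reDet, coe_reDet]
    exact congrArg Complex.re (cdet_map b hg x _)

theorem covariant_of_modelFun {ν : Measure (ℂ × ℂ)} [ν.IsAddHaarMeasure] {M N : ConvexBody ℂ}
    (h : ∀ K w, hSupp (Z K) (reDet b w)
      = modelFun ν M N (K.mapCLM (coordEquiv b : W →L[ℝ] ℂ × ℂ)) (coordEquiv b w)) :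
    Continuous Z ∧ IsTranslationInvariant Z ∧ IsMinkowskiValuation Z ∧ IsSLCovariant Z := by
  have hval : ∀ w, CTVal fun K => hSupp (Z K) (reDet b w) := fun w => by
    simp only [h]
    exact (modelFun_ctval ν M N _).comp_map _
  have hext : ∀ K L : ConvexBody W, (∀ w, hSupp K (reDet b w) = hSupp L (reDet b w)) → K = L :=
    fun K L hKL => eq_of_hSupp_eq fun p => by
      obtain ⟨w, rfl⟩ := exists_eq_reDet b p
      exact hKL w
  refine ⟨continuous_of_hSupp fun p => ?_, fun K x => hext _ _ fun w => (hval w).transl K x,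
    fun K L hU hI => hext _ _ fun w => ?_, fun g hg K => hext _ _ fun w => ?_⟩
  · obtain ⟨w, rfl⟩ := exists_eq_reDet b p
    exact (hval w).cont
  · rw [hSupp_add, hSupp_add]
    exact (hval w).val K L hU hI
  · obtain ⟨w, rfl⟩ := g.surjective w
    obtain ⟨a, c₁, c₂, d, hd, h₁⟩ : ∃ a c₁ c₂ d : ℂ, a * d - c₁ * c₂ = 1 ∧
        ∀ x, coordEquiv b (g x) = mat a c₁ c₂ d (coordEquiv b x) :=
      ⟨_, _, _, _, toMatrix_det_eq_one b hg, coordEquiv_map b (g : W →ₗ[ℂ] W)⟩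
    have h₂ : (K.mapCLM (cReal (g : W →ₗ[ℂ] W))).mapCLM (coordEquiv b : W →L[ℝ] ℂ × ℂ)
        = (K.mapCLM (coordEquiv b : W →L[ℝ] ℂ × ℂ)).mapCLM
          (mat a c₁ c₂ d) := by
      rw [mapCLM_mapCLM, mapCLM_mapCLM]
      exact congrArg (mapCLM · K) (ContinuousLinearMap.ext h₁)
    rw [h, h₁, h₂, modelFun_mat ν M N hd, ← h, hSupp_mapCLM]
    congr 1
    ext x
    rw [coe_reDet, coe_reDet]
    exact congrArg Complex.re (cdet_map b hg x w).symm

end Classification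

/-- Let `W` be a 2-dimensional complex vector space (with a fixed basis
`b` and a fixed Lebesgue measure `μ`). A map `Z' : 𝒦(W) → 𝒦(W)` is a continuous,
translation invariant and `SL(W,ℂ)`-covariant Minkowski valuation if and only if there are
convex bodies `M, N ⊆ ℂ` with `Z' K = D_M K + (Φ⁻¹ ∘ Π_N) K` for all `K`.  Applying the
determinant identification `Φ : W ≃ W*` (so that equality of two bodies `L, L'` in `W` is
equivalent to `h(Φ L, w) = h(Φ L', w)` for all `w ∈ W`), this says exactly:
`h(Φ(Z' K), w) = ∫_{S¹} h(Φ(α K), w) dS(M, α) + V(K, K, K, N·w)`,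
where `h(Φ(L), w) = sup_{x ∈ L} Re det(x, w)` and
`h(Φ(α K), w) = sup_{x ∈ K} Re det(α x, w)`. -/
theorem covariant_classification_dim_two
    {W : Type*} [NormedAddCommGroup W] [NormedSpace ℂ W] [FiniteDimensional ℂ W]
    (hW : Module.finrank ℂ W = 2) (b : Basis (Fin 2) ℂ W)
    [MeasurableSpace W] [BorelSpace W] (μ : Measure W) [μ.IsAddHaarMeasure]
    (Z' : ConvexBody W → ConvexBody W) :
    (Continuous Z' ∧ IsTranslationInvariant Z' ∧ IsMinkowskiValuation Z' ∧
        IsSLCovariant Z') ↔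
      (∃ (M N : ConvexBody ℂ) (σ : Measure ℂ), IsSurfaceAreaMeasure M σ ∧
        ∀ (K : ConvexBody W) (w : W),
          hSupp (Z' K) (fun x => (cdet b x w).re) =
            (∫ α, hSupp K (fun x => (cdet b (α • x) w).re) ∂σ)
              + mixedVol μ ![K, K, K, dotBody N w]) := by
  simp only [← coe_reDet]
  constructor
  · rintro ⟨hc, ht, hv, hs⟩
    obtain ⟨M, N, h⟩ := (covFun_of_covariant b hc ht hv hs).exists_modelFun (μ.map (coordEquiv b))
    obtain ⟨σ, hσ⟩ := exists_isSurfaceAreaMeasure M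
    refine ⟨M, N, σ, hσ, fun K w => ?_⟩
    rw [rhs_eq_modelFun b μ hW N hσ, ← h, mapCLM_coord_symm, ContinuousLinearEquiv.symm_apply_apply]
  · rintro ⟨M, N, σ, hσ, h⟩
    exact covariant_of_modelFun b fun K w => (h K w).trans (rhs_eq_modelFun b μ hW N hσ K w)
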